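/- Fix an integer r ≥ 3. There exist a real constant d̃'_r (depending only on r) and a constant C > 0 such that for all sufficiently large N one has |η̄_r^+(N) − c̃_r·N^{r/2 − 3/4}·I_{r−3/2}(π√N) − d̃'_r·N^{r/2 − 5/4}·I_{r−5/2}(π√N)| ≤ C·N^{r/2 − 7/4}·e^{π√N}, where c̃_r = 2^{r−5/2}·π^{1−r}·ζ(r)(1−2^{1−r}). -/

import Mathlib

open scoped BigOperators
open Filter MeasureTheory

/-- An overpartition of `n`: a partition of `n` in which the first occurrence of
each part size may be overlined.  We encode it as a finite set of (distinct)
overlined parts together with a multiset of non-overlined parts, all positive,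
with total sum `n`. -/
structure Overpartition (n : ℕ) where
  overlined : Finset ℕ
  nonoverlined : Multiset ℕ
  overlined_pos : ∀ i ∈ overlined, 0 < i
  nonoverlined_pos : ∀ i ∈ nonoverlined, 0 < i
  total : (overlined.sum id) + nonoverlined.sum = n

namespace Overpartition

/-- The multiset of all parts of an overpartition. -/
def parts {n : ℕ} (p : Overpartition n) : Multiset ℕ := p.overlined.val + p.nonoverlined

/-- Dyson's rank of an overpartition: largest part minus number of parts. -/
def rank {n : ℕ} (p : Overpartition n) : ℤ :=
  (p.parts.sup : ℤ) - (Multiset.card p.parts : ℤ)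

end Overpartition

/-- The crank of a partition (given as a multiset of positive parts):
the largest part if there are no 1's, and otherwise `μ(λ) - o(λ)` where `o(λ)`
is the number of 1's and `μ(λ)` is the number of parts larger than `o(λ)`. -/
def multisetCrank (s : Multiset ℕ) : ℤ :=
  if s.count 1 = 0 then (s.sup : ℤ)
  else ((s.filter (fun part => s.count 1 < part)).card : ℤ) - (s.count 1 : ℤ)

/-- The first residual crank of an overpartition: the crank of the subpartition
consisting of the non-overlined parts. -/
def Overpartition.crank {n : ℕ} (p : Overpartition n) : ℤ := multisetCrank p.nonoverlined

/-- `Mbar m n` is the number of overpartitions of `n` with first residual crank `m`. -/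
noncomputable def Mbar (m : ℤ) (n : ℕ) : ℕ :=
  Nat.card {p : Overpartition n // p.crank = m}

/-- `Nbar m n` is the number of overpartitions of `n` with Dyson rank `m`. -/
noncomputable def Nbar (m : ℤ) (n : ℕ) : ℕ :=
  Nat.card {p : Overpartition n // p.rank = m}

/-- The `r`-th positive crank moment `M̄_r^+(N) = Σ_{m ≥ 1} m^r M̄(m,N)`. -/
noncomputable def Mplus (r N : ℕ) : ℝ :=
  ∑' m : ℕ, ((m : ℝ) + 1) ^ r * (Mbar ((m : ℤ) + 1) N : ℝ)

/-- The `r`-th positive rank moment `N̄_r^+(N) = Σ_{m ≥ 1} m^r N̄(m,N)`. -/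
noncomputable def Nplus (r N : ℕ) : ℝ :=
  ∑' m : ℕ, ((m : ℝ) + 1) ^ r * (Nbar ((m : ℤ) + 1) N : ℝ)

/-- Positive symmetrized crank moment `μ̄_r^+(n) = Σ_{m ≥ 1} C(m + ⌊(r-1)/2⌋, r) M̄(m,n)`. -/
noncomputable def mubar (r n : ℕ) : ℝ :=
  ∑' m : ℕ, (Nat.choose (m + 1 + (r - 1) / 2) r : ℝ) * (Mbar ((m : ℤ) + 1) n : ℝ)

/-- Positive symmetrized rank moment `η̄_r^+(n) = Σ_{m ≥ 1} C(m + ⌊(r-1)/2⌋, r) N̄(m,n)`. -/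
noncomputable def etabar (r n : ℕ) : ℝ :=
  ∑' m : ℕ, (Nat.choose (m + 1 + (r - 1) / 2) r : ℝ) * (Nbar ((m : ℤ) + 1) n : ℝ)

/-- The Dirichlet eta function at positive integers:
`η(1) = log 2` and `η(r) = (1 - 2^{1-r}) ζ(r)` for `r ≥ 2`. -/
noncomputable def dirichletEtaNat (r : ℕ) : ℝ :=
  if r = 1 then Real.log 2 else (1 - 2 ^ (1 - (r : ℝ))) * (riemannZeta r).re

/-- The infinite Pochhammer symbol `(a; q)_∞ = Π_{j ≥ 0} (1 - a q^j)`. -/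
noncomputable def poch (a q : ℂ) : ℂ := ∏' j : ℕ, (1 - a * q ^ j)

/-- The (integral) exponent `n²/2 + (r/2 + ρ_C(r)) n`, where `ρ_C(r) = 0` for odd `r`
and `1/2` for even `r`. -/
def eC (r n : ℕ) : ℕ := (n * n + r * n + (if r % 2 = 0 then n else 0)) / 2

/-- The (integral) exponent `n² + (r/2 + ρ_R(r)) n`, where `ρ_R(r) = 1/2` for odd `r`
and `1` for even `r`. -/
def eR (r n : ℕ) : ℕ := (2 * n * n + r * n + (if r % 2 = 1 then n else 2 * n)) / 2

/-- `S_r(q) = Σ_{n ≥ 1} (-1)^{n+1} q^{n²/2 + (r/2 + ρ_C(r)) n} / (1 - q^n)^r`. -/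
noncomputable def Sr (r : ℕ) (q : ℂ) : ℂ :=
  ∑' n : ℕ, (-1 : ℂ) ^ n * q ^ eC r (n + 1) / (1 - q ^ (n + 1)) ^ r

/-- `S̃_r(q) = Σ_{n ≥ 1} (-1)^{n+1} q^{n² + (r/2 + ρ_R(r)) n} / ((1 - q^n)^r (1 + q^n))`. -/
noncomputable def Str (r : ℕ) (q : ℂ) : ℂ :=
  ∑' n : ℕ, (-1 : ℂ) ^ n * q ^ eR r (n + 1) / ((1 - q ^ (n + 1)) ^ r * (1 + q ^ (n + 1)))

/-- `SC_r(q) = ((-q;q)_∞/(q;q)_∞) S_r(q)`, the generating function of the positive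
symmetrized crank moments. -/
noncomputable def SCr (r : ℕ) (q : ℂ) : ℂ := (poch (-q) q / poch q q) * Sr r q

/-- `SR_r(q) = 2 ((-q;q)_∞/(q;q)_∞) S̃_r(q)`, the generating function of the positive
symmetrized rank moments. -/
noncomputable def SRr (r : ℕ) (q : ℂ) : ℂ := 2 * (poch (-q) q / poch q q) * Str r q

/-- `c_r = ζ(r) (1 - 2^{1-r})`. -/
noncomputable def cconst (r : ℕ) : ℂ := riemannZeta r * (1 - 2 ^ (1 - (r : ℂ)))

/-- `d_r = -(ζ(r-2)(1-2^{3-r})/2 + ρ_C(r) ζ(r-1)(1-2^{1-r}))`. -/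
noncomputable def dconst (r : ℕ) : ℂ :=
  -(riemannZeta ((r : ℂ) - 2) * (1 - 2 ^ (3 - (r : ℂ))) / 2 +
    (if r % 2 = 0 then (1 : ℂ) / 2 else 0) * riemannZeta ((r : ℂ) - 1) * (1 - 2 ^ (1 - (r : ℂ))))

/-- `d'_r = -(ζ(r-2)(1-2^{3-r}) + (ρ_R(r)/2) ζ(r-1)(1-2^{1-r}))`. -/
noncomputable def dconst' (r : ℕ) : ℂ :=
  -(riemannZeta ((r : ℂ) - 2) * (1 - 2 ^ (3 - (r : ℂ))) +
    (if r % 2 = 1 then (1 : ℂ) / 4 else (1 : ℂ) / 2) * riemannZeta ((r : ℂ) - 1) *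
      (1 - 2 ^ (1 - (r : ℂ))))

/-- The modified Bessel function of the first kind,
`I_s(x) = Σ_{k ≥ 0} (x/2)^{2k+s} / (k! Γ(k+s+1))`. -/
noncomputable def besselI (s x : ℝ) : ℝ :=
  ∑' k : ℕ, (x / 2) ^ (2 * (k : ℝ) + s) / ((k.factorial : ℝ) * Real.Gamma ((k : ℝ) + s + 1))

/-- The point `τ = x + i y` in the upper half plane. -/
noncomputable def mkTau (x y : ℝ) : ℂ := (x : ℂ) + (y : ℂ) * Complex.I


namespace EtaAux

/-- weight of a partition: number of overlining choices. -/
def wt (s : Multiset ℕ) : ℕ := 2 ^ s.toFinset.card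

/-- rank of a multiset. -/
def rk (s : Multiset ℕ) : ℤ := (s.sup : ℤ) - (Multiset.card s : ℤ)

/-- remove the first column. -/
def col (s : Multiset ℕ) : Multiset ℕ := (s.map (fun x => x - 1)).filter (fun x => 0 < x)

/-- add a first column of length `l`. -/
def raise (v : Multiset ℕ) (l : ℕ) : Multiset ℕ :=
  v.map (fun x => x + 1) + Multiset.replicate (l - Multiset.card v) 1

lemma sup_mem (s : Multiset ℕ) (h : s ≠ 0) : s.sup ∈ s := by
  induction s using Multiset.induction with
  | empty => exact absurd rfl h
  | cons a s ih =>
    by_cases hs : s = 0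
    · subst hs; simp
    · have := ih hs
      rw [Multiset.sup_cons]
      rcases le_total a s.sup with h1 | h1
      · rw [sup_eq_right.2 h1]; exact Multiset.mem_cons_of_mem this
      · rw [sup_eq_left.2 h1]; exact Multiset.mem_cons_self _ _

lemma card_col_le (s : Multiset ℕ) : Multiset.card (col s) ≤ Multiset.card s := by
  unfold col
  calc _ ≤ Multiset.card (s.map (fun x => x - 1)) := Multiset.card_le_card (Multiset.filter_le _ _)
    _ = _ := Multiset.card_map _ _

lemma col_pos (s : Multiset ℕ) : ∀ i ∈ col s, 0 < i := by
  intro i hi; exact (Multiset.mem_filter.1 hi).2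

lemma raise_col (s : Multiset ℕ) (hs : ∀ i ∈ s, 0 < i) : raise (col s) (Multiset.card s) = s := by
  induction s using Multiset.induction with
  | empty => simp [raise, col]
  | cons a s ih =>
    have h1 := ih (fun i hi => hs i (Multiset.mem_cons_of_mem hi))
    have ha : 0 < a := hs a (Multiset.mem_cons_self _ _)
    have hc := card_col_le s
    by_cases h : a = 1
    · subst h
      have e : col (1 ::ₘ s) = col s := by simp [col]
      rw [e]
      conv_rhs => rw [← h1]
      unfold raise
      rw [Multiset.card_cons, Nat.succ_sub hc, Multiset.replicate_succ]
      simp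
    · have e : col (a ::ₘ s) = (a - 1) ::ₘ col s := by
        unfold col
        rw [Multiset.map_cons, Multiset.filter_cons_of_pos]
        omega
      rw [e]
      conv_rhs => rw [← h1]
      unfold raise
      rw [Multiset.card_cons, Multiset.card_cons, Nat.add_sub_add_right]
      rw [Multiset.map_cons, Nat.sub_add_cancel ha]
      simp

lemma card_raise (v : Multiset ℕ) (l : ℕ) (h : Multiset.card v ≤ l) :
    Multiset.card (raise v l) = l := by
  simp [raise]; omega

lemma sum_raise (v : Multiset ℕ) (l : ℕ) (h : Multiset.card v ≤ l) :
    (raise v l).sum = v.sum + l := by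
  simp [raise, Multiset.sum_map_add]; omega

lemma raise_pos (v : Multiset ℕ) (l : ℕ) : ∀ i ∈ raise v l, 0 < i := by
  intro i hi
  rw [raise, Multiset.mem_add] at hi
  rcases hi with hi | hi
  · obtain ⟨a, _, rfl⟩ := Multiset.mem_map.1 hi; omega
  · rw [Multiset.eq_of_mem_replicate hi]; exact one_pos

lemma col_raise (v : Multiset ℕ) (l : ℕ) (hv : ∀ i ∈ v, 0 < i) : col (raise v l) = v := by
  unfold col raise
  rw [Multiset.map_add, Multiset.filter_add, Multiset.map_map, Multiset.map_replicate]
  have : Multiset.map ((fun x => x - 1) ∘ fun x => x + 1) v = v := by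
    conv_rhs => rw [← Multiset.map_id v]
    apply Multiset.map_congr rfl; intro x _; simp
  rw [this, Multiset.filter_eq_self.2 hv]
  have : (Multiset.replicate (l - Multiset.card v) (1-1)).filter (fun x => 0 < x) = 0 := by
    rw [Multiset.filter_eq_nil]
    intro a ha; rw [Multiset.eq_of_mem_replicate ha]; simp
  rw [this, add_zero]

lemma sup_raise (v : Multiset ℕ) (l : ℕ) (h : Multiset.card v ≤ l) (hl : 0 < l) :
    (raise v l).sup = v.sup + 1 := by
  apply le_antisymm
  · apply Multiset.sup_le.2
    intro b hb
    rw [raise, Multiset.mem_add] at hb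
    rcases hb with hb | hb
    · obtain ⟨a, ha, rfl⟩ := Multiset.mem_map.1 hb
      have := Multiset.le_sup ha; omega
    · rw [Multiset.eq_of_mem_replicate hb]; omega
  · by_cases hv : v = 0
    · subst hv
      apply Multiset.le_sup
      rw [raise, Multiset.mem_add]; right
      rw [Multiset.mem_replicate]
      simp only [Multiset.card_zero, Multiset.sup_zero]
      exact ⟨by omega, by simp⟩
    · apply Multiset.le_sup
      rw [raise, Multiset.mem_add]; left
      exact Multiset.mem_map_of_mem _ (sup_mem v hv)

lemma wt_raise (v : Multiset ℕ) (l : ℕ) (hv : ∀ i ∈ v, 0 < i) :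
    wt (raise v l) = wt v * (if Multiset.card v < l then 2 else 1) := by
  unfold wt raise
  have e1 : (v.map (fun x => x + 1)).toFinset.card = v.toFinset.card := by
    rw [Multiset.toFinset_map]
    exact Finset.card_image_of_injective _ (fun a b h => by simpa using h)
  split_ifs with h
  · rw [Multiset.toFinset_add, Finset.card_union_of_disjoint, e1]
    · rw [Multiset.toFinset_replicate, if_neg (by omega)]; simp [pow_succ]
    · rw [Multiset.toFinset_replicate, if_neg (by omega), Finset.disjoint_singleton_right]
      simp
      intro h; exact absurd (hv 0 h) (by simp)
  · rw [show l - Multiset.card v = 0 by omega]; simp [e1]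

lemma wt_cons (v : Multiset ℕ) (b : ℕ) (hb : 0 < b) (h : v.sup ≤ b) :
    wt (b ::ₘ v) = wt v * (if v.sup < b then 2 else 1) := by
  unfold wt
  split_ifs with h1
  · have : b ∉ v := fun hm => absurd (Multiset.le_sup hm) (by omega)
    rw [Multiset.toFinset_cons, Finset.card_insert_of_notMem (by simpa using this), pow_succ]
  · have e : b = v.sup := by omega
    have hv : v ≠ 0 := by rintro rfl; simp at e; omega
    have : b ∈ v := e ▸ sup_mem v hv
    rw [Multiset.toFinset_cons, Finset.insert_eq_of_mem (by simpa using this), mul_one]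

lemma sup_cons_erase (s : Multiset ℕ) (h : s ≠ 0) : s.sup ::ₘ s.erase s.sup = s :=
  Multiset.cons_erase (sup_mem s h)

lemma sup_erase_le (s : Multiset ℕ) : (s.erase s.sup).sup ≤ s.sup :=
  Multiset.sup_mono (Multiset.erase_subset _ _)

/-- Dyson's map. -/
def fwd (r : ℕ) (s : Multiset ℕ) : Multiset ℕ := (Multiset.card s + r) ::ₘ col s

/-- its inverse. -/
def bwd (r : ℕ) (s : Multiset ℕ) : Multiset ℕ := raise (s.erase s.sup) (s.sup - r)

lemma sup_col_add (s : Multiset ℕ) (hs : ∀ i ∈ s, 0 < i) (h0 : s ≠ 0) : (col s).sup + 1 = s.sup := by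
  have := sup_raise (col s) (Multiset.card s) (card_col_le s) (Multiset.card_pos.2 h0)
  rw [raise_col s hs] at this; exact this.symm

lemma sup_col_le (r : ℕ) (s : Multiset ℕ) (hs : ∀ i ∈ s, 0 < i) (h : rk s ≤ r + 1) :
    (col s).sup ≤ Multiset.card s + r := by
  by_cases h0 : s = 0
  · subst h0; simp [col]
  · have := sup_col_add s hs h0
    unfold rk at h; omega

lemma sup_col_lt_iff (r : ℕ) (hr : 1 ≤ r) (s : Multiset ℕ) (hs : ∀ i ∈ s, 0 < i) :
    (col s).sup < Multiset.card s + r ↔ rk s ≤ r := by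
  by_cases h0 : s = 0
  · subst h0; simp [col, rk]; omega
  · have := sup_col_add s hs h0
    unfold rk; omega

lemma sum_col (s : Multiset ℕ) (hs : ∀ i ∈ s, 0 < i) : (col s).sum + Multiset.card s = s.sum := by
  rw [← sum_raise _ _ (card_col_le s), raise_col s hs]

lemma fwd_sum (r : ℕ) (s : Multiset ℕ) (hs : ∀ i ∈ s, 0 < i) : (fwd r s).sum = s.sum + r := by
  rw [fwd, Multiset.sum_cons, ← sum_col s hs]; omega

lemma fwd_pos (r : ℕ) (hr : 1 ≤ r) (s : Multiset ℕ) : ∀ i ∈ fwd r s, 0 < i := by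
  intro i hi
  rcases Multiset.mem_cons.1 hi with rfl | hi
  · omega
  · exact col_pos s i hi

lemma fwd_sup (r : ℕ) (s : Multiset ℕ) (hs : ∀ i ∈ s, 0 < i) (h : rk s ≤ r + 1) :
    (fwd r s).sup = Multiset.card s + r := by
  rw [fwd, Multiset.sup_cons, sup_eq_left]
  exact sup_col_le r s hs h

lemma fwd_rk (r : ℕ) (s : Multiset ℕ) (hs : ∀ i ∈ s, 0 < i) (h : rk s ≤ r + 1) :
    rk (fwd r s) = Multiset.card s + r - (Multiset.card (col s) + 1) := by
  rw [rk, fwd_sup r s hs h]; simp [fwd]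

lemma bwd_fwd (r : ℕ) (s : Multiset ℕ) (hs : ∀ i ∈ s, 0 < i) (h : rk s ≤ r + 1) :
    bwd r (fwd r s) = s := by
  rw [bwd, fwd_sup r s hs h, Nat.add_sub_cancel, fwd, Multiset.erase_cons_head, raise_col s hs]

lemma bwd_cond (r : ℕ) (s : Multiset ℕ) (h0 : s ≠ 0) (h : (r : ℤ) - 1 ≤ rk s) :
    Multiset.card (s.erase s.sup) + r ≤ s.sup := by
  have h1 : Multiset.card s = Multiset.card (s.erase s.sup) + 1 := by
    conv_lhs => rw [← sup_cons_erase s h0]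
    simp
  unfold rk at h; omega

lemma fwd_bwd (r : ℕ) (s : Multiset ℕ) (hs : ∀ i ∈ s, 0 < i) (h0 : s ≠ 0) (h : (r : ℤ) - 1 ≤ rk s) :
    fwd r (bwd r s) = s := by
  have hc := bwd_cond r s h0 h
  rw [fwd, bwd, card_raise _ _ (by omega), col_raise _ _ (fun i hi => hs i (Multiset.mem_of_mem_erase hi)),
    Nat.sub_add_cancel (by omega)]
  exact sup_cons_erase s h0

lemma bwd_rk (r : ℕ) (s : Multiset ℕ) (h0 : s ≠ 0) (h : (r : ℤ) - 1 ≤ rk s) :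
    rk (bwd r s) ≤ r + 1 := by
  have hc := bwd_cond r s h0 h
  have hs := sup_erase_le s
  rw [rk, bwd, card_raise _ _ (by omega)]
  by_cases hl : 0 < s.sup - r
  · rw [sup_raise _ _ (by omega) hl]; omega
  · have : Multiset.card (s.erase s.sup) = 0 := by omega
    rw [Multiset.card_eq_zero] at this
    rw [this, show s.sup - r = 0 by omega]; simp [raise]; omega

lemma wt_fwd (r : ℕ) (hr : 1 ≤ r) (s : Multiset ℕ) (hs : ∀ i ∈ s, 0 < i) (h : rk s ≤ r + 1) :
    wt s * (if rk s ≤ r then 2 else 1) = wt (fwd r s) * (if (r : ℤ) ≤ rk (fwd r s) then 2 else 1) := by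
  conv_lhs => rw [← raise_col s hs]
  rw [wt_raise _ _ (col_pos s), raise_col s hs]
  rw [fwd_rk r s hs h]
  rw [fwd, wt_cons _ _ (by omega) (sup_col_le r s hs h)]
  simp only [sup_col_lt_iff r hr s hs]
  have : (Multiset.card (col s) < Multiset.card s) ↔
     ((r : ℤ) ≤ Multiset.card s + r - (Multiset.card (col s) + 1)) := by omega
  simp only [this]; ring

/-- weighted count of partitions of `n` satisfying `P (rank)`. -/
def Wc (P : ℤ → Prop) [DecidablePred P] (n : ℕ) : ℕ :=
  ∑ p : Nat.Partition n, if P (rk p.parts) then wt p.parts else 0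

lemma dyson (r : ℕ) (hr : 2 ≤ r) (n : ℕ) :
    Wc (fun j => j ≤ r + 1) n + Wc (fun j => j ≤ r) n =
    Wc (fun j => (r : ℤ) - 1 ≤ j) (n + r) + Wc (fun j => (r : ℤ) ≤ j) (n + r) := by
  have L : Wc (fun j => j ≤ r + 1) n + Wc (fun j => j ≤ r) n =
    ∑ p ∈ (Finset.univ : Finset (Nat.Partition n)).filter (fun p => rk p.parts ≤ r + 1),
      wt p.parts * (if rk p.parts ≤ r then 2 else 1) := by
    unfold Wc
    rw [← Finset.sum_add_distrib, Finset.sum_filter]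
    apply Finset.sum_congr rfl
    intro p _
    by_cases h1 : rk p.parts ≤ r
    · simp [h1, show rk p.parts ≤ r + 1 by omega]; ring
    · simp [h1]
  have R : Wc (fun j => (r : ℤ) - 1 ≤ j) (n + r) + Wc (fun j => (r : ℤ) ≤ j) (n + r) =
    ∑ p ∈ (Finset.univ : Finset (Nat.Partition (n+r))).filter (fun p => (r : ℤ) - 1 ≤ rk p.parts),
      wt p.parts * (if (r : ℤ) ≤ rk p.parts then 2 else 1) := by
    unfold Wc
    rw [← Finset.sum_add_distrib, Finset.sum_filter]
    apply Finset.sum_congr rfl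
    intro p _
    by_cases h1 : (r : ℤ) ≤ rk p.parts
    · simp [h1, show (r : ℤ) ≤ rk p.parts + 1 by omega]; ring
    · simp [h1]
  rw [L, R]
  have ne0 : ∀ p : Nat.Partition (n + r), p.parts ≠ 0 := by
    intro p h
    have := p.parts_sum
    rw [h] at this; simp at this; omega
  have hsum : ∀ p : Nat.Partition (n + r), (r : ℤ) - 1 ≤ rk p.parts → (bwd r p.parts).sum = n := by
    intro p hp
    have := fwd_sum r (bwd r p.parts) (raise_pos _ _)
    rw [fwd_bwd r p.parts (fun i hi => p.parts_pos hi) (ne0 p) hp, p.parts_sum] at this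
    omega
  refine Finset.sum_bij' (fun p _ => (⟨fwd r p.parts, fun {i} hi => fwd_pos r (by omega) _ i hi, by
      rw [fwd_sum r _ (fun i hi => p.parts_pos hi), p.parts_sum]⟩ : Nat.Partition (n + r)))
    (fun p hp => (⟨bwd r p.parts, fun {i} hi => raise_pos _ _ i hi, hsum p (Finset.mem_filter.1 hp).2⟩ : Nat.Partition n)) ?_ ?_ ?_ ?_ ?_
  · intro p hp
    have h := (Finset.mem_filter.1 hp).2
    simp only [Finset.mem_filter, Finset.mem_univ, true_and]
    rw [fwd_rk r _ (fun i hi => p.parts_pos hi) h]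
    have := card_col_le p.parts
    omega
  · intro p hp
    have h := (Finset.mem_filter.1 hp).2
    simp only [Finset.mem_filter, Finset.mem_univ, true_and]
    exact bwd_rk r _ (ne0 p) h
  · intro p hp
    have h := (Finset.mem_filter.1 hp).2
    ext1
    exact bwd_fwd r _ (fun i hi => p.parts_pos hi) h
  · intro p hp
    have h := (Finset.mem_filter.1 hp).2
    ext1
    exact fwd_bwd r _ (fun i hi => p.parts_pos hi) (ne0 p) h
  · intro p hp
    have h := (Finset.mem_filter.1 hp).2
    exact wt_fwd r (by omega) _ (fun i hi => p.parts_pos hi) h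

end EtaAux

namespace EtaAux

lemma over_le {n : ℕ} (lam : Nat.Partition n) (s : Finset ℕ) (hs : s ∈ lam.parts.toFinset.powerset) :
    s.val ≤ lam.parts := by
  rw [Multiset.le_iff_subset s.nodup]
  intro a ha
  have := Finset.mem_powerset.1 hs ha
  simpa using this

/-- overpartitions as partitions with a subset of part sizes -/
def overEquiv (n : ℕ) (m : ℤ) : {p : Overpartition n // p.rank = m} ≃
    (Σ lam : {lam : Nat.Partition n // rk lam.parts = m}, {s // s ∈ lam.1.parts.toFinset.powerset}) where
  toFun p := ⟨⟨⟨p.1.parts, by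
      intro i hi
      rcases Multiset.mem_add.1 hi with h | h
      · exact p.1.overlined_pos i h
      · exact p.1.nonoverlined_pos i h, by
      have := p.1.total
      rw [Overpartition.parts, Multiset.sum_add]
      rwa [Finset.sum, Multiset.map_id] at this⟩, p.2⟩, ⟨p.1.overlined, by
        rw [Finset.mem_powerset]
        intro a ha
        simp [Overpartition.parts, ha]⟩⟩
  invFun x := ⟨⟨x.2.1, x.1.1.parts - x.2.1.val, by
      intro i hi
      have := Finset.mem_powerset.1 x.2.2 hi
      exact x.1.1.parts_pos (by simpa using this), by
      intro i hi
      exact x.1.1.parts_pos (Multiset.mem_of_le (Multiset.sub_le_self _ _) hi), by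
      have h := over_le x.1.1 x.2.1 x.2.2
      have h2 : (x.2.1.val + (x.1.1.parts - x.2.1.val)).sum = n := by
        rw [add_tsub_cancel_of_le h, x.1.1.parts_sum]
      rw [Multiset.sum_add] at h2
      rwa [Finset.sum, Multiset.map_id]⟩, by
      have h := over_le x.1.1 x.2.1 x.2.2
      have h2 : (x.2.1.val + (x.1.1.parts - x.2.1.val)) = x.1.1.parts := add_tsub_cancel_of_le h
      unfold Overpartition.rank Overpartition.parts
      simp only [h2]
      exact x.1.2⟩
  left_inv p := by
    obtain ⟨⟨o, no, h1, h2, h3⟩, h4⟩ := p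
    simp [Overpartition.parts]
  right_inv x := by
    obtain ⟨⟨lam, h1⟩, ⟨s, hs⟩⟩ := x
    have h := over_le lam s hs
    have h2 : (s.val + (lam.parts - s.val)) = lam.parts := add_tsub_cancel_of_le h
    refine Sigma.ext ?_ ?_
    · apply Subtype.ext
      ext1
      exact h2
    · refine (Subtype.heq_iff_coe_eq ?_).2 rfl
      intro x
      simp only [Overpartition.parts, h2]

lemma Nbar_eq (m : ℤ) (n : ℕ) : Nbar m n = Wc (fun j => j = m) n := by
  classical
  unfold Nbar
  rw [Nat.card_congr (overEquiv n m), Nat.card_eq_fintype_card, Fintype.card_sigma]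
  unfold Wc
  rw [← Finset.sum_filter]
  rw [← Finset.sum_subtype_of_mem (p := fun lam : Nat.Partition n => rk lam.parts = m)
    (fun lam => wt lam.parts) (by intro x hx; exact (Finset.mem_filter.1 hx).2)]
  apply Finset.sum_congr
  · ext x
    simp [x.2]
  · intro x _
    rw [Fintype.card_coe, Finset.card_powerset, wt]

/-- overpartition counting function -/
def pb (n : ℕ) : ℕ := Wc (fun _ => True) n

/-- overpartitions with rank at least `m`. -/
def G (m n : ℕ) : ℕ := Wc (fun j => (m : ℤ) ≤ j) n

lemma G_le (m n : ℕ) : G m n ≤ pb n := by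
  unfold G pb Wc
  apply Finset.sum_le_sum
  intro p _
  simp only [if_true]
  split_ifs <;> simp

lemma G_zero (m n : ℕ) (hm : 1 ≤ m) (h : n ≤ m) : G m n = 0 := by
  unfold G Wc
  apply Finset.sum_eq_zero
  intro p _
  rw [if_neg]
  unfold rk
  by_cases h0 : p.parts = 0
  · rw [h0]; simp; omega
  · have h1 : p.parts.sup ≤ n := by
      have := Multiset.single_le_sum (fun x _ => Nat.zero_le x) _ (sup_mem _ h0)
      rwa [p.parts_sum] at this
    have := Multiset.card_pos.2 h0
    omega

lemma Nbar_eq_G (m n : ℕ) : G m n = Nbar m n + G (m+1) n := by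
  rw [Nbar_eq]
  unfold G Wc
  rw [← Finset.sum_add_distrib]
  apply Finset.sum_congr rfl
  intro p _
  by_cases h : rk p.parts = m
  · simp [h]
  · simp only [h, if_false, zero_add]
    congr 1
    simp; omega

lemma Wc_add (r n : ℕ) : Wc (fun j => j ≤ r) n + G (r+1) n = pb n := by
  unfold G pb Wc
  rw [← Finset.sum_add_distrib]
  apply Finset.sum_congr rfl
  intro p _
  by_cases h : rk p.parts ≤ r
  · simp [h]
  · simp [h]

lemma G_rec (m n : ℕ) (hm : 1 ≤ m) :
    G m (n + (m+1)) + G (m+1) (n + (m+1)) + G (m+2) n + G (m+3) n = 2 * pb n := by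
  have h := dyson (m+1) (by omega) n
  have h1 : Wc (fun j => j ≤ ((m+1 : ℕ) : ℤ)) n + G (m+2) n = pb n := Wc_add (m+1) n
  have h2 : Wc (fun j => j ≤ ((m+2 : ℕ) : ℤ)) n + G (m+3) n = pb n := Wc_add (m+2) n
  have e1 : Wc (fun j => ((m+1 : ℕ) : ℤ) - 1 ≤ j) (n + (m+1)) = G m (n+(m+1)) := by
    unfold G; congr 1; funext j; simp
  have e2 : Wc (fun j => ((m+1 : ℕ) : ℤ) ≤ j) (n + (m+1)) = G (m+1) (n+(m+1)) := by
    unfold G; rfl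
  have e3 : Wc (fun j => j ≤ ((m+1 : ℕ) : ℤ) + 1) n = Wc (fun j => j ≤ ((m+2 : ℕ) : ℤ)) n := by
    congr 1
  rw [e1, e2, e3] at h
  omega

end EtaAux

namespace EtaAux

lemma cauchy_aux (F K H : ℕ → ℂ) (hF : Summable (fun n => ‖F n‖)) (hK : Summable (fun n => ‖K n‖))
    (key : ∀ n, H n = ∑ kl ∈ Finset.HasAntidiagonal.antidiagonal n, F kl.1 * K kl.2) :
    Summable (fun n => ‖H n‖) ∧ ∑' n, H n = (∑' n, F n) * (∑' n, K n) := by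
  rw [funext key]
  exact ⟨summable_norm_sum_mul_antidiagonal_of_summable_norm hF hK,
    (tsum_mul_tsum_eq_tsum_sum_antidiagonal_of_summable_norm hF hK).symm⟩

open PowerSeries PowerSeries.WithPiTopology

/-- absolutely convergent evaluation of a real power series -/
def Ev (f : PowerSeries ℝ) (q s : ℂ) : Prop :=
  Summable (fun n => ‖((coeff n f : ℝ) : ℂ) * q ^ n‖) ∧ ∑' n, ((coeff n f : ℝ) : ℂ) * q ^ n = s

lemma Ev_mul {f g : PowerSeries ℝ} {q s t : ℂ} (hf : Ev f q s) (hg : Ev g q t) : Ev (f * g) q (s * t) := by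
  have key : ∀ n, ((coeff n (f * g) : ℝ) : ℂ) * q ^ n =
      ∑ kl ∈ Finset.HasAntidiagonal.antidiagonal n, (((coeff kl.1 f : ℝ) : ℂ) * q ^ kl.1) * (((coeff kl.2 g : ℝ) : ℂ) * q ^ kl.2) := by
    intro n
    rw [coeff_mul, Complex.ofReal_sum, Finset.sum_mul]
    apply Finset.sum_congr rfl
    intro x hx
    rw [← Finset.HasAntidiagonal.mem_antidiagonal.1 hx, pow_add]
    push_cast; ring
  have h := cauchy_aux _ _ _ hf.1 hg.1 key
  rw [hf.2, hg.2] at h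
  exact h

lemma Ev_one (q : ℂ) : Ev 1 q 1 := by
  have h : ∀ n, n ≠ 0 → ((coeff n (1 : PowerSeries ℝ) : ℝ) : ℂ) * q ^ n = 0 := by
    intro n hn; simp [coeff_one, hn]
  constructor
  · apply summable_of_ne_finset_zero (s := {0})
    intro n hn; rw [h n (by simpa using hn), norm_zero]
  · rw [tsum_eq_single 0 h]; simp

/-- factor -/
noncomputable def fc (i : ℕ) : PowerSeries ℝ := 1 + ∑' j : ℕ, (2 : ℝ) • (X : PowerSeries ℝ) ^ ((i + 1) * (j + 1))

lemma coeff_fc_aux (i n : ℕ) : coeff n (∑' j : ℕ, (2 : ℝ) • (X : PowerSeries ℝ) ^ ((i + 1) * (j + 1)))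
    = if n ≠ 0 ∧ (i + 1) ∣ n then 2 else 0 := by
  have hs : Summable (fun j : ℕ => (2 : ℝ) • (X : PowerSeries ℝ) ^ ((i + 1) * (j + 1))) :=
    Nat.Partition.summable_genFun_term (fun _ _ => (2 : ℝ)) i
  have h1 := ((hasSum_iff_hasSum_coeff ℝ).1 hs.hasSum n)
  rw [← h1.tsum_eq]
  simp only [coeff_smul, coeff_X_pow, smul_eq_mul, mul_ite, mul_one, mul_zero]
  split_ifs with h
  · obtain ⟨h0, k, rfl⟩ := h
    have hk : k ≠ 0 := by rintro rfl; simp at h0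
    rw [tsum_eq_single (k - 1)]
    · rw [if_pos]; congr 1; omega
    · intro j hj
      rw [if_neg]
      intro he
      have := Nat.eq_of_mul_eq_mul_left (Nat.succ_pos i) he
      omega
  · convert tsum_zero with j
    rw [if_neg]
    rintro rfl
    apply h
    exact ⟨by positivity, Dvd.intro _ rfl⟩

lemma fc_nonneg (i n : ℕ) : 0 ≤ coeff n (fc i) := by
  rw [fc, map_add, coeff_fc_aux, coeff_one]
  split_ifs <;> norm_num

lemma hasSum_fc (i : ℕ) (q : ℂ) (hq : ‖q‖ < 1) :
    HasSum (fun n => ((coeff n (∑' j : ℕ, (2 : ℝ) • (X : PowerSeries ℝ) ^ ((i + 1) * (j + 1))) : ℝ) : ℂ) * q ^ n)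
      (2 * q ^ (i+1) / (1 - q ^ (i+1))) := by
  have inj : Function.Injective (fun j : ℕ => (i + 1) * (j + 1)) := by
    intro a b h
    have := Nat.eq_of_mul_eq_mul_left (Nat.succ_pos i) h
    omega
  rw [← inj.hasSum_iff]
  · have hq' : ‖q ^ (i+1)‖ < 1 := by rw [norm_pow]; exact pow_lt_one₀ (norm_nonneg _) hq (by omega)
    have h := (hasSum_geometric_of_norm_lt_one hq').mul_left (2 * q ^ (i+1))
    rw [← div_eq_mul_inv] at h
    refine h.congr_fun ?_
    intro j
    simp only [Function.comp, coeff_fc_aux]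
    rw [if_pos ⟨by positivity, Dvd.intro _ rfl⟩, pow_mul, pow_succ]
    push_cast; ring
  · intro n hn
    rw [coeff_fc_aux, if_neg]; · simp
    rintro ⟨h0, k, rfl⟩
    apply hn
    have hk : k ≠ 0 := by rintro rfl; simp at h0
    exact ⟨k - 1, by show (i+1) * (k - 1 + 1) = _; rw [Nat.sub_add_cancel (by omega)]⟩

lemma one_sub_pow_ne (q : ℂ) (hq : ‖q‖ < 1) (i : ℕ) : 1 - q ^ (i+1) ≠ 0 := by
  intro h
  have : ‖q ^ (i+1)‖ < 1 := by rw [norm_pow]; exact pow_lt_one₀ (norm_nonneg _) hq (by omega)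
  rw [← sub_eq_zero.1 h] at this
  simp at this

lemma one_add_pow_ne (q : ℂ) (hq : ‖q‖ < 1) (i : ℕ) : 1 + q ^ (i+1) ≠ 0 := by
  intro h
  have : ‖q ^ (i+1)‖ < 1 := by rw [norm_pow]; exact pow_lt_one₀ (norm_nonneg _) hq (by omega)
  rw [show q ^ (i+1) = -1 by linear_combination h] at this
  simp at this

lemma Ev_fc (i : ℕ) (q : ℂ) (hq : ‖q‖ < 1) : Ev (fc i) q ((1 + q ^ (i+1)) / (1 - q ^ (i+1))) := by
  have h1 : HasSum (fun n => ((coeff n (1 : PowerSeries ℝ) : ℝ) : ℂ) * q ^ n) 1 := by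
    have := (Ev_one q)
    rw [← this.2]; exact this.1.of_norm.hasSum
  have h2 := h1.add (hasSum_fc i q hq)
  have h3 : HasSum (fun n => ((coeff n (fc i) : ℝ) : ℂ) * q ^ n) ((1 + q ^ (i+1)) / (1 - q ^ (i+1))) := by
    convert h2 using 1
    · funext n; rw [fc, map_add]; push_cast; ring
    · have := one_sub_pow_ne q hq i
      field_simp; ring
  exact ⟨h3.summable.norm, h3.tsum_eq⟩

/-- partial product -/
noncomputable def QK (K : ℕ) : PowerSeries ℝ := ∏ i ∈ Finset.range K, fc i

/-- partial product value -/
noncomputable def PK (K : ℕ) (q : ℂ) : ℂ := ∏ i ∈ Finset.range K, ((1 + q ^ (i+1)) / (1 - q ^ (i+1)))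

lemma Ev_QK (K : ℕ) (q : ℂ) (hq : ‖q‖ < 1) : Ev (QK K) q (PK K q) := by
  induction K with
  | zero => simpa [QK, PK] using Ev_one q
  | succ K ih =>
    unfold QK PK at *
    rw [Finset.prod_range_succ, Finset.prod_range_succ]
    exact Ev_mul ih (Ev_fc K q hq)

lemma QK_nonneg (K n : ℕ) : 0 ≤ coeff n (QK K) := by
  induction K generalizing n with
  | zero => simp [QK, coeff_one]; split_ifs <;> norm_num
  | succ K ih =>
    unfold QK at *
    rw [Finset.prod_range_succ, coeff_mul]
    exact Finset.sum_nonneg (fun x _ => mul_nonneg (ih _) (fc_nonneg _ _))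

lemma QK_mono (n : ℕ) : Monotone (fun K => coeff n (QK K)) := by
  apply monotone_nat_of_le_succ
  intro K
  have : QK (K+1) = QK K * fc K := by unfold QK; rw [Finset.prod_range_succ]
  rw [this, coeff_mul]
  have h := Finset.single_le_sum (f := fun p : ℕ × ℕ => coeff p.1 (QK K) * coeff p.2 (fc K))
    (fun x _ => mul_nonneg (QK_nonneg _ _) (fc_nonneg _ _)) (show (n, 0) ∈ Finset.HasAntidiagonal.antidiagonal n by simp)
  refine le_trans (le_of_eq ?_) h
  have : coeff 0 (fc K) = 1 := by rw [fc, map_add, coeff_fc_aux]; simp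
  simp only [this, mul_one]

lemma coeff_gen (n : ℕ) : coeff n (Nat.Partition.genFun (fun _ _ => (2 : ℝ))) = pb n := by
  rw [Nat.Partition.coeff_genFun, pb, Wc]
  push_cast
  apply Finset.sum_congr rfl
  intro p _
  simp [Finsupp.prod, wt]

lemma QK_tendsto (n : ℕ) : Tendsto (fun K => coeff n (QK K)) atTop (nhds (pb n : ℝ)) := by
  have h := (Nat.Partition.hasProd_genFun (fun _ _ => (2 : ℝ))).tendsto_prod_nat
  have h2 := (tendsto_iff_coeff_tendsto ℝ _ _ _).1 h n
  rw [coeff_gen] at h2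
  exact h2

lemma QK_le (K n : ℕ) : coeff n (QK K) ≤ pb n :=
  (QK_mono n).ge_of_tendsto (QK_tendsto n) K

lemma summable_fac (q : ℂ) (hq : ‖q‖ < 1) : Summable (fun i : ℕ => ‖2 * q ^ (i+1) / (1 - q ^ (i+1))‖) := by
  have hg : Summable (fun i : ℕ => (2 * ‖q‖ / (1 - ‖q‖)) * ‖q‖ ^ i) :=
    (summable_geometric_of_lt_one (norm_nonneg _) hq).mul_left _
  refine Summable.of_nonneg_of_le (fun _ => norm_nonneg _) (fun i => ?_) hg
  rw [norm_div, norm_mul, norm_pow]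
  have h1 : 1 - ‖q‖ ≤ ‖1 - q ^ (i+1)‖ := by
    have := norm_sub_norm_le (1:ℂ) (q ^ (i+1))
    rw [norm_one, norm_pow] at this
    have h2 : ‖q‖ ^ (i+1) ≤ ‖q‖ := pow_le_of_le_one (norm_nonneg _) hq.le (by omega)
    linarith
  have h0 : 0 < 1 - ‖q‖ := by linarith
  rw [div_mul_eq_mul_div]
  have : ‖(2:ℂ)‖ * ‖q‖ ^ (i+1) = 2 * ‖q‖ * ‖q‖ ^ i := by rw [Complex.norm_ofNat]; ring
  rw [this]
  gcongr

lemma fac_eq (q : ℂ) (hq : ‖q‖ < 1) (i : ℕ) :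
    (1 + q ^ (i+1)) / (1 - q ^ (i+1)) = 1 + 2 * q ^ (i+1) / (1 - q ^ (i+1)) := by
  have := one_sub_pow_ne q hq i
  field_simp; ring

lemma multipliable_fac (q : ℂ) (hq : ‖q‖ < 1) :
    Multipliable (fun i : ℕ => (1 + q ^ (i+1)) / (1 - q ^ (i+1))) := by
  simp_rw [fac_eq q hq]
  exact Complex.multipliable_one_add_of_summable (summable_fac q hq).of_norm

/-- the overpartition product -/
noncomputable def PP (q : ℂ) : ℂ := ∏' i : ℕ, ((1 + q ^ (i+1)) / (1 - q ^ (i+1)))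

lemma PK_tendsto (q : ℂ) (hq : ‖q‖ < 1) : Tendsto (fun K => PK K q) atTop (nhds (PP q)) :=
  (multipliable_fac q hq).hasProd.tendsto_prod_nat

lemma pb_summable (q : ℂ) (hq : ‖q‖ < 1) : Summable (fun n => ‖(pb n : ℂ) * q ^ n‖) := by
  set x : ℂ := ((‖q‖ : ℝ) : ℂ) with hx
  have hxn : ‖x‖ < 1 := by rw [hx, Complex.norm_real, norm_norm]; exact hq
  obtain ⟨B, hB⟩ : ∃ B, ∀ K, ‖PK K x‖ ≤ B := by
    have := (PK_tendsto x hxn).norm.bddAbove_range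
    obtain ⟨B, hB⟩ := this
    exact ⟨B, fun K => hB ⟨K, rfl⟩⟩
  apply summable_of_sum_range_le (c := B) (fun _ => norm_nonneg _)
  intro M
  have ht : Tendsto (fun K => ∑ n ∈ Finset.range M, coeff n (QK K) * ‖q‖ ^ n) atTop
     (nhds (∑ n ∈ Finset.range M, (pb n : ℝ) * ‖q‖ ^ n)) :=
    tendsto_finsetSum _ (fun n _ => (QK_tendsto n).mul_const _)
  have e : ∑ n ∈ Finset.range M, ‖(pb n : ℂ) * q ^ n‖ = ∑ n ∈ Finset.range M, (pb n : ℝ) * ‖q‖ ^ n := by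
    apply Finset.sum_congr rfl; intro n _; simp
  rw [e]
  refine le_of_tendsto' ht (fun K => ?_)
  have hev := Ev_QK K x hxn
  have e2 : ∀ n, ‖((coeff n (QK K) : ℝ) : ℂ) * x ^ n‖ = coeff n (QK K) * ‖q‖ ^ n := by
    intro n
    rw [hx, ← Complex.ofReal_pow, ← Complex.ofReal_mul, Complex.norm_real, Real.norm_of_nonneg]
    exact mul_nonneg (QK_nonneg _ _) (by positivity)
  have e3 : ∑' n, coeff n (QK K) * ‖q‖ ^ n ≤ B := by
    refine le_trans ?_ (hB K)
    rw [← hev.2, hx]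
    have : (∑' n, ((coeff n (QK K) : ℝ) : ℂ) * ((‖q‖ : ℝ) : ℂ) ^ n) = ((∑' n, coeff n (QK K) * ‖q‖ ^ n : ℝ) : ℂ) := by
      rw [Complex.ofReal_tsum]; congr 1; funext n; push_cast; ring
    rw [this, Complex.norm_real]
    exact le_abs_self _
  refine le_trans ?_ e3
  apply Summable.sum_le_tsum
  · intro n _; exact mul_nonneg (QK_nonneg _ _) (by positivity)
  · have := hev.1
    simp_rw [e2] at this; exact this

lemma pb_hasSum (q : ℂ) (hq : ‖q‖ < 1) : HasSum (fun n => (pb n : ℂ) * q ^ n) (PP q) := by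
  have hs := pb_summable q hq
  have h : Tendsto (fun K => ∑' n, ((coeff n (QK K) : ℝ) : ℂ) * q ^ n) atTop (nhds (∑' n, (pb n : ℂ) * q ^ n)) := by
    apply tendsto_tsum_of_dominated_convergence hs
    · intro n
      have := (Complex.continuous_ofReal.tendsto _).comp (QK_tendsto n)
      simpa using this.mul_const (q ^ n)
    · refine Filter.Eventually.of_forall (fun K n => ?_)
      rw [norm_mul, norm_mul]
      gcongr
      rw [Complex.norm_real, Real.norm_of_nonneg (QK_nonneg _ _)]
      simpa using QK_le K n
  have h2 := PK_tendsto q hq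
  simp_rw [fun K => (Ev_QK K q hq).2] at h
  rw [tendsto_nhds_unique h2 h]
  exact hs.of_norm.hasSum

end EtaAux

namespace EtaAux

/-- coefficient in the Gauss identity -/
noncomputable def cs (q : ℂ) (s : ℕ) : ℂ := (-1) ^ (s+1) * 2 * PK (s+1) q / (1 + q ^ (s+1))

lemma PK_succ (q : ℂ) (n : ℕ) : PK (n+1) q = PK n q * ((1 + q ^ (n+1)) / (1 - q ^ (n+1))) := by
  rw [PK, PK, Finset.prod_range_succ]

lemma gauss_tel (q : ℂ) (hq : ‖q‖ < 1) (x : ℂ) (k : ℕ) :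
    (1 - x) * (1 + ∑ s ∈ Finset.range k, cs q s * (q * x) ^ (s+1))
     - (1 + x) * (1 + ∑ s ∈ Finset.range k, cs q s * x ^ (s+1)) = -2 * (-1) ^ k * PK k q * x ^ (k+1) := by
  induction k with
  | zero => simp [PK]; ring
  | succ k ih =>
    rw [Finset.sum_range_succ, Finset.sum_range_succ]
    have h1 := one_sub_pow_ne q hq k
    have h2 := one_add_pow_ne q hq k
    have e : (1 - x) * (cs q k * (q * x) ^ (k+1)) - (1 + x) * (cs q k * x ^ (k+1))
       = -2 * (-1) ^ (k+1) * PK (k+1) q * x ^ (k+1+1) + 2 * (-1) ^ k * PK k q * x ^ (k+1) := by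
      rw [cs, PK_succ, mul_pow]
      field_simp
      ring
    linear_combination ih + e

lemma gauss_fin (q : ℂ) (hq : ‖q‖ < 1) (n : ℕ) :
    1 + ∑ s ∈ Finset.range n, cs q s * (q ^ (n+1)) ^ (s+1) =
    PK n q * (1 + 2 * ∑ j ∈ Finset.range n, (-1) ^ (j+1) * q ^ ((j+1)^2)) := by
  induction n with
  | zero => simp [PK]
  | succ n ih =>
    have h1 := one_sub_pow_ne q hq n
    have h2 := one_add_pow_ne q hq n
    have ht := gauss_tel q hq (q ^ (n+1)) n
    rw [ih] at ht
    have e1 : q * q ^ (n+1) = q ^ (n+1+1) := by ring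
    rw [e1] at ht
    rw [Finset.sum_range_succ, Finset.sum_range_succ]
    have e2 : q ^ ((n+1)^2) = (q ^ (n+1)) ^ (n+1) := by rw [← pow_mul]; ring_nf
    rw [e2, cs, PK_succ]
    have e3 : (q ^ (n+1+1)) ^ (n+1) = q ^ (n+1) * (q ^ (n+1)) ^ (n+1) := by
      rw [← pow_mul, ← pow_mul, ← pow_add]
      congr 1
      ring
    rw [e3]
    generalize (∑ x ∈ Finset.range n, cs q x * (q ^ (n + 1 + 1)) ^ (x + 1)) = A at *
    generalize (∑ j ∈ Finset.range n, (-1) ^ (j+1) * q ^ ((j+1)^2)) = B at *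
    generalize (q ^ (n+1)) = x at *
    have h4 : A = ((1 + x) * (PK n q * (1 + 2 * B)) + -2 * (-1) ^ n * PK n q * x ^ (n+1)) / (1 - x) - 1 := by
      field_simp
      linear_combination ht
    rw [h4]
    field_simp
    ring

lemma summable_sq (q : ℂ) (hq : ‖q‖ < 1) : Summable (fun j : ℕ => ‖(-1 : ℂ) ^ (j+1) * q ^ ((j+1)^2)‖) := by
  refine Summable.of_nonneg_of_le (fun _ => norm_nonneg _) (fun j => ?_)
    (summable_geometric_of_lt_one (norm_nonneg q) hq)
  simp only [norm_mul, norm_pow, norm_neg, norm_one, one_pow, one_mul]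
  exact pow_le_pow_of_le_one (norm_nonneg _) hq.le (by nlinarith)

/-- theta four -/
noncomputable def th4 (q : ℂ) : ℂ := 1 + 2 * ∑' j : ℕ, (-1 : ℂ) ^ (j+1) * q ^ ((j+1)^2)

lemma PP_mul_th4 (q : ℂ) (hq : ‖q‖ < 1) : PP q * th4 q = 1 := by
  have hP := PK_tendsto q hq
  have hS : Tendsto (fun n => 1 + 2 * ∑ j ∈ Finset.range n, (-1 : ℂ) ^ (j+1) * q ^ ((j+1)^2)) atTop (nhds (th4 q)) :=
    ((summable_sq q hq).of_norm.hasSum.tendsto_sum_nat.const_mul 2).const_add 1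
  have hR := hP.mul hS
  simp_rw [← gauss_fin q hq] at hR
  obtain ⟨B, hB⟩ : ∃ B, ∀ K, ‖PK K q‖ ≤ B := by
    obtain ⟨B, hB⟩ := hP.norm.bddAbove_range
    exact ⟨B, fun K => hB ⟨K, rfl⟩⟩
  have hB0 : 0 ≤ B := (norm_nonneg _).trans (hB 0)
  have h0 : 0 < 1 - ‖q‖ := by linarith
  have hc : ∀ s, ‖cs q s‖ ≤ 2 * B / (1 - ‖q‖) := by
    intro s
    have h1 : 1 - ‖q‖ ≤ ‖1 + q ^ (s+1)‖ := by
      have := norm_sub_norm_le (1:ℂ) (-q ^ (s+1))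
      rw [norm_one, norm_neg, norm_pow, sub_neg_eq_add] at this
      have h2 : ‖q‖ ^ (s+1) ≤ ‖q‖ := pow_le_of_le_one (norm_nonneg _) hq.le (by omega)
      linarith
    rw [cs, norm_div, norm_mul, norm_mul, norm_pow, norm_neg, norm_one, one_pow, one_mul, Complex.norm_ofNat]
    have := hB (s+1)
    gcongr
  have hz : Tendsto (fun n => ∑ s ∈ Finset.range n, cs q s * (q ^ (n+1)) ^ (s+1)) atTop (nhds 0) := by
    have hlim : Tendsto (fun n : ℕ => (2 * B / (1 - ‖q‖)) * ((n : ℝ) * ‖q‖ ^ n)) atTop (nhds 0) := by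
      have := (tendsto_self_mul_const_pow_of_lt_one (norm_nonneg q) hq).const_mul (2 * B / (1 - ‖q‖))
      simpa using this
    refine squeeze_zero_norm (fun n => ?_) hlim
    refine (norm_sum_le _ _).trans ?_
    have : ∀ s ∈ Finset.range n, ‖cs q s * (q ^ (n+1)) ^ (s+1)‖ ≤ (2 * B / (1 - ‖q‖)) * ‖q‖ ^ n := by
      intro s _
      rw [norm_mul, ← pow_mul, norm_pow]
      have := hc s
      have h3 : ‖q‖ ^ ((n+1)*(s+1)) ≤ ‖q‖ ^ n := pow_le_pow_of_le_one (norm_nonneg _) hq.le (by nlinarith)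
      gcongr
    refine (Finset.sum_le_sum this).trans (le_of_eq ?_)
    simp; ring
  have h1 := hz.const_add 1
  rw [add_zero] at h1
  exact tendsto_nhds_unique hR h1

end EtaAux

namespace EtaAux

/-- generating function of `G m` -/
noncomputable def Gh (q : ℂ) (m : ℕ) : ℂ := ∑' n, (G m n : ℂ) * q ^ n

lemma G_summable (q : ℂ) (hq : ‖q‖ < 1) (m : ℕ) : Summable (fun n => (G m n : ℂ) * q ^ n) := by
  refine Summable.of_norm_bounded (pb_summable q hq) (fun n => ?_)
  rw [norm_mul, norm_mul]
  gcongr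
  simpa using G_le m n

lemma Gh_norm_le (q : ℂ) (hq : ‖q‖ < 1) (m : ℕ) : ‖Gh q m‖ ≤ ∑' n, ‖(pb n : ℂ) * q ^ n‖ := by
  refine tsum_of_norm_bounded (pb_summable q hq).hasSum (fun n => ?_)
  rw [norm_mul, norm_mul]
  gcongr
  simpa using G_le m n

lemma Gh_tendsto (q : ℂ) (hq : ‖q‖ < 1) : Tendsto (Gh q) atTop (nhds 0) := by
  have : Tendsto (fun m => ∑' n, (G m n : ℂ) * q ^ n) atTop (nhds (∑' n : ℕ, (0:ℂ))) := by
    apply tendsto_tsum_of_dominated_convergence (pb_summable q hq)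
    · intro n
      apply tendsto_const_nhds.congr'
      filter_upwards [eventually_ge_atTop (n+1)] with m hm
      rw [G_zero m n (by omega) (by omega)]; simp
    · refine Filter.Eventually.of_forall (fun m n => ?_)
      rw [norm_mul, norm_mul]
      gcongr
      simpa using G_le m n
  rw [tsum_zero] at this
  exact this

lemma Gh_rec (q : ℂ) (hq : ‖q‖ < 1) (m : ℕ) (hm : 1 ≤ m) :
    Gh q m + Gh q (m+1) = q ^ (m+1) * (2 * PP q - (Gh q (m+2) + Gh q (m+3))) := by
  have h1 := (G_summable q hq m).add (G_summable q hq (m+1))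
  have e1 : Gh q m + Gh q (m+1) = ∑' n, ((G m n : ℂ) * q ^ n + (G (m+1) n : ℂ) * q ^ n) :=
    ((G_summable q hq m).tsum_add (G_summable q hq (m+1))).symm
  rw [e1, ← h1.sum_add_tsum_nat_add (m+1)]
  have z : ∑ n ∈ Finset.range (m+1), ((G m n : ℂ) * q ^ n + (G (m+1) n : ℂ) * q ^ n) = 0 := by
    apply Finset.sum_eq_zero
    intro n hn
    have := Finset.mem_range.1 hn
    rw [G_zero m n hm (by omega), G_zero (m+1) n (by omega) (by omega)]; simp
  rw [z, zero_add]
  have hs := (((pb_hasSum q hq).mul_left 2).sub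
    ((G_summable q hq (m+2)).hasSum.add (G_summable q hq (m+3)).hasSum)).mul_left (q ^ (m+1))
  rw [show (∑' n, (G (m+2) n : ℂ) * q ^ n) = Gh q (m+2) from rfl,
    show (∑' n, (G (m+3) n : ℂ) * q ^ n) = Gh q (m+3) from rfl] at hs
  rw [← hs.tsum_eq]
  congr 1
  funext n
  have h := G_rec m n hm
  have h' : (G m (n + (m+1)) : ℂ) + G (m+1) (n + (m+1)) + G (m+2) n + G (m+3) n = 2 * pb n := by
    exact_mod_cast h
  rw [pow_add]
  linear_combination q ^ n * q ^ (m+1) * h'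

lemma bnd_exp (q : ℂ) (hq : ‖q‖ < 1) (m n : ℕ) :
    ‖q‖ ^ ((n+1)^2 + m * (n+1)) ≤ ‖q‖ ^ m * ‖q‖ ^ n := by
  rw [← pow_add]
  exact pow_le_pow_of_le_one (norm_nonneg _) hq.le (by nlinarith [Nat.zero_le (m*n), Nat.zero_le n])

lemma T_summable (q : ℂ) (hq : ‖q‖ < 1) (m : ℕ) :
    Summable (fun n : ℕ => (-1 : ℂ) ^ n * q ^ ((n+1)^2 + m * (n+1))) := by
  refine Summable.of_norm_bounded ((summable_geometric_of_lt_one (norm_nonneg q) hq).mul_left (‖q‖ ^ m)) (fun n => ?_)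
  simp only [norm_mul, norm_pow, norm_neg, norm_one, one_pow, one_mul]
  exact bnd_exp q hq m n

/-- partial theta -/
noncomputable def Tm (q : ℂ) (m : ℕ) : ℂ := ∑' n : ℕ, (-1 : ℂ) ^ n * q ^ ((n+1)^2 + m * (n+1))

lemma Tm_rec (q : ℂ) (hq : ‖q‖ < 1) (m : ℕ) : Tm q m = q ^ (m+1) * (1 - Tm q (m+2)) := by
  rw [Tm, (T_summable q hq m).tsum_eq_zero_add]
  have : ∑' n : ℕ, (-1 : ℂ) ^ (n+1) * q ^ ((n+1+1)^2 + m * (n+1+1)) = -(q ^ (m+1) * Tm q (m+2)) := by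
    rw [Tm, ← tsum_mul_left, ← tsum_neg]
    congr 1
    funext n
    rw [show (n+1+1)^2 + m * (n+1+1) = (m+1) + ((n+1)^2 + (m+2) * (n+1)) by ring, pow_add q (m+1)]
    ring
  rw [this]
  simp
  ring

lemma Tm_norm (q : ℂ) (hq : ‖q‖ < 1) (m : ℕ) : ‖Tm q m‖ ≤ (1 - ‖q‖)⁻¹ := by
  refine tsum_of_norm_bounded (hasSum_geometric_of_lt_one (norm_nonneg q) hq) (fun n => ?_)
  simp only [norm_mul, norm_pow, norm_neg, norm_one, one_pow, one_mul]
  refine (bnd_exp q hq m n).trans ?_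
  have : ‖q‖ ^ m ≤ 1 := pow_le_one₀ (norm_nonneg _) hq.le
  have h2 : 0 ≤ ‖q‖ ^ n := by positivity
  nlinarith

lemma E_eq (q : ℂ) (hq : ‖q‖ < 1) (m : ℕ) (hm : 1 ≤ m) : Gh q m + Gh q (m+1) = 2 * PP q * Tm q m := by
  set D : ℕ → ℂ := fun m => Gh q m + Gh q (m+1) - 2 * PP q * Tm q m with hD
  have hrec : ∀ m, 1 ≤ m → D m = - q ^ (m+1) * D (m+2) := by
    intro m hm
    simp only [hD]
    rw [Gh_rec q hq m hm, Tm_rec q hq m]; ring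
  obtain ⟨B, hB⟩ : ∃ B, ∀ m, ‖D m‖ ≤ B := by
    refine ⟨(∑' n, ‖(pb n : ℂ) * q ^ n‖) + (∑' n, ‖(pb n : ℂ) * q ^ n‖) + ‖2 * PP q‖ * (1 - ‖q‖)⁻¹, fun m => ?_⟩
    simp only [hD]
    refine (norm_sub_le _ _).trans (add_le_add ((norm_add_le _ _).trans (add_le_add (Gh_norm_le q hq _) (Gh_norm_le q hq _))) ?_)
    rw [norm_mul]
    exact mul_le_mul_of_nonneg_left (Tm_norm q hq m) (norm_nonneg _)
  have hk : ∀ k m, 1 ≤ m → ‖D m‖ ≤ ‖q‖ ^ k * B := by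
    intro k
    induction k with
    | zero => intro m _; simpa using hB m
    | succ k ih =>
      intro m hm
      rw [hrec m hm, norm_mul, norm_neg, norm_pow, pow_succ' ‖q‖ k, mul_assoc]
      have h1 : ‖q‖ ^ (m+1) ≤ ‖q‖ := pow_le_of_le_one (norm_nonneg _) hq.le (by omega)
      exact mul_le_mul h1 (ih (m+2) (by omega)) (norm_nonneg _) (norm_nonneg _)
  have hz : ‖D m‖ ≤ 0 := by
    have : Tendsto (fun k => ‖q‖ ^ k * B) atTop (nhds (0 * B)) :=
      (tendsto_pow_atTop_nhds_zero_of_lt_one (norm_nonneg _) hq).mul_const B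
    rw [zero_mul] at this
    exact ge_of_tendsto' this (fun k => hk k m hm)
  have := norm_le_zero_iff.1 hz
  simp only [hD] at this
  exact sub_eq_zero.1 this

lemma norm_one_add_ge (q : ℂ) (hq : ‖q‖ < 1) (s : ℕ) : 1 - ‖q‖ ≤ ‖1 + q ^ (s+1)‖ := by
  have := norm_sub_norm_le (1:ℂ) (-q ^ (s+1))
  rw [norm_one, norm_neg, norm_pow, sub_neg_eq_add] at this
  have h2 : ‖q‖ ^ (s+1) ≤ ‖q‖ := pow_le_of_le_one (norm_nonneg _) hq.le (by omega)
  linarith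

lemma norm_one_sub_ge (q : ℂ) (hq : ‖q‖ < 1) (s : ℕ) : 1 - ‖q‖ ≤ ‖1 - q ^ (s+1)‖ := by
  have := norm_sub_norm_le (1:ℂ) (q ^ (s+1))
  rw [norm_one, norm_pow] at this
  have h2 : ‖q‖ ^ (s+1) ≤ ‖q‖ := pow_le_of_le_one (norm_nonneg _) hq.le (by omega)
  linarith

/-- Appell type sum -/
noncomputable def Vm (q : ℂ) (m : ℕ) : ℂ :=
  ∑' n : ℕ, (-1 : ℂ) ^ n * q ^ ((n+1)^2 + m * (n+1)) / (1 + q ^ (n+1))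

lemma V_term (q : ℂ) (hq : ‖q‖ < 1) (m n : ℕ) :
    ‖(-1 : ℂ) ^ n * q ^ ((n+1)^2 + m * (n+1)) / (1 + q ^ (n+1))‖ ≤ (‖q‖ ^ m / (1 - ‖q‖)) * ‖q‖ ^ n := by
  rw [norm_div]
  simp only [norm_mul, norm_pow, norm_neg, norm_one, one_pow, one_mul]
  have h1 := bnd_exp q hq m n
  have h2 := norm_one_add_ge q hq n
  have h0 : 0 < 1 - ‖q‖ := by linarith
  rw [div_mul_eq_mul_div]
  gcongr

lemma V_summable (q : ℂ) (hq : ‖q‖ < 1) (m : ℕ) :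
    Summable (fun n : ℕ => (-1 : ℂ) ^ n * q ^ ((n+1)^2 + m * (n+1)) / (1 + q ^ (n+1))) :=
  Summable.of_norm_bounded ((summable_geometric_of_lt_one (norm_nonneg q) hq).mul_left _) (V_term q hq m)

lemma Vm_norm (q : ℂ) (hq : ‖q‖ < 1) (m : ℕ) : ‖Vm q m‖ ≤ (‖q‖ ^ m / (1 - ‖q‖)) * (1 - ‖q‖)⁻¹ :=
  tsum_of_norm_bounded ((hasSum_geometric_of_lt_one (norm_nonneg q) hq).mul_left _) (V_term q hq m)

lemma Vm_add (q : ℂ) (hq : ‖q‖ < 1) (m : ℕ) : Vm q m + Vm q (m+1) = Tm q m := by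
  rw [Vm, Vm, Tm, ← (V_summable q hq m).tsum_add (V_summable q hq (m+1))]
  congr 1
  funext n
  have := one_add_pow_ne q hq n
  rw [show (n+1)^2 + (m+1) * (n+1) = (n+1)^2 + m * (n+1) + (n+1) by ring, pow_add q _ (n+1)]
  field_simp

lemma Gh_eq (q : ℂ) (hq : ‖q‖ < 1) (m : ℕ) (hm : 1 ≤ m) : Gh q m = 2 * PP q * Vm q m := by
  set U : ℕ → ℂ := fun m => Gh q m - 2 * PP q * Vm q m with hU
  have hrec : ∀ m, 1 ≤ m → U m = - U (m+1) := by
    intro m hm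
    have h1 := E_eq q hq m hm
    have h2 := Vm_add q hq m
    simp only [hU]
    linear_combination h1 - 2 * PP q * h2
  have hk : ∀ k, ‖U m‖ = ‖U (m+k)‖ := by
    intro k
    induction k with
    | zero => rfl
    | succ k ih => rw [ih, hrec (m+k) (by omega), norm_neg]; rfl
  have hV : Tendsto (Vm q) atTop (nhds 0) := by
    have : Tendsto (fun m => (‖q‖ ^ m / (1 - ‖q‖)) * (1 - ‖q‖)⁻¹) atTop (nhds ((0 / (1 - ‖q‖)) * (1 - ‖q‖)⁻¹)) :=
      ((tendsto_pow_atTop_nhds_zero_of_lt_one (norm_nonneg _) hq).div_const _).mul_const _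
    rw [zero_div, zero_mul] at this
    exact squeeze_zero_norm (Vm_norm q hq) this
  have hz : Tendsto (fun k => ‖U (m+k)‖) atTop (nhds 0) := by
    have h1 : Tendsto U atTop (nhds (0 - 2 * PP q * 0)) := (Gh_tendsto q hq).sub (hV.const_mul _)
    rw [mul_zero, sub_zero] at h1
    have h2 := h1.norm
    rw [norm_zero] at h2
    exact h2.comp (tendsto_add_atTop_nat m |>.congr (fun k => by ring))
  simp_rw [← hk] at hz
  have := tendsto_nhds_unique hz tendsto_const_nhds
  exact sub_eq_zero.1 (norm_eq_zero.1 this.symm)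

lemma Nbar_hasSum (q : ℂ) (hq : ‖q‖ < 1) (m : ℕ) :
    HasSum (fun n => (Nbar ((m : ℤ) + 1) n : ℂ) * q ^ n)
    (2 * PP q * ∑' n : ℕ, (-1 : ℂ) ^ n * q ^ ((n+1)^2 + (m+1) * (n+1)) * (1 - q ^ (n+1)) / (1 + q ^ (n+1))) := by
  have h := (G_summable q hq (m+1)).hasSum.sub (G_summable q hq (m+2)).hasSum
  have e1 := Gh_eq q hq (m+1) (by omega)
  have e2 := Gh_eq q hq (m+2) (by omega)
  rw [Gh] at e1 e2
  rw [e1, e2, ← mul_sub, Vm, Vm, ← (V_summable q hq (m+1)).tsum_sub (V_summable q hq (m+2))] at h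
  have ev : (2 * PP q * ∑' n : ℕ, (-1 : ℂ) ^ n * q ^ ((n+1)^2 + (m+1) * (n+1)) * (1 - q ^ (n+1)) / (1 + q ^ (n+1)))
     = 2 * PP q * ∑' (b : ℕ), ((-1) ^ b * q ^ ((b + 1) ^ 2 + (m + 1) * (b + 1)) / (1 + q ^ (b + 1)) -
          (-1) ^ b * q ^ ((b + 1) ^ 2 + (m + 2) * (b + 1)) / (1 + q ^ (b + 1))) := by
    congr 1
    refine tsum_congr (fun n => ?_)
    rw [show (n+1)^2 + (m+2) * (n+1) = (n+1)^2 + (m+1) * (n+1) + (n+1) by ring, pow_add q _ (n+1)]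
    ring
  rw [ev]
  refine h.congr_fun (fun n => ?_)
  have := Nbar_eq_G (m+1) n
  have h2 : (G (m+1) n : ℂ) = Nbar ((m : ℤ)+1) n + G (m+2) n := by exact_mod_cast this
  rw [h2]; ring

/-- the sum S -/
noncomputable def SS (r : ℕ) (q : ℂ) : ℂ :=
  ∑' n : ℕ, (-1 : ℂ) ^ n * q ^ ((n+1)^2 + (r/2+1) * (n+1)) / ((1 - q ^ (n+1)) ^ r * (1 + q ^ (n+1)))

lemma choose_hasSum (r : ℕ) (hr : 1 ≤ r) (x : ℂ) (hx : ‖x‖ < 1) :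
    HasSum (fun m : ℕ => (Nat.choose (m + 1 + (r-1)/2) r : ℂ) * x ^ (m+1)) (x ^ (r/2+1) / (1 - x) ^ (r+1)) := by
  have h := (hasSum_choose_mul_geometric_of_norm_lt_one r hx).mul_left (x ^ (r/2+1))
  rw [← mul_div_assoc, mul_one] at h
  have h2 : HasSum (fun m : ℕ => (Nat.choose (m + r/2 + 1 + (r-1)/2) r : ℂ) * x ^ (m+r/2+1)) (x ^ (r/2+1) / (1 - x) ^ (r+1)) := by
    refine h.congr_fun (fun m => ?_)
    rw [show m + r/2 + 1 + (r-1)/2 = m + r by omega, show m + r/2 + 1 = r/2 + 1 + m by ring, pow_add]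
    ring
  rw [hasSum_nat_add_iff (f := fun m : ℕ => (Nat.choose (m + 1 + (r-1)/2) r : ℂ) * x ^ (m+1)) (r/2)] at h2
  rwa [Finset.sum_eq_zero, add_zero] at h2
  intro i hi
  have := Finset.mem_range.1 hi
  rw [Nat.choose_eq_zero_of_lt (by omega)]; simp

lemma fam1 (r : ℕ) (hr : 1 ≤ r) (q : ℂ) (hq : ‖q‖ < 1) :
    Summable (fun p : ℕ × ℕ => (Nat.choose (p.1 + 1 + (r-1)/2) r : ℂ) * ((Nbar ((p.1 : ℤ) + 1) p.2 : ℂ) * q ^ p.2)) := by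
  obtain ⟨σ, h1, h2⟩ := exists_between hq
  have hσ : 0 < σ := (norm_nonneg q).trans_lt h1
  obtain ⟨B, hB⟩ : ∃ B, ∀ n, (pb n : ℝ) * σ ^ n ≤ B := by
    have hs := (pb_summable (σ : ℂ) (by rwa [Complex.norm_real, Real.norm_of_nonneg hσ.le]))
    obtain ⟨B, hB⟩ := hs.tendsto_atTop_zero.bddAbove_range
    refine ⟨B, fun n => ?_⟩
    have := hB ⟨n, rfl⟩
    simpa [abs_of_pos hσ] using this
  set τ := Real.sqrt (‖q‖ / σ) with hτ
  have hτ0 : 0 ≤ τ := Real.sqrt_nonneg _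
  have hτ2 : τ ^ 2 = ‖q‖ / σ := Real.sq_sqrt (by positivity)
  have hτ1 : τ < 1 := by
    rw [hτ, Real.sqrt_lt' one_pos, one_pow, div_lt_one hσ]; exact h1
  have hA : Summable (fun m : ℕ => (Nat.choose (m + 1 + (r-1)/2) r : ℝ) * τ ^ (m+1)) := by
    have := (choose_hasSum r hr (τ : ℂ) (by rwa [Complex.norm_real, Real.norm_of_nonneg hτ0])).summable.norm
    refine this.congr (fun m => ?_)
    simp [abs_of_nonneg hτ0]
  have hC : Summable (fun n : ℕ => B * τ ^ n) := (summable_geometric_of_lt_one hτ0 hτ1).mul_left _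
  have hB0 : 0 ≤ B := le_trans (by positivity) (hB 0)
  refine Summable.of_norm_bounded (hA.mul_of_nonneg hC (fun m => by positivity) (fun n => by positivity)) ?_
  rintro ⟨m, n⟩
  simp only
  rw [norm_mul, norm_mul, norm_pow, Complex.norm_natCast, Complex.norm_natCast]
  have hN := Nbar_eq_G (m+1) n
  have hle : (Nbar ((m : ℤ)+1) n : ℝ) ≤ pb n := by
    have h3 := G_le (m+1) n
    push_cast at hN
    exact_mod_cast (by omega : Nbar ((m : ℤ)+1) n ≤ pb n)
  by_cases hmn : n ≤ m + 1
  · have h3 := G_zero (m+1) n (by omega) hmn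
    push_cast at hN
    have : Nbar ((m : ℤ)+1) n = 0 := by omega
    rw [this]; simp; positivity
  · have hqn : ‖q‖ ^ n = σ ^ n * (τ ^ 2) ^ n := by rw [← mul_pow, hτ2]; congr 1; field_simp
    have h5 : (τ ^ 2) ^ n ≤ τ ^ (m+1) * τ ^ n := by
      rw [← pow_mul, ← pow_add]; exact pow_le_pow_of_le_one hτ0 hτ1.le (by omega)
    rw [mul_assoc]
    refine mul_le_mul_of_nonneg_left ?_ (by positivity)
    rw [hqn]
    calc (Nbar ((m : ℤ)+1) n : ℝ) * (σ ^ n * (τ ^ 2) ^ n) ≤ pb n * (σ ^ n * (τ ^ (m+1) * τ ^ n)) := by gcongr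
      _ = (pb n * σ ^ n) * (τ ^ (m+1) * τ ^ n) := by ring
      _ ≤ B * (τ ^ (m+1) * τ ^ n) := by gcongr; exact hB n
      _ = _ := by ring

lemma fam2 (r : ℕ) (hr : 1 ≤ r) (q : ℂ) (hq : ‖q‖ < 1) :
    Summable (fun p : ℕ × ℕ => (Nat.choose (p.1 + 1 + (r-1)/2) r : ℂ) *
      ((-1 : ℂ) ^ p.2 * q ^ ((p.2+1)^2 + (p.1+1) * (p.2+1)) * (1 - q ^ (p.2+1)) / (1 + q ^ (p.2+1)))) := by
  have hA : Summable (fun m : ℕ => (Nat.choose (m + 1 + (r-1)/2) r : ℝ) * ‖q‖ ^ (m+1)) := by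
    have := (choose_hasSum r hr q hq).summable.norm
    refine this.congr (fun m => ?_)
    simp
  have h0 : 0 < 1 - ‖q‖ := by linarith
  have hC : Summable (fun n : ℕ => 2 / (1 - ‖q‖) * ‖q‖ ^ n) :=
    (summable_geometric_of_lt_one (norm_nonneg q) hq).mul_left _
  refine Summable.of_norm_bounded (hA.mul_of_nonneg hC (fun m => by positivity) (fun n => by positivity)) ?_
  rintro ⟨m, n⟩
  simp only
  rw [norm_mul, norm_div]
  simp only [norm_mul, norm_pow, norm_neg, norm_one, one_pow, one_mul, Complex.norm_natCast]
  rw [mul_assoc]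
  refine mul_le_mul_of_nonneg_left ?_ (by positivity)
  have h1 := bnd_exp q hq (m+1) n
  have h2 := norm_one_add_ge q hq n
  have h3 : ‖1 - q ^ (n+1)‖ ≤ 2 := by
    refine (norm_sub_le _ _).trans ?_
    have : ‖q ^ (n+1)‖ ≤ 1 := by rw [norm_pow]; exact pow_le_one₀ (norm_nonneg _) hq.le
    rw [norm_one]; linarith
  calc ‖q‖ ^ ((n+1)^2 + (m+1) * (n+1)) * ‖1 - q ^ (n+1)‖ / ‖1 + q ^ (n+1)‖
      ≤ (‖q‖ ^ (m+1) * ‖q‖ ^ n) * 2 / (1 - ‖q‖) := by gcongr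
    _ = _ := by ring

theorem etabar_hasSum (r : ℕ) (hr : 1 ≤ r) (q : ℂ) (hq : ‖q‖ < 1) :
    HasSum (fun n => (etabar r n : ℂ) * q ^ n) (2 * PP q * SS r q) := by
  have s1 := fam1 r hr q hq
  have s2 := fam2 r hr q hq
  have e : ∀ n, (etabar r n : ℂ) * q ^ n =
      ∑' m : ℕ, (Nat.choose (m + 1 + (r-1)/2) r : ℂ) * ((Nbar ((m : ℤ) + 1) n : ℂ) * q ^ n) := by
    intro n
    rw [etabar, Complex.ofReal_tsum, ← tsum_mul_right]
    congr 1; funext m; push_cast; ring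
  have hs : Summable (fun n => (etabar r n : ℂ) * q ^ n) := by
    rw [funext e]
    exact s1.prod_symm.prod
  have hv : ∑' n, (etabar r n : ℂ) * q ^ n = 2 * PP q * SS r q := by
    rw [tsum_congr e]
    rw [Summable.tsum_comm (f := fun m n : ℕ => (Nat.choose (m + 1 + (r-1)/2) r : ℂ) * ((Nbar ((m : ℤ) + 1) n : ℂ) * q ^ n)) s1]
    simp_rw [tsum_mul_left, (Nbar_hasSum q hq _).tsum_eq]
    have : ∀ m : ℕ, (Nat.choose (m + 1 + (r-1)/2) r : ℂ) * (2 * PP q * ∑' n : ℕ, (-1 : ℂ) ^ n * q ^ ((n+1)^2 + (m+1) * (n+1)) * (1 - q ^ (n+1)) / (1 + q ^ (n+1)))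
      = 2 * PP q * ∑' n : ℕ, (Nat.choose (m + 1 + (r-1)/2) r : ℂ) * ((-1 : ℂ) ^ n * q ^ ((n+1)^2 + (m+1) * (n+1)) * (1 - q ^ (n+1)) / (1 + q ^ (n+1))) := by
      intro m
      rw [tsum_mul_left]; ring
    rw [tsum_congr this, tsum_mul_left]
    congr 1
    rw [Summable.tsum_comm (f := fun n m : ℕ => (Nat.choose (m + 1 + (r-1)/2) r : ℂ) * ((-1 : ℂ) ^ n * q ^ ((n+1)^2 + (m+1) * (n+1)) * (1 - q ^ (n+1)) / (1 + q ^ (n+1)))) s2.prod_symm, SS]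
    congr 1
    funext n
    have hx : ‖q ^ (n+1)‖ < 1 := by rw [norm_pow]; exact pow_lt_one₀ (norm_nonneg _) hq (by omega)
    have hc := (choose_hasSum r hr (q ^ (n+1)) hx).mul_right ((-1 : ℂ) ^ n * q ^ ((n+1)^2) * (1 - q ^ (n+1)) / (1 + q ^ (n+1)))
    have h1 := one_sub_pow_ne q hq n
    have h2 := one_add_pow_ne q hq n
    refine Eq.trans ?_ (hc.tsum_eq.trans ?_)
    · congr 1
      funext m
      rw [pow_add, mul_comm (m+1) (n+1), pow_mul]
      ring
    · rw [pow_add q ((n+1)^2), mul_comm (r/2+1) (n+1), pow_mul, pow_succ (1 - q ^ (n+1)) r]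
      generalize (q ^ (n+1)) ^ (r/2+1) = A
      generalize q ^ ((n+1)^2) = B
      field_simp
  rw [← hv]; exact hs.hasSum

end EtaAux


namespace EtaAux

/-- tail theta terms -/
noncomputable def tt (t : ℂ) (k : ℕ) : ℂ := Complex.exp (-(Real.pi:ℂ)^2 * ((k+1:ℂ)^2 + (k+1)) / t)

lemma re_inv_pos {t : ℂ} (ht : 0 < t.re) : 0 < (1/t).re := by
  rw [one_div, Complex.inv_re]
  have : t ≠ 0 := fun h => by simp [h] at ht
  exact div_pos ht (Complex.normSq_pos.2 this)

lemma tt_norm (t : ℂ) (ht : 0 < t.re) (k : ℕ) :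
    ‖tt t k‖ ≤ Real.exp (-2 * Real.pi^2 * (1/t).re) ^ (k+1) := by
  rw [tt, Complex.norm_exp, ← Real.exp_nat_mul]
  refine Real.exp_le_exp.2 ?_
  have e : (-(Real.pi:ℂ)^2 * ((k+1:ℂ)^2 + (k+1)) / t) = ((-(Real.pi)^2 * ((k+1:ℝ)^2 + (k+1)) : ℝ) : ℂ) * (1/t) := by
    push_cast; ring
  rw [e, Complex.re_ofReal_mul]
  have h := re_inv_pos ht
  have hk : (0:ℝ) ≤ k := Nat.cast_nonneg k
  have : 0 ≤ Real.pi^2 * (1/t).re * ((k+1:ℝ) * k) := by positivity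
  push_cast
  nlinarith

lemma tt_sum (t : ℂ) (ht : 0 < t.re) : Summable (tt t) ∧
    (Real.exp (-2 * Real.pi^2 * (1/t).re) ≤ 1/2 → ‖∑' k, tt t k‖ ≤ 2 * Real.exp (-2 * Real.pi^2 * (1/t).re)) := by
  set v := Real.exp (-2 * Real.pi^2 * (1/t).re) with hv
  have v0 : 0 < v := Real.exp_pos _
  have v1 : v < 1 := by
    rw [hv, Real.exp_lt_one_iff]
    have := re_inv_pos ht
    have : 0 < Real.pi^2 * (1/t).re := by positivity
    linarith
  have hs : HasSum (fun k : ℕ => v ^ (k+1)) (v * (1 - v)⁻¹) := by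
    have := (hasSum_geometric_of_lt_one v0.le v1).mul_left v
    refine this.congr_fun (fun k => by ring)
  refine ⟨Summable.of_norm_bounded hs.summable (tt_norm t ht), fun h => ?_⟩
  refine (tsum_of_norm_bounded hs (tt_norm t ht)).trans ?_
  have : (1 - v)⁻¹ ≤ 2 := by
    rw [inv_le_comm₀ (by linarith) (by norm_num)]; linarith
  nlinarith

lemma th4_modular (t : ℂ) (ht : 0 < t.re) :
    th4 (Complex.exp (-t)) = 2 * (1 / (t / Real.pi) ^ (1/2 : ℂ)) * Complex.exp (-(Real.pi:ℂ)^2 / (4 * t)) * (1 + ∑' k, tt t k) := by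
  have t0 : t ≠ 0 := fun h => by simp [h] at ht
  have p0 : (Real.pi : ℂ) ≠ 0 := by exact_mod_cast Real.pi_ne_zero
  set τ : ℂ := Complex.I * t / Real.pi with hτ
  have hτim : 0 < τ.im := by
    rw [hτ, mul_div_assoc, Complex.I_mul_im]
    rw [Complex.div_ofReal_re]; positivity
  have hτ0 : τ ≠ 0 := fun h => by simp [h] at hτim
  have hτ' : 0 < (-1/τ).im := by
    have : -1/τ = Complex.I * (Real.pi * (1/t)) := by
      rw [hτ]; field_simp; rw [Complex.I_sq]
    rw [this, Complex.I_mul_im, Complex.re_ofReal_mul]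
    have := re_inv_pos ht
    positivity
  have hq : ‖Complex.exp (-t)‖ < 1 := by rw [Complex.norm_exp, Real.exp_lt_one_iff]; simpa using ht
  -- left side
  have hodd : ∀ n : ℕ, Complex.exp (n * (Real.pi * Complex.I)) = (-1) ^ n := by
    intro n; rw [Complex.exp_nat_mul, Complex.exp_pi_mul_I]
  have hL : jacobiTheta₂ (1/2) τ = th4 (Complex.exp (-t)) := by
    have s := (summable_sq _ hq).of_norm.hasSum
    have h1 : HasSum (fun n : ℕ => jacobiTheta₂_term ((n:ℤ)+1) (1/2) τ) _ := s.congr_fun (fun n => by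
      rw [jacobiTheta₂_term, ← Complex.exp_nat_mul, ← hodd, ← Complex.exp_add]
      congr 1
      rw [hτ]; push_cast; field_simp
      linear_combination ((n:ℂ)+1) * t * Complex.I_sq)
    have h2 : HasSum (fun n : ℕ => jacobiTheta₂_term (-((n:ℤ)+1)) (1/2) τ) _ := s.congr_fun (fun n => by
      have : ((-1:ℂ))^(n+1) = Complex.exp (-((n+1:ℕ) * (Real.pi * Complex.I))) := by
        rw [Complex.exp_neg, hodd, ← inv_pow]; norm_num
      rw [jacobiTheta₂_term, this, ← Complex.exp_nat_mul, ← Complex.exp_add]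
      congr 1
      rw [hτ]; push_cast; field_simp
      linear_combination ((n:ℂ)+1) * t * Complex.I_sq)
    have h := h1.of_add_one_of_neg_add_one (f := fun n : ℤ => jacobiTheta₂_term n (1/2) τ) h2
    rw [jacobiTheta₂, h.tsum_eq, th4]
    simp [jacobiTheta₂_term]; ring
  have hR : jacobiTheta₂ (1/2/τ) (-1/τ) = 2 * (1 + ∑' k, tt t k) := by
    have s := (tt_sum t ht).1
    have hT : HasSum (fun n : ℕ => Complex.exp (-(Real.pi:ℂ)^2 * ((n:ℂ)^2 + n) / t)) (1 + ∑' k, tt t k) := by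
      rw [← hasSum_nat_add_iff' 1]
      simp only [Finset.range_one, Finset.sum_singleton]
      norm_num
      exact s.hasSum.congr_fun (fun n => by simp [tt])
    have h1 : HasSum (fun n : ℕ => jacobiTheta₂_term ((n:ℤ)+1) (1/2/τ) (-1/τ)) _ := hT.congr_fun (fun n => by
      rw [jacobiTheta₂_term]
      congr 1
      rw [hτ]; push_cast; field_simp
      linear_combination (0:ℂ) * Complex.I_sq)
    have h2 : HasSum (fun n : ℕ => jacobiTheta₂_term (-((n:ℤ)+1)) (1/2/τ) (-1/τ)) _ := s.hasSum.congr_fun (fun n => by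
      rw [jacobiTheta₂_term, tt]
      congr 1
      rw [hτ]; push_cast; field_simp
      linear_combination (0:ℂ) * Complex.I_sq)
    have h := h1.of_add_one_of_neg_add_one (f := fun n : ℤ => jacobiTheta₂_term n (1/2/τ) (-1/τ)) h2
    rw [jacobiTheta₂, h.tsum_eq]
    simp [jacobiTheta₂_term]; ring
  rw [← hL, jacobiTheta₂_functional_equation, hR]
  have e1 : -Complex.I * τ = t / Real.pi := by
    rw [hτ]; field_simp; linear_combination - Complex.I_sq
  have e2 : -(Real.pi:ℂ) * Complex.I * (1/2)^2/τ = -(Real.pi:ℂ)^2 / (4 * t) := by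
    rw [hτ]; field_simp; norm_num
  rw [e1, e2]; ring


lemma norm_exp_div_le (a : ℝ) (ha : 0 ≤ a) (t : ℂ) (ht : 0 < t.re) :
    ‖Complex.exp (a / t)‖ ≤ Real.exp (a / t.re) := by
  rw [Complex.norm_exp]
  refine Real.exp_le_exp.2 ?_
  rw [show (a:ℂ)/t = a * t⁻¹ by ring, Complex.re_ofReal_mul, Complex.inv_re, div_eq_mul_inv a]
  refine mul_le_mul_of_nonneg_left ?_ ha
  rw [div_le_iff₀ (Complex.normSq_pos.2 (fun h => by simp [h] at ht)), Complex.normSq_apply, inv_mul_eq_div, le_div_iff₀ ht]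
  nlinarith [mul_self_nonneg t.im]

lemma PP_major (t : ℂ) (ht : 0 < t.re) (him : |t.im| ≤ t.re) (h1 : t.re ≤ 1) :
    ‖PP (Complex.exp (-t)) - (1/2) * (t / Real.pi) ^ (1/2:ℂ) * Complex.exp ((Real.pi^2/4 : ℝ) / t)‖
      ≤ 2 * ‖t‖ ^ 2 * ‖(t / Real.pi) ^ (1/2:ℂ) * Complex.exp ((Real.pi^2/4 : ℝ) / t)‖ := by
  have t0 : t ≠ 0 := fun h => by simp [h] at ht
  have p0 : (Real.pi : ℂ) ≠ 0 := by exact_mod_cast Real.pi_ne_zero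
  have hq : ‖Complex.exp (-t)‖ < 1 := by rw [Complex.norm_exp, Real.exp_lt_one_iff]; simpa using ht
  have hu : 1 / (2 * t.re) ≤ (1/t).re := by
    rw [one_div t, Complex.inv_re, Complex.normSq_apply, div_le_div_iff₀ (by positivity) (by nlinarith [mul_self_nonneg t.im])]
    have := abs_le.1 him
    nlinarith
  set v := Real.exp (-2 * Real.pi^2 * (1/t).re) with hv
  have hpi : 9 < Real.pi^2 := by nlinarith [Real.pi_gt_three]
  have hvle : v ≤ t.re ^ 2 / 8 := by
    have hx : 9 / t.re ≤ 2 * Real.pi^2 * (1/t).re := by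
      have : 9 / t.re = 2 * 9 * (1 / (2 * t.re)) := by field_simp
      rw [this]
      gcongr
    have h3 : v ≤ Real.exp (-(9 / t.re)) := Real.exp_le_exp.2 (by linarith)
    refine h3.trans ?_
    rw [Real.exp_neg, inv_le_comm₀ (Real.exp_pos _) (by positivity)]
    have h4 := Real.quadratic_le_exp_of_nonneg (show 0 ≤ 9 / t.re by positivity)
    refine le_trans ?_ h4
    have : (t.re^2/8)⁻¹ = 8 / t.re^2 := by field_simp
    rw [this]
    have h5 : (9/t.re)^2/2 = 81/2 / t.re^2 := by field_simp; norm_num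
    rw [h5]
    have : 8 / t.re^2 ≤ 81/2/t.re^2 := by gcongr; norm_num
    have : 0 ≤ 9 / t.re := by positivity
    linarith
  have hr2 : t.re^2 ≤ 1 := by nlinarith
  have hE := (tt_sum t ht).2 (by rw [← hv]; linarith)
  rw [← hv] at hE
  set E := ∑' k, tt t k with hEd
  have hE2 : ‖E‖ ≤ 1/4 := by linarith
  have hE1 : 3/4 ≤ ‖1 + E‖ := by
    have := norm_sub_le (1 + E) E
    simp at this; linarith
  have hne : 1 + E ≠ 0 := fun h => by rw [h, norm_zero] at hE1; linarith
  have hth := th4_modular t ht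
  rw [← hEd] at hth
  have hPP := PP_mul_th4 _ hq
  rw [hth] at hPP
  set A := (t / (Real.pi:ℂ)) ^ (1/2:ℂ) with hA
  have hA0 : A ≠ 0 := by
    rw [hA, Complex.cpow_def_of_ne_zero (div_ne_zero t0 p0)]; exact Complex.exp_ne_zero _
  have e3 : -(Real.pi:ℂ)^2/(4*t) = - ((Real.pi^2/4 : ℝ) / t) := by push_cast; field_simp
  rw [e3, Complex.exp_neg ((Real.pi^2/4 : ℝ) / t)] at hPP
  set X := Complex.exp ((Real.pi^2/4 : ℝ) / t) with hX
  have hX0 : X ≠ 0 := Complex.exp_ne_zero _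
  have e4 : PP (Complex.exp (-t)) = (1/2) * A * X / (1+E) := by
    generalize PP (Complex.exp (-t)) = Q at hPP ⊢
    field_simp at hPP ⊢
    linear_combination hPP
  have e5 : PP (Complex.exp (-t)) - (1/2) * A * X = (-(1/2) * E / (1+E)) * (A * X) := by
    rw [e4]; field_simp; ring
  rw [e5, norm_mul]
  refine mul_le_mul_of_nonneg_right ?_ (norm_nonneg _)
  rw [norm_div, div_le_iff₀ (by linarith), norm_mul]
  have h6 : ‖(-(1/2:ℂ))‖ = 1/2 := by norm_num
  have h7 : t.re^2 ≤ ‖t‖^2 := by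
    have := Complex.abs_re_le_norm t
    rw [abs_of_pos ht] at this
    gcongr
  rw [h6]
  nlinarith [sq_nonneg t.re]

lemma norm_sqrt_div_pi (t : ℂ) : ‖(t / Real.pi) ^ (1/2:ℂ)‖ = (‖t‖ / Real.pi) ^ (1/2:ℝ) := by
  have := Complex.norm_cpow_real (t / Real.pi) (1/2)
  push_cast at this
  rw [this, norm_div, Complex.norm_real, Real.norm_of_nonneg Real.pi_pos.le]

/-- bound on the real axis -/
lemma PP_real (y : ℝ) (hy : 0 < y) (h1 : y ≤ 1) :
    ‖PP (Complex.exp (-(y:ℂ)))‖ ≤ 3 * Real.exp (Real.pi^2/4 / y) := by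
  have h := PP_major (y:ℂ) (by simpa using hy) (by simpa using hy.le) (by simpa using h1)
  have h2 := norm_exp_div_le (Real.pi^2/4) (by positivity) (y:ℂ) (by simpa using hy)
  have h3 : ‖((y:ℂ) / Real.pi) ^ (1/2:ℂ)‖ ≤ 1 := by
    rw [norm_sqrt_div_pi]
    refine Real.rpow_le_one (by positivity) ?_ (by norm_num)
    rw [div_le_one Real.pi_pos, Complex.norm_real, Real.norm_of_nonneg hy.le]
    linarith [Real.pi_gt_three]
  have h4 : ‖((y:ℂ) / Real.pi) ^ (1/2:ℂ) * Complex.exp ((Real.pi^2/4 : ℝ) / (y:ℂ))‖ ≤ Real.exp (Real.pi^2/4 / y) := by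
    rw [norm_mul]
    refine (mul_le_mul h3 h2 (norm_nonneg _) zero_le_one).trans ?_
    simp
  have h5 : ‖(y:ℂ)‖^2 ≤ 1 := by
    rw [Complex.norm_real, Real.norm_of_nonneg hy.le]; nlinarith
  have h6 := norm_le_norm_add_norm_sub' (PP (Complex.exp (-(y:ℂ)))) ((1/2) * ((y:ℂ) / Real.pi) ^ (1/2:ℂ) * Complex.exp ((Real.pi^2/4 : ℝ) / (y:ℂ)))
  rw [mul_assoc (1/2:ℂ), norm_mul (1/2:ℂ)] at h6
  rw [mul_assoc (1/2:ℂ)] at h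
  have h7 : ‖(1/2:ℂ)‖ = 1/2 := by norm_num
  rw [h7] at h6
  have h8 : 2 * ‖(y:ℂ)‖ ^ 2 * ‖((y:ℂ) / Real.pi) ^ (1/2:ℂ) * Complex.exp ((Real.pi^2/4 : ℝ) / (y:ℂ))‖ ≤ 2 * 1 * Real.exp (Real.pi^2/4 / y) := by
    gcongr
  linarith [Real.exp_pos (Real.pi^2/4/y)]

end EtaAux


namespace EtaAux

/-- odd log coefficients -/
noncomputable def lc (n : ℕ) : ℝ := ((-1)^(n+3) + 1) / (n+2)

lemma lc_nonneg (n : ℕ) : 0 ≤ lc n := by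
  refine div_nonneg ?_ (by positivity)
  rcases neg_one_pow_eq_or ℝ (n+3) with h | h <;> rw [h] <;> norm_num

lemma lc_hasSum (w : ℂ) (hw : ‖w‖ < 1) :
    HasSum (fun n : ℕ => (lc n : ℂ) * w ^ (n+2)) (Complex.log (1+w) - Complex.log (1-w) - 2 * w) := by
  have h := (Complex.hasSum_taylorSeries_log hw).add (Complex.hasSum_taylorSeries_neg_log hw)
  have h2 := (hasSum_nat_add_iff' 2).2 h
  have ev : Complex.log (1+w) - Complex.log (1-w) - 2 * w = Complex.log (1 + w) + -Complex.log (1 - w) -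
      ∑ i ∈ Finset.range 2, ((-1) ^ (i + 1) * w ^ i / i + w ^ i / i) := by
    simp [Finset.sum_range_succ]; ring
  rw [ev]
  refine h2.congr_fun (fun n => ?_)
  rw [lc]; push_cast
  ring

lemma fac_norm_le (w : ℂ) (hw : ‖w‖ < 1) :
    ‖(1 + w) / (1 - w)‖ ≤ ‖(1 + (‖w‖:ℂ)) / (1 - (‖w‖:ℂ))‖ * Real.exp (2 * w.re - 2 * ‖w‖) := by
  have hw' : ‖((‖w‖:ℝ):ℂ)‖ < 1 := by simpa using hw
  have key : ∀ u : ℂ, ‖u‖ < 1 → ‖(1 + u) / (1 - u)‖ = Real.exp ((Complex.log (1+u) - Complex.log (1-u) - 2 * u).re + 2 * u.re) := by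
    intro u hu
    have n1 : 1 + u ≠ 0 := by simpa using one_add_pow_ne u hu 0
    have n2 : 1 - u ≠ 0 := by simpa using one_sub_pow_ne u hu 0
    have : (1 + u) / (1 - u) = Complex.exp (Complex.log (1+u) - Complex.log (1-u)) := by
      rw [Complex.exp_sub, Complex.exp_log n1, Complex.exp_log n2]
    rw [this, Complex.norm_exp]
    congr 1; simp
  rw [key w hw, key _ hw', ← Real.exp_add]
  refine Real.exp_le_exp.2 ?_
  have h1 := lc_hasSum w hw
  have h2 := lc_hasSum _ hw'
  have h3 := (Complex.hasSum_re h1)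
  have h4 := (Complex.hasSum_re h2)
  have := hasSum_le (fun n => ?_) h3 h4
  · rw [Complex.ofReal_re]; linarith
  · have e : ((lc n : ℂ) * ((‖w‖:ℝ):ℂ) ^ (n+2)).re = lc n * ‖w‖ ^ (n+2) := by
      rw [← Complex.ofReal_pow, ← Complex.ofReal_mul, Complex.ofReal_re]
    rw [e, Complex.re_ofReal_mul, ← norm_pow]
    exact mul_le_mul_of_nonneg_left (Complex.re_le_norm _) (lc_nonneg n)

lemma PP_norm_le (q : ℂ) (hq : ‖q‖ < 1) :
    ‖PP q‖ ≤ ‖PP (‖q‖:ℂ)‖ * Real.exp (2 * (q / (1 - q)).re - 2 * (‖q‖ / (1 - ‖q‖))) := by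
  have hq' : ‖((‖q‖:ℝ):ℂ)‖ < 1 := by simpa using hq
  have hK : ∀ K, ‖PK K q‖ ≤ ‖PK K (‖q‖:ℂ)‖ * Real.exp (2 * (∑ i ∈ Finset.range K, q ^ (i+1)).re - 2 * ∑ i ∈ Finset.range K, ‖q‖ ^ (i+1)) := by
    intro K
    induction K with
    | zero => simp [PK]
    | succ K ih =>
      rw [PK_succ, PK_succ, norm_mul, norm_mul, Finset.sum_range_succ, Finset.sum_range_succ]
      have hx : ‖q ^ (K+1)‖ < 1 := by rw [norm_pow]; exact pow_lt_one₀ (norm_nonneg _) hq (by omega)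
      have h := fac_norm_le (q ^ (K+1)) hx
      have e : ((‖q ^ (K+1)‖ : ℝ) : ℂ) = (‖q‖:ℂ) ^ (K+1) := by rw [norm_pow]; push_cast; rfl
      rw [e] at h
      refine (mul_le_mul ih h (norm_nonneg _) (by positivity)).trans (le_of_eq ?_)
      rw [mul_mul_mul_comm, ← Real.exp_add]
      congr 2
      rw [Complex.add_re, norm_pow]; ring
  have g1 : Tendsto (fun K => ∑ i ∈ Finset.range K, q ^ (i+1)) atTop (nhds (q / (1-q))) := by
    have := ((hasSum_geometric_of_norm_lt_one hq).mul_left q).tendsto_sum_nat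
    rw [← div_eq_mul_inv] at this
    exact this.congr (fun K => Finset.sum_congr rfl (fun i _ => by ring))
  have g2 : Tendsto (fun K => ∑ i ∈ Finset.range K, ‖q‖ ^ (i+1)) atTop (nhds (‖q‖ / (1-‖q‖))) := by
    have := ((hasSum_geometric_of_lt_one (norm_nonneg q) hq).mul_left ‖q‖).tendsto_sum_nat
    rw [← div_eq_mul_inv] at this
    exact this.congr (fun K => Finset.sum_congr rfl (fun i _ => by ring))
  refine le_of_tendsto_of_tendsto' (PK_tendsto q hq).norm ?_ hK
  refine (PK_tendsto _ hq').norm.mul ?_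
  refine (Real.continuous_exp.tendsto _).comp ?_
  exact (((Complex.continuous_re.tendsto _).comp g1).const_mul 2).sub (g2.const_mul 2)

lemma norm_exp_sub_one_sq (x y : ℝ) : ‖Complex.exp (y + x * Complex.I) - 1‖ ^ 2 =
    (Real.exp y - 1)^2 + 2 * Real.exp y * (1 - Real.cos x) := by
  rw [← Complex.normSq_eq_norm_sq, Complex.normSq_apply]
  have h1 : (Complex.exp (y + x * Complex.I)).re = Real.exp y * Real.cos x := by
    simp [Complex.exp_re]
  have h2 : (Complex.exp (y + x * Complex.I)).im = Real.exp y * Real.sin x := by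
    simp [Complex.exp_im]
  rw [Complex.sub_re, Complex.sub_im, h1, h2, Complex.one_re, Complex.one_im]
  linear_combination (Real.exp y)^2 * Real.sin_sq_add_cos_sq x

lemma PP_minor (x y : ℝ) (hy : 0 < y) (h1 : y ≤ 1) (hx : y ≤ |x|) (hx2 : |x| ≤ Real.pi) :
    ‖PP (Complex.exp (-(y + x * Complex.I)))‖ ≤ 3 * Real.exp 2 * Real.exp ((Real.pi^2/4 - 1/4) / y) := by
  set t : ℂ := y + x * Complex.I with ht
  have hn : ‖Complex.exp (-t)‖ = Real.exp (-y) := by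
    rw [Complex.norm_exp]; simp [ht]
  have hq : ‖Complex.exp (-t)‖ < 1 := by rw [hn, Real.exp_lt_one_iff]; linarith
  refine (PP_norm_le _ hq).trans ?_
  rw [hn]
  have e1 : ((Real.exp (-y) : ℝ):ℂ) = Complex.exp (-(y:ℂ)) := by push_cast; rfl
  rw [e1]
  have hP := PP_real y hy h1
  have hey : 1 + y ≤ Real.exp y := by linarith [Real.add_one_le_exp y]
  have hb : 1 / y - 1 ≤ Real.exp (-y) / (1 - Real.exp (-y)) := by
    have h3 : 1 - y ≤ Real.exp (-y) := by linarith [Real.add_one_le_exp (-y)]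
    have h4 : Real.exp (-y) < 1 := by rw [Real.exp_lt_one_iff]; linarith
    have : 1 / y - 1 = (1 - y) / y := by field_simp
    rw [this, div_le_div_iff₀ hy (by linarith)]
    nlinarith
  have ha : (Complex.exp (-t) / (1 - Complex.exp (-t))).re ≤ 7/8 / y := by
    refine (Complex.re_le_norm _).trans ?_
    have : Complex.exp (-t) / (1 - Complex.exp (-t)) = 1 / (Complex.exp t - 1) := by
      rw [Complex.exp_neg]
      have := Complex.exp_ne_zero t
      by_cases h : Complex.exp t = 1
      · simp [h]
      · have h' : Complex.exp t - 1 ≠ 0 := sub_ne_zero.2 h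
        have h'' : 1 - (Complex.exp t)⁻¹ ≠ 0 := by
          intro h0; apply h'
          field_simp at h0; simpa using h0
        field_simp
    rw [this, norm_div, norm_one]
    have hsq := norm_exp_sub_one_sq x y
    rw [← ht] at hsq
    have hc := Real.cos_le_one_sub_mul_cos_sq hx2
    have hpi : Real.pi^2 < 10 := by nlinarith [Real.pi_lt_d2, Real.pi_pos]
    have hc2 : 1/5 * y^2 ≤ 1 - Real.cos x := by
      have h5 : y^2 ≤ x^2 := by rw [← sq_abs x]; gcongr
      have h6 : 1/5 ≤ 2 / Real.pi^2 := by
        rw [div_le_div_iff₀ (by norm_num) (by positivity)]; linarith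
      have : 1/5 * y^2 ≤ 2 / Real.pi^2 * x^2 := by gcongr
      linarith
    have h7 : (8/7 * y)^2 ≤ ‖Complex.exp t - 1‖^2 := by
      rw [hsq]
      have h8 : y^2 ≤ (Real.exp y - 1)^2 := by
        have : y ≤ Real.exp y - 1 := by linarith
        gcongr
      have h9 : 1 * (1/5 * y^2) ≤ Real.exp y * (1 - Real.cos x) := by
        refine mul_le_mul (by linarith) hc2 (by positivity) (by positivity)
      nlinarith
    have h10 : 8/7 * y ≤ ‖Complex.exp t - 1‖ := by
      exact le_of_sq_le_sq h7 (norm_nonneg _) 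
    rw [div_le_div_iff₀ (by linarith) hy]
    linarith
  have hE : 2 * (Complex.exp (-t) / (1 - Complex.exp (-t))).re - 2 * (Real.exp (-y) / (1 - Real.exp (-y))) ≤ 2 - 1/4/y := by
    have : 2 * (7/8/y) - 2 * (1/y - 1) = 2 - 1/4/y := by ring
    linarith
  refine (mul_le_mul hP (Real.exp_le_exp.2 hE) (Real.exp_pos _).le (by positivity)).trans (le_of_eq ?_)
  rw [mul_assoc, mul_assoc, ← Real.exp_add, ← Real.exp_add]
  congr 2
  ring

lemma SS_crude (r : ℕ) (q : ℂ) (hq : ‖q‖ < 1) : ‖SS r q‖ ≤ (1 / (1 - ‖q‖)) ^ (r+2) := by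
  have h0 : 0 < 1 - ‖q‖ := by linarith
  have hs : HasSum (fun n : ℕ => (1 / (1 - ‖q‖)) ^ (r+1) * ‖q‖ ^ n) ((1 / (1 - ‖q‖)) ^ (r+1) * (1 - ‖q‖)⁻¹) :=
    (hasSum_geometric_of_lt_one (norm_nonneg q) hq).mul_left _
  rw [pow_succ, one_div (1 - ‖q‖)]
  rw [one_div] at hs
  refine tsum_of_norm_bounded hs (fun n => ?_)
  rw [norm_div]
  simp only [norm_mul, norm_pow, norm_neg, norm_one, one_pow, one_mul]
  have h1 := bnd_exp q hq (r/2+1) n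
  have h2 := norm_one_add_ge q hq n
  have h3 : 1 - ‖q‖ ≤ ‖1 - q ^ (n+1)‖ := by
    have := norm_sub_norm_le (1:ℂ) (q ^ (n+1))
    rw [norm_one, norm_pow] at this
    have h2 : ‖q‖ ^ (n+1) ≤ ‖q‖ := pow_le_of_le_one (norm_nonneg _) hq.le (by omega)
    linarith
  have h4 : ‖q‖ ^ (r/2+1) ≤ 1 := pow_le_one₀ (norm_nonneg _) hq.le
  calc _ ≤ (1 * ‖q‖ ^ n) / ((1 - ‖q‖)^r * (1 - ‖q‖)) := by
        gcongr
        exact h1.trans (by gcongr)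
    _ = _ := by rw [inv_pow, pow_succ]; field_simp

lemma SS_crude' (r : ℕ) (x y : ℝ) (hy : 0 < y) (h1 : y ≤ 1) :
    ‖SS r (Complex.exp (-(y + x * Complex.I)))‖ ≤ (2 / y) ^ (r+2) := by
  have hn : ‖Complex.exp (-(y + x * Complex.I))‖ = Real.exp (-y) := by
    rw [Complex.norm_exp]; simp
  have hq : ‖Complex.exp (-(y + x * Complex.I))‖ < 1 := by rw [hn, Real.exp_lt_one_iff]; linarith
  refine (SS_crude r _ hq).trans ?_
  rw [hn]
  have h4 : Real.exp (-y) < 1 := by rw [Real.exp_lt_one_iff]; linarith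
  have h5 : y / 2 ≤ 1 - Real.exp (-y) := by
    have h6 : Real.exp (-y) ≤ 1 / (1 + y) := by
      rw [Real.exp_neg, ← one_div]
      exact one_div_le_one_div_of_le (by linarith) (by linarith [Real.add_one_le_exp y])
    have : 1 / (1+y) ≤ 1 - y/2 := by
      rw [div_le_iff₀ (by linarith)]; nlinarith
    linarith
  have : 1 / (1 - Real.exp (-y)) ≤ 2 / y := by
    rw [div_le_div_iff₀ (by linarith) hy]; linarith
  gcongr

end EtaAux


namespace EtaAux

lemma cauchy_step (f : ℂ → ℂ) (c : ℂ) (R δ B : ℝ) (hδ : 0 < δ)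
    (hd : DifferentiableOn ℂ f (Metric.ball c R)) (hB : ∀ x ∈ Metric.ball c R, ‖f x‖ ≤ B) :
    DifferentiableOn ℂ (fun z => f (z+1) - f z) (Metric.ball c (R - δ - 1)) ∧
    ∀ z ∈ Metric.ball c (R - δ - 1), ‖f (z+1) - f z‖ ≤ B / δ := by
  have hmem : ∀ z ∈ Metric.ball c (R - δ - 1), z + 1 ∈ Metric.ball c (R - δ) := by
    intro z hz
    rw [Metric.mem_ball, dist_eq_norm] at hz ⊢
    have := norm_add_le (z - c) 1
    rw [norm_one] at this
    rw [show z + 1 - c = z - c + 1 by ring]; linarith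
  have hm0 : ∀ z ∈ Metric.ball c (R - δ - 1), z ∈ Metric.ball c (R - δ) := fun z hz =>
    Metric.ball_subset_ball (by linarith) hz
  have hm1 : Metric.ball c (R - δ) ⊆ Metric.ball c R := Metric.ball_subset_ball (by linarith)
  constructor
  · intro z hz
    have h1 : DifferentiableAt ℂ f (z+1) := hd.differentiableAt (Metric.isOpen_ball.mem_nhds (hm1 (hmem z hz)))
    have h2 : DifferentiableAt ℂ f z := hd.differentiableAt (Metric.isOpen_ball.mem_nhds (hm1 (hm0 z hz)))
    have h3 : DifferentiableAt ℂ (fun z => f (z+1)) z := h1.comp z (differentiableAt_id.add_const 1)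
    exact (h3.sub h2).differentiableWithinAt
  · intro z hz
    have key : ∀ w ∈ Metric.ball c (R - δ), ‖deriv f w‖ ≤ B / δ := by
      intro w hw
      have hsub : Metric.closedBall w δ ⊆ Metric.ball c R := by
        intro u hu
        rw [Metric.mem_closedBall] at hu
        rw [Metric.mem_ball] at hw ⊢
        linarith [dist_triangle u w c]
      refine Complex.norm_deriv_le_of_forall_mem_sphere_norm_le hδ ?_ (fun u hu => hB u (hsub (Metric.sphere_subset_closedBall hu)))
      exact (hd.mono hsub).diffContOnCl_ball subset_rfl
    have := (convex_ball c (R - δ)).norm_image_sub_le_of_norm_deriv_le (f := f)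
      (fun w hw => hd.differentiableAt (Metric.isOpen_ball.mem_nhds (hm1 hw))) key (hm0 z hz) (hmem z hz)
    simpa using this

/-- forward difference -/
def dl (a : ℕ → ℂ) : ℕ → ℂ := fun n => a (n+1) - a n

/-- Euler-transformed alternating sum -/
noncomputable def LL (a : ℕ → ℂ) : ℂ :=
  a 0 / 2 - dl a 0 / 4 + dl (dl a) 0 / 8 - (1/8) * ∑' n, (-1:ℂ)^n * dl (dl (dl a)) n

lemma alt_dl (a : ℕ → ℂ) (h : Summable (fun n => (-1:ℂ)^n * a n)) :
    Summable (fun n => (-1:ℂ)^n * dl a n) ∧ ∑' n, (-1:ℂ)^n * a n = a 0 / 2 - (∑' n, (-1:ℂ)^n * dl a n) / 2 := by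
  have h1 := (summable_nat_add_iff 1).2 h
  have h2 := h.tsum_eq_zero_add
  have e : ∀ n, (-1:ℂ)^n * dl a n = -((-1:ℂ)^(n+1) * a (n+1)) - (-1:ℂ)^n * a n := by
    intro n; rw [dl]; ring
  have hs : Summable (fun n => (-1:ℂ)^n * dl a n) := by
    rw [funext e]; exact h1.neg.sub h
  refine ⟨hs, ?_⟩
  rw [funext e, h1.neg.tsum_sub h, tsum_neg]
  simp at h2
  linear_combination (1/2) * h2

lemma LL_eq (a : ℕ → ℂ) (h : Summable (fun n => (-1:ℂ)^n * a n)) : ∑' n, (-1:ℂ)^n * a n = LL a := by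
  obtain ⟨s1, e1⟩ := alt_dl a h
  obtain ⟨s2, e2⟩ := alt_dl _ s1
  obtain ⟨s3, e3⟩ := alt_dl _ s2
  rw [e1, e2, e3, LL]; ring

/-- Z constant -/
noncomputable def ZZ : ℝ := ∑' n : ℕ, 1 / ((n:ℝ)+1)^2

lemma ZZ_summable : Summable (fun n : ℕ => 1 / ((n:ℝ)+1)^2) := by
  have := (summable_nat_add_iff 1).2 (Real.summable_one_div_nat_pow.2 (show 1 < 2 by norm_num))
  simpa using this

lemma diff3 (h : ℂ → ℂ) (K : ℝ) (hK : 0 ≤ K)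
    (hd : ∀ m : ℕ, 1 ≤ m → DifferentiableOn ℂ h (Metric.ball (m:ℂ) (m/8)))
    (hb : ∀ m : ℕ, 1 ≤ m → ∀ x ∈ Metric.ball (m:ℂ) (m/8), ‖h x‖ ≤ K * m) (n : ℕ) :
    ‖dl (dl (dl (fun n : ℕ => h (n+1)))) n‖ ≤ (32 * 39^3 * K) * (1 / ((n:ℝ)+1)^2) := by
  set m : ℝ := (n:ℝ) + 1 with hm
  have hm1 : 1 ≤ m := by rw [hm]; linarith [Nat.cast_nonneg (α := ℝ) n]
  by_cases hn : n < 38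
  · have hv : ∀ k : ℕ, ‖h ((k:ℂ)+1)‖ ≤ K * ((k:ℝ)+1) := by
      intro k
      have := hb (k+1) (by omega) ((k+1:ℕ):ℂ) (Metric.mem_ball_self (by positivity))
      push_cast at this; exact this
    have e : dl (dl (dl (fun n : ℕ => h (n+1)))) n = h ((n+3:ℕ)+1) - 3 * h ((n+2:ℕ)+1) + 3 * h ((n+1:ℕ)+1) - h ((n:ℕ)+1) := by
      simp only [dl]; ring_nf
    rw [e]
    have n1 : ‖h ((n+3:ℕ)+1) - 3 * h ((n+2:ℕ)+1) + 3 * h ((n+1:ℕ)+1) - h ((n:ℕ)+1)‖ ≤ ‖h ((n+3:ℕ)+1)‖ + 3 * ‖h ((n+2:ℕ)+1)‖ + 3 * ‖h ((n+1:ℕ)+1)‖ + ‖h ((n:ℕ)+1)‖ := by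
      have a1 := norm_sub_le (h ((n+3:ℕ)+1) - 3 * h ((n+2:ℕ)+1) + 3 * h ((n+1:ℕ)+1)) (h ((n:ℕ)+1))
      have a2 := norm_add_le (h ((n+3:ℕ)+1) - 3 * h ((n+2:ℕ)+1)) (3 * h ((n+1:ℕ)+1))
      have a3 := norm_sub_le (h ((n+3:ℕ)+1)) (3 * h ((n+2:ℕ)+1))
      rw [norm_mul] at a2 a3
      norm_num at a1 a2 a3 ⊢
      linarith
    have h0 := hv n
    have h1 := hv (n+1)
    have h2 := hv (n+2)
    have h3 := hv (n+3)
    push_cast at n1 h0 h1 h2 h3 ⊢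
    have hm2 : m ≤ 39 := by
      have : (n:ℝ) ≤ 38 := by exact_mod_cast hn.le
      rw [hm]; linarith
    have hle : 32 * (K * m) ≤ (32 * 39^3 * K) * (1 / m^2) := by
      rw [mul_one_div, le_div_iff₀ (by positivity)]
      have : m^3 ≤ 39^3 := by gcongr
      nlinarith
    have e2 : (n:ℝ) = m - 1 := by rw [hm]; ring
    rw [e2] at h0 h1 h2 h3
    have hKm : K ≤ K * m := by nlinarith
    refine n1.trans (le_trans ?_ hle)
    nlinarith
  · push Not at hn
    have hm39 : 39 ≤ m := by
      have : (38:ℝ) ≤ n := by exact_mod_cast hn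
      rw [hm]; linarith
    have d0 := hd (n+1) (by omega)
    have b0 := hb (n+1) (by omega)
    push_cast at d0 b0
    rw [← hm] at d0 b0
    have hδ : 0 < m / 64 := by positivity
    obtain ⟨d1, b1⟩ := cauchy_step _ _ _ _ _ hδ d0 b0
    obtain ⟨d2, b2⟩ := cauchy_step _ _ _ _ _ hδ d1 b1
    obtain ⟨d3, b3⟩ := cauchy_step _ _ _ _ _ hδ d2 b2
    have := b3 ((n:ℂ)+1) (Metric.mem_ball_self (by linarith))
    have e : dl (dl (dl (fun n : ℕ => h (n+1)))) n = h ((n:ℂ)+1+1+1+1) - h ((n:ℂ)+1+1+1) - (h ((n:ℂ)+1+1+1) - h ((n:ℂ)+1+1)) - (h ((n:ℂ)+1+1+1) - h ((n:ℂ)+1+1) - (h ((n:ℂ)+1+1) - h ((n:ℂ)+1))) := by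
      simp only [dl]; push_cast; rfl
    rw [e]
    refine this.trans ?_
    have : K * m / (m/64) / (m/64) / (m/64) = (64^3 * K) * (1/m^2) := by
      field_simp
    rw [this]
    gcongr
    norm_num

lemma LL_bound (h : ℂ → ℂ) (K : ℝ) (hK : 0 ≤ K)
    (hd : ∀ m : ℕ, 1 ≤ m → DifferentiableOn ℂ h (Metric.ball (m:ℂ) (m/8)))
    (hb : ∀ m : ℕ, 1 ≤ m → ∀ x ∈ Metric.ball (m:ℂ) (m/8), ‖h x‖ ≤ K * m) :
    Summable (fun n => (-1:ℂ)^n * dl (dl (dl (fun n : ℕ => h (n+1)))) n) ∧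
    ‖LL (fun n : ℕ => h (n+1))‖ ≤ (4 + 32 * 39^3 * ZZ) * K := by
  have h3 := diff3 h K hK hd hb
  have h3' : ∀ n, ‖(-1:ℂ)^n * dl (dl (dl (fun n : ℕ => h (n+1)))) n‖ ≤ (32 * 39^3 * K) * (1 / ((n:ℝ)+1)^2) := by
    intro n; rw [norm_mul, norm_pow, norm_neg, norm_one, one_pow, one_mul]; exact h3 n
  have hs := (ZZ_summable.hasSum.mul_left (32 * 39^3 * K))
  refine ⟨Summable.of_norm_bounded hs.summable h3', ?_⟩
  have hT := tsum_of_norm_bounded hs h3'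
  have hv : ∀ k : ℕ, ‖h ((k:ℂ)+1)‖ ≤ K * ((k:ℝ)+1) := by
    intro k
    have := hb (k+1) (by omega) ((k+1:ℕ):ℂ) (Metric.mem_ball_self (by positivity))
    push_cast at this; exact this
  rw [LL]
  set T := ∑' n, (-1:ℂ)^n * dl (dl (dl (fun n : ℕ => h (n+1)))) n
  have h0 := hv 0
  have h1 := hv 1
  have h2 := hv 2
  simp only [dl]
  set x0 := h ((0:ℕ)+1)
  set x1 := h ((0+1:ℕ)+1)
  set x2 := h ((0+1+1:ℕ)+1)
  have e : x0 / 2 - (x1 - x0)/4 + (x2 - x1 - (x1 - x0))/8 - (1/8) * T = (7/8) * x0 - (1/2) * x1 + (1/8) * x2 - (1/8) * T := by ring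
  rw [e]
  have a1 := norm_sub_le ((7/8) * x0 - (1/2) * x1 + (1/8) * x2) ((1/8) * T)
  have a2 := norm_add_le ((7/8) * x0 - (1/2) * x1) ((1/8) * x2)
  have a3 := norm_sub_le ((7/8) * x0) ((1/2) * x1)
  rw [norm_mul] at a1 a2
  rw [norm_mul, norm_mul] at a3
  have f0 : ‖x0‖ ≤ K * ((0:ℕ)+1) := h0
  have f1 : ‖x1‖ ≤ K * ((1:ℕ)+1) := h1
  have f2 : ‖x2‖ ≤ K * ((2:ℕ)+1) := h2
  norm_num at a1 a2 a3 f0 f1 f2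
  have hT' : ‖T‖ ≤ (32 * 39^3 * K) * ZZ := hT
  have := norm_nonneg T
  nlinarith

lemma LL_lin (a b c d : ℕ → ℂ) (t : ℂ) (h : ∀ n, d n = a n + t * b n + c n)
    (ha : Summable (fun n => (-1:ℂ)^n * dl (dl (dl a)) n))
    (hb : Summable (fun n => (-1:ℂ)^n * dl (dl (dl b)) n))
    (hc : Summable (fun n => (-1:ℂ)^n * dl (dl (dl c)) n)) :
    LL d = LL a + t * LL b + LL c := by
  have e : ∀ n, (-1:ℂ)^n * dl (dl (dl d)) n = (-1:ℂ)^n * dl (dl (dl a)) n + t * ((-1:ℂ)^n * dl (dl (dl b)) n) + (-1:ℂ)^n * dl (dl (dl c)) n := by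
    intro n; simp only [dl, h]; ring
  have e2 : ∑' n, (-1:ℂ)^n * dl (dl (dl d)) n = ∑' n, (-1:ℂ)^n * dl (dl (dl a)) n + t * (∑' n, (-1:ℂ)^n * dl (dl (dl b)) n) + ∑' n, (-1:ℂ)^n * dl (dl (dl c)) n := by
    rw [tsum_congr e, (ha.add (hb.mul_left t)).tsum_add hc, ha.tsum_add (hb.mul_left t), tsum_mul_left]
  rw [LL, LL, LL, LL, e2]
  simp only [dl, h]; ring

lemma split_gen (f : ℕ → ℂ) (hf : Summable f) : ∑' k, f (2*k) + ∑' k, f (2*k+1) = ∑' k, f k := by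
  have ie : Function.Injective (fun k : ℕ => 2 * k) := fun a b h => by
    have h' : 2 * a = 2 * b := h
    omega
  have io : Function.Injective (fun k : ℕ => 2 * k + 1) := fun a b h => by
    have h' : 2 * a + 1 = 2 * b + 1 := h
    omega
  exact tsum_even_add_odd (hf.comp_injective ie) (hf.comp_injective io)

lemma eta_sum (r : ℕ) (hr : 2 ≤ r) : Summable (fun n : ℕ => (-1:ℂ)^n * (1 / ((n:ℂ)+1)^r)) ∧
    ∑' n : ℕ, (-1:ℂ)^n * (1 / ((n:ℂ)+1)^r) = (1 - 2 * (1/2)^r) * riemannZeta r := by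
  have hz := zeta_nat_eq_tsum_of_gt_one (show 1 < r by omega)
  have hs0 : Summable (fun n : ℕ => 1 / (n:ℂ)^r) := by
    refine Summable.of_norm ((Real.summable_one_div_nat_pow.2 (show 1 < r by omega)).congr (fun n => ?_))
    simp
  have hs : Summable (fun n : ℕ => 1 / ((n:ℂ)+1)^r) := by
    have := (summable_nat_add_iff 1).2 hs0
    simpa using this
  have hS : ∑' n : ℕ, 1 / ((n:ℂ)+1)^r = riemannZeta r := by
    rw [hz, hs0.tsum_eq_zero_add]
    have : r ≠ 0 := by omega
    simp [this]
  have hA : Summable (fun n : ℕ => (-1:ℂ)^n * (1 / ((n:ℂ)+1)^r)) := by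
    refine Summable.of_norm (hs.norm.congr (fun n => ?_))
    rw [norm_mul, norm_pow, norm_neg, norm_one, one_pow, one_mul]
  refine ⟨hA, ?_⟩
  have p1 := split_gen (fun n : ℕ => 1 / ((n:ℂ)+1)^r) hs
  have p2 := split_gen (fun n : ℕ => (-1:ℂ)^n * (1 / ((n:ℂ)+1)^r)) hA
  have o1 : ∑' k : ℕ, 1 / (((2*k+1:ℕ):ℂ)+1)^r = (1/2)^r * riemannZeta r := by
    rw [← hS, ← tsum_mul_left]
    refine tsum_congr (fun k => ?_)
    rw [show (((2*k+1:ℕ):ℂ)+1) = 2 * ((k:ℂ)+1) by push_cast; ring, mul_pow, one_div_pow]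
    field_simp
  have q1 : ∀ k : ℕ, (-1:ℂ)^(2*k) = 1 := fun k => by simp
  have q2 : ∀ k : ℕ, (-1:ℂ)^(2*k+1) = -1 := fun k => by rw [pow_succ]; simp
  have r1 : ∑' k : ℕ, (-1:ℂ)^(2*k) * (1 / (((2*k:ℕ):ℂ)+1)^r) = ∑' k : ℕ, 1 / (((2*k:ℕ):ℂ)+1)^r :=
    tsum_congr (fun k => by rw [q1, one_mul])
  have r2 : ∑' k : ℕ, (-1:ℂ)^(2*k+1) * (1 / (((2*k+1:ℕ):ℂ)+1)^r) = - ∑' k : ℕ, 1 / (((2*k+1:ℕ):ℂ)+1)^r := by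
    rw [← tsum_neg]
    exact tsum_congr (fun k => by rw [q2, neg_one_mul])
  rw [r1, r2] at p2
  rw [← p2]
  rw [hS] at p1
  linear_combination p1 - 2 * o1

end EtaAux


namespace EtaAux

/-- regularised kernel -/
noncomputable def gk (r : ℕ) (w : ℂ) : ℂ :=
  Complex.exp (-((r/2+1 : ℕ) : ℂ) * w) / (dslope (fun w => 1 - Complex.exp (-w)) 0 w ^ r * (1 + Complex.exp (-w)))

lemma gk_eq (r : ℕ) (w : ℂ) (hw : w ≠ 0) :
    gk r w = w ^ r * Complex.exp (-((r/2+1 : ℕ) : ℂ) * w) / ((1 - Complex.exp (-w)) ^ r * (1 + Complex.exp (-w))) := by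
  rw [gk, dslope_of_ne _ hw, slope_def_field]
  simp only [neg_zero, Complex.exp_zero, sub_self, sub_zero]
  rw [div_pow, div_mul_eq_mul_div, div_div_eq_mul_div]
  ring

lemma gk_zero (r : ℕ) : gk r 0 = 1/2 := by
  have h : HasDerivAt (fun w : ℂ => 1 - Complex.exp (-w)) 1 0 := by
    have h1 : HasDerivAt (fun w : ℂ => Complex.exp (-w)) (Complex.exp (-0) * (-1)) 0 := (hasDerivAt_neg (0:ℂ)).cexp
    have h2 := h1.const_sub 1
    simpa using h2
  rw [gk, dslope_same, h.deriv]
  norm_num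

lemma gk_analytic (r : ℕ) : AnalyticAt ℂ (gk r) 0 := by
  have h : HasDerivAt (fun w : ℂ => 1 - Complex.exp (-w)) 1 0 := by
    have h1 : HasDerivAt (fun w : ℂ => Complex.exp (-w)) (Complex.exp (-0) * (-1)) 0 := (hasDerivAt_neg (0:ℂ)).cexp
    have h2 := h1.const_sub 1
    simpa using h2
  have h1 : AnalyticAt ℂ (dslope (fun w : ℂ => 1 - Complex.exp (-w)) 0) 0 := by
    have h0 : Differentiable ℂ (fun w : ℂ => 1 - Complex.exp (-w)) := by fun_prop
    have : DifferentiableOn ℂ (dslope (fun w : ℂ => 1 - Complex.exp (-w)) 0) Set.univ :=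
      (Complex.differentiableOn_dslope Filter.univ_mem).2 h0.differentiableOn
    exact (this.analyticOnNhd isOpen_univ) 0 (Set.mem_univ _)
  have h2 : Differentiable ℂ (fun w : ℂ => 1 + Complex.exp (-w)) := by fun_prop
  have h3 : Differentiable ℂ (fun w : ℂ => Complex.exp (-((r/2+1 : ℕ) : ℂ) * w)) := by fun_prop
  refine (h3.analyticAt 0).div ((h1.pow r).mul (h2.analyticAt 0)) ?_
  rw [dslope_same, h.deriv]
  norm_num

lemma pow_mul_exp_bdd (r : ℕ) (x : ℝ) (hx : 0 ≤ x) : x ^ r * Real.exp (-(x/2)) ≤ 2^r * r.factorial := by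
  have h := Real.pow_div_factorial_le_exp (x/2) (by positivity) r
  rw [Real.exp_neg]
  rw [div_le_iff₀ (by positivity), div_pow, div_le_iff₀ (by positivity)] at h
  rw [mul_inv_le_iff₀ (Real.exp_pos _)]
  linarith

lemma gk_taylor (r : ℕ) : ∃ g1 : ℂ, ∃ C : ℝ, 0 ≤ C ∧ ∀ w : ℂ, ‖w‖ ≤ 2 * w.re →
    ‖gk r w - 1/2 - g1 * w‖ ≤ C * ‖w‖^2 := by
  obtain ⟨p, hp⟩ := gk_analytic r
  have hO := hp.isBigO_sub_partialSum_pow 2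
  obtain ⟨C1, hC1⟩ := hO.bound
  obtain ⟨δ, hδ, hball⟩ := Metric.eventually_nhds_iff.1 hC1
  set g1 : ℂ := p 1 (fun _ => 1) with hg1
  have hps : ∀ y : ℂ, p.partialSum 2 y = 1/2 + g1 * y := by
    intro y
    rw [FormalMultilinearSeries.partialSum]
    simp only [Finset.sum_range_succ, Finset.range_zero, Finset.sum_empty, zero_add]
    have h0 : p 0 (fun _ => y) = 1/2 := by
      rw [← gk_zero r]; exact hp.coeff_zero _
    have h1 : p 1 (fun _ => y) = g1 * y := by
      have := (p 1).map_smul_univ (fun _ => y) (fun _ => 1)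
      simp only [smul_eq_mul, mul_one] at this
      rw [this]; simp [hg1]; ring
    rw [h0, h1]
  -- far bound
  set e0 : ℝ := 1 - Real.exp (-(δ/2)) with he0
  have he0p : 0 < e0 := by
    have : Real.exp (-(δ/2)) < 1 := by rw [Real.exp_lt_one_iff]; linarith
    linarith
  set C2 : ℝ := 2^r * r.factorial / (e0^r * e0) with hC2
  have hC2p : 0 ≤ C2 := by positivity
  refine ⟨g1, max C1 0 + (C2 + 1/2) / δ^2 + ‖g1‖ / δ, by positivity, fun w hw => ?_⟩
  by_cases hwδ : ‖w‖ < δ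
  · have := hball (y := w) (by simpa using hwδ)
    rw [zero_add, hps] at this
    rw [sub_sub]
    refine this.trans ?_
    rw [norm_pow, norm_norm]
    refine mul_le_mul_of_nonneg_right ?_ (by positivity)
    have : 0 ≤ (C2 + 1/2) / δ^2 + ‖g1‖ / δ := by positivity
    linarith [le_max_left C1 0]
  · push Not at hwδ
    have hw0 : w ≠ 0 := fun h => by rw [h, norm_zero] at hwδ; linarith
    have hre : δ/2 ≤ w.re := by linarith
    have hexp : ‖Complex.exp (-w)‖ ≤ Real.exp (-(δ/2)) := by
      rw [Complex.norm_exp]; exact Real.exp_le_exp.2 (by simp; linarith)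
    have d1 : e0 ≤ ‖1 - Complex.exp (-w)‖ := by
      have := norm_sub_norm_le (1:ℂ) (Complex.exp (-w))
      rw [norm_one] at this; linarith
    have d2 : e0 ≤ ‖1 + Complex.exp (-w)‖ := by
      have := norm_sub_norm_le (1:ℂ) (-Complex.exp (-w))
      rw [norm_one, norm_neg, sub_neg_eq_add] at this; linarith
    have hg : ‖gk r w‖ ≤ C2 := by
      rw [gk_eq r w hw0, norm_div, norm_mul, norm_mul, norm_pow, norm_pow, hC2]
      refine div_le_div₀ (by positivity) ?_ (by positivity) ?_
      · refine le_trans ?_ (pow_mul_exp_bdd r ‖w‖ (norm_nonneg _))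
        gcongr
        rw [Complex.norm_exp]
        refine Real.exp_le_exp.2 ?_
        have : (-((r/2+1 : ℕ) : ℂ) * w).re = -(((r/2+1 : ℕ) : ℝ) * w.re) := by
          rw [← Complex.ofReal_natCast, ← Complex.ofReal_neg, Complex.re_ofReal_mul]; ring
        rw [this]
        have h1 : (1:ℝ) ≤ ((r/2+1 : ℕ) : ℝ) := by exact_mod_cast Nat.le_add_left 1 _
        nlinarith
      · gcongr
    have a1 := norm_sub_le (gk r w - 1/2) (g1 * w)
    have a2 := norm_sub_le (gk r w) (1/2)
    rw [norm_mul] at a1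
    have a3 : ‖(1/2:ℂ)‖ = 1/2 := by norm_num
    rw [a3] at a2
    have b1 : (C2 + 1/2) ≤ (C2 + 1/2) / δ^2 * ‖w‖^2 := by
      rw [div_mul_eq_mul_div, le_div_iff₀ (by positivity)]
      gcongr
    have b2 : ‖g1‖ * ‖w‖ ≤ ‖g1‖ / δ * ‖w‖^2 := by
      rw [div_mul_eq_mul_div, le_div_iff₀ (by positivity), mul_assoc, pow_two]
      gcongr
    have b3 : 0 ≤ max C1 0 * ‖w‖^2 := by positivity
    nlinarith

lemma norm_exp_sub_one_le (u : ℂ) (hu : 0 ≤ u.re) : ‖Complex.exp (-u) - 1‖ ≤ ‖u‖ := by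
  have h := Convex.norm_image_sub_le_of_norm_hasDerivWithin_le (𝕜 := ℂ) (f := fun z : ℂ => Complex.exp (-z)) (f' := fun z => Complex.exp (-z) * (-1))
    (s := {z : ℂ | 0 ≤ z.re}) (C := 1) (x := 0) (y := u)
    (fun z _ => ((hasDerivAt_neg z).cexp).hasDerivWithinAt)
    (fun z hz => by
      rw [norm_mul, norm_neg, norm_one, mul_one, Complex.norm_exp, Real.exp_le_one_iff]
      simpa using hz)
    (convex_halfSpace_re_ge 0) (by simp) hu
  simpa using h

lemma norm_exp_sub_two_le (u : ℂ) (hu : 0 ≤ u.re) : ‖Complex.exp (-u) - 1 + u‖ ≤ ‖u‖^2 := by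
  have h := Convex.norm_image_sub_le_of_norm_hasDerivWithin_le (𝕜 := ℂ) (f := fun z : ℂ => Complex.exp (-z) + z) (f' := fun z => Complex.exp (-z) * (-1) + 1)
    (s := {z : ℂ | 0 ≤ z.re} ∩ Metric.closedBall 0 ‖u‖) (C := ‖u‖) (x := 0) (y := u)
    (fun z _ => (((hasDerivAt_neg z).cexp).add (hasDerivAt_id z)).hasDerivWithinAt)
    (fun z hz => by
      have h1 := norm_exp_sub_one_le z hz.1
      have h2 : ‖z‖ ≤ ‖u‖ := by simpa using hz.2
      rw [show Complex.exp (-z) * (-1) + 1 = -(Complex.exp (-z) - 1) by ring, norm_neg]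
      linarith)
    ((convex_halfSpace_re_ge 0).inter (convex_closedBall 0 ‖u‖)) (by simp) (by simp [hu])
  simp only [neg_zero, Complex.exp_zero, add_zero, sub_zero] at h
  rw [show Complex.exp (-u) - 1 + u = Complex.exp (-u) + u - 1 by ring, pow_two]
  exact h

/-- geometry: x near m, t in the cone -/
lemma cone_geom (t x : ℂ) (m : ℝ) (hm : 1 ≤ m) (him : |t.im| ≤ t.re) (hx : ‖x - m‖ < m/8) :
    ‖x * t‖ ≤ 2 * (x * t).re ∧ 0 ≤ (x^2 * t).re ∧ 7/8 * m ≤ ‖x‖ ∧ ‖x‖ ≤ 2 * m := by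
  have hmC : ‖(m:ℂ)‖ = m := by rw [Complex.norm_real, Real.norm_of_nonneg (by linarith)]
  have hx1 : ‖x‖ ≤ 9/8 * m := by
    have := norm_add_le (x - m) m
    rw [sub_add_cancel, hmC] at this; linarith
  have hx2 : 7/8 * m ≤ ‖x‖ := by
    have := norm_sub_norm_le (m:ℂ) (m - x)
    rw [sub_sub_cancel, hmC, norm_sub_rev] at this; linarith
  have hre0 : 0 ≤ t.re := (abs_nonneg _).trans him
  have ht : 7/10 * ‖t‖ ≤ t.re := by
    refine le_of_sq_le_sq ?_ hre0
    rw [mul_pow, ← Complex.normSq_eq_norm_sq, Complex.normSq_apply]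
    have := abs_le.1 him
    nlinarith
  refine ⟨?_, ?_, hx2, by linarith⟩
  · have e : x * t = (m:ℂ) * t + (x - m) * t := by ring
    have h1 : (x*t).re = m * t.re + ((x - m) * t).re := by rw [e, Complex.add_re, Complex.re_ofReal_mul]
    have h2 := Complex.abs_re_le_norm ((x - m) * t)
    rw [norm_mul] at h2 ⊢
    have h3 := neg_abs_le ((x - m) * t).re
    have h4 : ‖x - m‖ * ‖t‖ ≤ m/8 * ‖t‖ := by gcongr
    have h5 : ‖x‖ * ‖t‖ ≤ 9/8 * m * ‖t‖ := by gcongr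
    have h6 : m * (7/10 * ‖t‖) ≤ m * t.re := by gcongr
    have h7 : 0 ≤ m * ‖t‖ := by positivity
    rw [h1]; nlinarith
  · have e : x^2 * t = ((m^2:ℝ):ℂ) * t + (x - m) * (x + m) * t := by push_cast; ring
    have h1 : (x^2*t).re = m^2 * t.re + ((x - m) * (x + m) * t).re := by
      rw [e, Complex.add_re, Complex.re_ofReal_mul]
    have h2 := Complex.abs_re_le_norm ((x - m) * (x + m) * t)
    rw [norm_mul, norm_mul] at h2
    have h3 := neg_abs_le ((x - m) * (x + m) * t).re
    have h8 : ‖x + m‖ ≤ 17/8 * m := by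
      have := norm_add_le x m
      rw [hmC] at this; linarith
    have h4 : ‖x - m‖ * ‖x + m‖ * ‖t‖ ≤ m/8 * (17/8 * m) * ‖t‖ := by gcongr
    have h6 : m^2 * (7/10 * ‖t‖) ≤ m^2 * t.re := by gcongr
    have h7 : 0 ≤ m^2 * ‖t‖ := by positivity
    rw [h1]; nlinarith

end EtaAux


namespace EtaAux

lemma SS_summable (r : ℕ) (q : ℂ) (hq : ‖q‖ < 1) :
    Summable (fun n : ℕ => (-1 : ℂ) ^ n * q ^ ((n+1)^2 + (r/2+1) * (n+1)) / ((1 - q ^ (n+1)) ^ r * (1 + q ^ (n+1)))) := by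
  have h0 : 0 < 1 - ‖q‖ := by linarith
  have hs : HasSum (fun n : ℕ => (1 - ‖q‖)⁻¹ ^ (r+1) * ‖q‖ ^ n) ((1 - ‖q‖)⁻¹ ^ (r+1) * (1 - ‖q‖)⁻¹) :=
    (hasSum_geometric_of_lt_one (norm_nonneg q) hq).mul_left _
  refine Summable.of_norm_bounded hs.summable (fun n => ?_)
  rw [norm_div]
  simp only [norm_mul, norm_pow, norm_neg, norm_one, one_pow, one_mul]
  have h1 := bnd_exp q hq (r/2+1) n
  have h2 := norm_one_add_ge q hq n
  have h3 : 1 - ‖q‖ ≤ ‖1 - q ^ (n+1)‖ := by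
    have := norm_sub_norm_le (1:ℂ) (q ^ (n+1))
    rw [norm_one, norm_pow] at this
    have h2 : ‖q‖ ^ (n+1) ≤ ‖q‖ := pow_le_of_le_one (norm_nonneg _) hq.le (by omega)
    linarith
  have h4 : ‖q‖ ^ (r/2+1) ≤ 1 := pow_le_one₀ (norm_nonneg _) hq.le
  calc _ ≤ (1 * ‖q‖ ^ n) / ((1 - ‖q‖)^r * (1 - ‖q‖)) := by
        gcongr
        exact h1.trans (by gcongr)
    _ = _ := by rw [inv_pow, pow_succ]; field_simp

/-- the summand -/
noncomputable def Gt (r : ℕ) (t x : ℂ) : ℂ :=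
  2 * t^r * (Complex.exp (-((r/2+1 : ℕ) : ℂ) * (x*t)) * Complex.exp (-(x^2*t)) / ((1 - Complex.exp (-(x*t))) ^ r * (1 + Complex.exp (-(x*t)))))

lemma SS_eq_Gt (r : ℕ) (t : ℂ) (ht : 0 < t.re) :
    Summable (fun n : ℕ => (-1:ℂ)^n * Gt r t (n+1)) ∧
    2 * t^r * SS r (Complex.exp (-t)) = ∑' n : ℕ, (-1:ℂ)^n * Gt r t (n+1) := by
  have hq : ‖Complex.exp (-t)‖ < 1 := by rw [Complex.norm_exp, Real.exp_lt_one_iff]; simpa using ht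
  have hs := SS_summable r _ hq
  have e : ∀ n : ℕ, (-1:ℂ)^n * Gt r t (n+1) = 2 * t^r * ((-1 : ℂ) ^ n * Complex.exp (-t) ^ ((n+1)^2 + (r/2+1) * (n+1)) / ((1 - Complex.exp (-t) ^ (n+1)) ^ r * (1 + Complex.exp (-t) ^ (n+1)))) := by
    intro n
    have e1 : Complex.exp (-t) ^ (n+1) = Complex.exp (-(((n:ℂ)+1)*t)) := by
      rw [← Complex.exp_nat_mul]; congr 1; push_cast; ring
    have e2 : Complex.exp (-t) ^ ((n+1)^2 + (r/2+1) * (n+1)) = Complex.exp (-((r/2+1 : ℕ) : ℂ) * (((n:ℂ)+1)*t)) * Complex.exp (-(((n:ℂ)+1)^2*t)) := by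
      rw [← Complex.exp_nat_mul, ← Complex.exp_add]; congr 1; push_cast; ring
    rw [e1, e2, Gt]; ring
  rw [funext e]
  refine ⟨hs.mul_left _, ?_⟩
  rw [tsum_mul_left, SS]

lemma xr_bound (r : ℕ) (hr : 3 ≤ r) (m X : ℝ) (hm : 1 ≤ m) (h1 : 7/8 * m ≤ X) (h2 : X ≤ 2 * m) :
    X^4 / X^r ≤ 2^r * m := by
  obtain ⟨k, rfl⟩ := Nat.exists_eq_add_of_le hr
  have hX : 1/2 ≤ X := by linarith
  have hX0 : 0 < X := by linarith
  have h3 : (1/2:ℝ)^k ≤ X^k := by gcongr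
  have e : X^4 / X^(3+k) = X / X^k := by
    rw [pow_add]; field_simp
  rw [e, div_le_iff₀ (by positivity)]
  have h4 : 1 ≤ 2^k * X^k := by
    have : (2:ℝ)^k * (1/2)^k = 1 := by rw [← mul_pow]; norm_num
    rw [← this]; gcongr
  calc X ≤ 2 * m * 1 := by linarith
    _ ≤ 2 * m * (2^k * X^k) := by gcongr
    _ ≤ 8 * m * (2^k * X^k) := by gcongr; norm_num
    _ = _ := by ring

theorem SS_major (r : ℕ) (hr : 3 ≤ r) : ∃ c1 : ℂ, ∃ C : ℝ, 0 ≤ C ∧ ∀ t : ℂ, 0 < t.re → |t.im| ≤ t.re →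
    ‖2 * t^r * SS r (Complex.exp (-t)) - (1 - 2 * (1/2)^r) * riemannZeta r - c1 * t‖ ≤ C * ‖t‖^2 := by
  obtain ⟨g1, C0, hC0, hg⟩ := gk_taylor r
  set ha : ℂ → ℂ := fun x => 1 / x^r with hha
  set hb : ℂ → ℂ := fun x => 2 * (g1 * x - 1/2 * x^2) / x^r with hhb
  have hmem : ∀ (m : ℕ) (x : ℂ), x ∈ Metric.ball (m:ℂ) (m/8) → ‖x - ((m:ℝ):ℂ)‖ < (m:ℝ)/8 := by
    intro m x hx; rw [Metric.mem_ball, dist_eq_norm] at hx; simpa using hx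
  have hm1 : ∀ m : ℕ, 1 ≤ m → (1:ℝ) ≤ m := fun m h => by exact_mod_cast h
  have hx0 : ∀ (m : ℕ), 1 ≤ m → ∀ (x : ℂ), x ∈ Metric.ball (m:ℂ) (m/8) → 7/8 * (m:ℝ) ≤ ‖x‖ ∧ ‖x‖ ≤ 2 * m ∧ x ≠ 0 := by
    intro m hm x hx
    obtain ⟨_, _, h3, h4⟩ := cone_geom 0 x m (hm1 m hm) (by simp) (hmem m x hx)
    refine ⟨h3, h4, fun h => ?_⟩
    rw [h, norm_zero] at h3
    linarith [hm1 m hm]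
  have hpows : ∀ X : ℝ, 7/8 ≤ X → 1 ≤ 2 * X^4 ∧ X ≤ 2 * X^4 ∧ X^2 ≤ 2 * X^4 ∧ X^3 ≤ 2 * X^4 := by
    intro X hX
    have p1 : 1/2 ≤ X^3 := by
      have : (7/8:ℝ)^3 ≤ X^3 := by gcongr
      norm_num at this ⊢; linarith
    have p2 : 1/2 ≤ X^2 := by
      have : (7/8:ℝ)^2 ≤ X^2 := by gcongr
      norm_num at this ⊢; linarith
    have p3 : 1/2 ≤ X^4 := by
      have : (7/8:ℝ)^4 ≤ X^4 := by gcongr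
      norm_num at this ⊢; linarith
    refine ⟨by linarith, by nlinarith, by nlinarith, ?_⟩
    have : 0 ≤ X^3 := by positivity
    nlinarith
  have conv : ∀ (m : ℕ), 1 ≤ m → ∀ (x : ℂ), x ∈ Metric.ball (m:ℂ) (m/8) → ∀ (H : ℂ) (K : ℝ), 0 ≤ K → ‖H‖ ≤ K * ‖x‖^4 → ‖H / x^r‖ ≤ K * 2^r * m := by
    intro m hm x hx H K hK hH
    obtain ⟨h1, h2, h3⟩ := hx0 m hm x hx
    rw [norm_div, norm_pow]
    calc ‖H‖ / ‖x‖^r ≤ K * ‖x‖^4 / ‖x‖^r := by gcongr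
      _ = K * (‖x‖^4 / ‖x‖^r) := by ring
      _ ≤ K * (2^r * m) := by gcongr; exact xr_bound r hr m _ (hm1 m hm) h1 h2
      _ = _ := by ring
  have h78 : ∀ (m : ℕ), 1 ≤ m → ∀ (x : ℂ), x ∈ Metric.ball (m:ℂ) (m/8) → 7/8 ≤ ‖x‖ := by
    intro m hm x hx
    have := (hx0 m hm x hx).1
    linarith [hm1 m hm]
  have da : ∀ m : ℕ, 1 ≤ m → DifferentiableOn ℂ ha (Metric.ball (m:ℂ) (m/8)) := by
    intro m hm x hx
    have := (hx0 m hm x hx).2.2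
    have n1 : DifferentiableAt ℂ (fun _ : ℂ => (1:ℂ)) x := by fun_prop
    have n2 : DifferentiableAt ℂ (fun x : ℂ => x^r) x := by fun_prop
    exact (n1.fun_div n2 (pow_ne_zero r this)).differentiableWithinAt
  have db : ∀ m : ℕ, 1 ≤ m → DifferentiableOn ℂ hb (Metric.ball (m:ℂ) (m/8)) := by
    intro m hm x hx
    have := (hx0 m hm x hx).2.2
    have n1 : DifferentiableAt ℂ (fun x : ℂ => 2 * (g1 * x - 1/2 * x^2)) x := by fun_prop
    have n2 : DifferentiableAt ℂ (fun x : ℂ => x^r) x := by fun_prop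
    exact (n1.fun_div n2 (pow_ne_zero r this)).differentiableWithinAt
  have ba := LL_bound ha (2 * 2^r) (by positivity) da (fun m hm x hx => by
    refine conv m hm x hx 1 2 (by norm_num) ?_
    rw [norm_one]; exact (hpows _ (h78 m hm x hx)).1)
  have bb := LL_bound hb ((4 * ‖g1‖ + 2) * 2^r) (by positivity) db (fun m hm x hx => by
    refine conv m hm x hx _ (4 * ‖g1‖ + 2) (by positivity) ?_
    obtain ⟨_, p1, p2, _⟩ := hpows _ (h78 m hm x hx)
    have := norm_sub_le (g1 * x) (1/2 * x^2)
    rw [norm_mul, norm_mul, norm_pow] at this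
    rw [norm_mul]
    norm_num at this ⊢
    have := norm_nonneg g1
    nlinarith)
  have eta := eta_sum r (by omega)
  have hLa : LL (fun n : ℕ => ha (n+1)) = (1 - 2 * (1/2)^r) * riemannZeta r := by
    rw [← eta.2, LL_eq _ eta.1]
  refine ⟨LL (fun n : ℕ => hb (n+1)), (4 + 32 * 39^3 * ZZ) * ((4 * C0 + 2 + 4 * ‖g1‖) * 2^r), ?_, fun t ht him => ?_⟩
  · have : 0 ≤ ZZ := tsum_nonneg (fun n => by positivity)
    positivity
  have t0 : t ≠ 0 := fun h => by simp [h] at ht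
  obtain ⟨sG, eG⟩ := SS_eq_Gt r t ht
  rw [eG, LL_eq _ sG]
  set hc : ℂ → ℂ := fun x => Gt r t x - ha x - t * hb x with hhc
  have hre : ∀ (m : ℕ), 1 ≤ m → ∀ (x : ℂ), x ∈ Metric.ball (m:ℂ) (m/8) → 0 < (x*t).re ∧ x * t ≠ 0 := by
    intro m hm x hx
    obtain ⟨h1, _, _, _⟩ := cone_geom t x m (hm1 m hm) him (hmem m x hx)
    have hn : x * t ≠ 0 := mul_ne_zero (hx0 m hm x hx).2.2 t0
    have := norm_pos_iff.2 hn
    exact ⟨by linarith, hn⟩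
  have hden : ∀ (m : ℕ), 1 ≤ m → ∀ (x : ℂ), x ∈ Metric.ball (m:ℂ) (m/8) →
      (1 - Complex.exp (-(x*t))) ^ r * (1 + Complex.exp (-(x*t))) ≠ 0 := by
    intro m hm x hx
    have h := (hre m hm x hx).1
    have hq : ‖Complex.exp (-(x*t))‖ < 1 := by
      rw [Complex.norm_exp, Real.exp_lt_one_iff, Complex.neg_re]; linarith
    have n1 : 1 + Complex.exp (-(x*t)) ≠ 0 := by simpa only [zero_add, pow_one] using one_add_pow_ne _ hq 0
    have n2 : 1 - Complex.exp (-(x*t)) ≠ 0 := by simpa only [zero_add, pow_one] using one_sub_pow_ne _ hq 0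
    exact mul_ne_zero (pow_ne_zero _ n2) n1
  have dc : ∀ m : ℕ, 1 ≤ m → DifferentiableOn ℂ hc (Metric.ball (m:ℂ) (m/8)) := by
    intro m hm
    refine DifferentiableOn.sub (DifferentiableOn.sub ?_ (da m hm)) ((db m hm).const_mul t)
    intro x hx
    refine DifferentiableAt.differentiableWithinAt ?_
    unfold Gt
    have n1 : DifferentiableAt ℂ (fun x : ℂ => Complex.exp (-((r/2+1 : ℕ) : ℂ) * (x*t)) * Complex.exp (-(x^2*t))) x := by fun_prop
    have n2 : DifferentiableAt ℂ (fun x : ℂ => (1 - Complex.exp (-(x*t))) ^ r * (1 + Complex.exp (-(x*t)))) x := by fun_prop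
    exact (n1.fun_div n2 (hden m hm x hx)).const_mul (2 * t^r)
  have bc := LL_bound hc (((4 * C0 + 2 + 4 * ‖g1‖) * ‖t‖^2) * 2^r) (by positivity) dc (fun m hm x hx => by
    obtain ⟨g1', g2', _, _⟩ := cone_geom t x m (hm1 m hm) him (hmem m x hx)
    have hwn := (hre m hm x hx).2
    have hxn := (hx0 m hm x hx).2.2
    have e : hc x = (2 * ((gk r (x*t) - 1/2 - g1 * (x*t)) * Complex.exp (-(x^2*t)) + (1/2) * (Complex.exp (-(x^2*t)) - 1 + x^2*t) + g1 * (x*t) * (Complex.exp (-(x^2*t)) - 1))) / x^r := by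
      have hd := hden m hm x hx
      have eg : Gt r t x = 2 * gk r (x*t) * Complex.exp (-(x^2*t)) / x^r := by
        rw [Gt, gk_eq r _ hwn, mul_pow]
        field_simp
      rw [hhc, hha, hhb]
      simp only
      rw [eg]
      field_simp
      ring
    rw [e]
    refine conv m hm x hx _ _ (by positivity) ?_
    have k1 := hg (x*t) g1'
    have k2 := norm_exp_sub_one_le (x^2*t) g2'
    have k3 := norm_exp_sub_two_le (x^2*t) g2'
    have k4 : ‖Complex.exp (-(x^2*t))‖ ≤ 1 := by
      rw [Complex.norm_exp, Real.exp_le_one_iff, Complex.neg_re]; linarith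
    obtain ⟨_, p1, p2, p3⟩ := hpows _ (h78 m hm x hx)
    rw [norm_mul, norm_pow] at k2 k3
    rw [norm_mul] at k1
    set X := ‖x‖
    set Tn := ‖t‖
    have X0 : 0 ≤ X := norm_nonneg x
    have T0 : 0 ≤ Tn := norm_nonneg t
    have l1 : ‖(gk r (x*t) - 1/2 - g1 * (x*t)) * Complex.exp (-(x^2*t))‖ ≤ C0 * (X*Tn)^2 * 1 := by
      rw [norm_mul]; gcongr
    have l2 : ‖(1/2:ℂ) * (Complex.exp (-(x^2*t)) - 1 + x^2*t)‖ ≤ 1/2 * (X^2*Tn)^2 := by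
      rw [norm_mul]; norm_num; linarith
    have l3 : ‖g1 * (x*t) * (Complex.exp (-(x^2*t)) - 1)‖ ≤ ‖g1‖ * (X * Tn) * (X^2*Tn) := by
      rw [norm_mul, norm_mul, norm_mul]; gcongr
    have l4 : C0 * (X*Tn)^2 * 1 ≤ (C0 * Tn^2) * (2 * X^4) := by
      have : C0 * (X*Tn)^2 * 1 = (C0 * Tn^2) * X^2 := by ring
      rw [this]; gcongr
    have l5 : ‖g1‖ * (X * Tn) * (X^2*Tn) ≤ (‖g1‖ * Tn^2) * (2 * X^4) := by
      have : ‖g1‖ * (X * Tn) * (X^2*Tn) = (‖g1‖ * Tn^2) * X^3 := by ring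
      rw [this]; gcongr
    have l6 := norm_add₃_le (a := (gk r (x*t) - 1/2 - g1 * (x*t)) * Complex.exp (-(x^2*t))) (b := (1/2:ℂ) * (Complex.exp (-(x^2*t)) - 1 + x^2*t)) (c := g1 * (x*t) * (Complex.exp (-(x^2*t)) - 1))
    rw [norm_mul (2:ℂ)]
    have l7 : ‖(2:ℂ)‖ = 2 := by norm_num
    rw [l7]
    have l8 : 0 ≤ X^4 * Tn^2 := by positivity
    have l9 : 1/2 * (X^2*Tn)^2 = 1/2 * (X^4 * Tn^2) := by ring
    have l10 : (4 * C0 + 2 + 4 * ‖g1‖) * Tn^2 * X^4 = 2 * ((C0 * Tn^2) * (2 * X^4)) + 2 * (X^4 * Tn^2) + 2 * ((‖g1‖ * Tn^2) * (2 * X^4)) := by ring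
    rw [l10]
    linarith)
  have hlin := LL_lin (fun n : ℕ => ha (n+1)) (fun n : ℕ => hb (n+1)) (fun n : ℕ => hc (n+1)) (fun n : ℕ => Gt r t (n+1)) t
    (fun n => by simp only [hhc]; ring) ba.1 bb.1 bc.1
  rw [hlin, hLa]
  have e : (1 - 2 * (1/2)^r) * riemannZeta r + t * LL (fun n : ℕ => hb (n+1)) + LL (fun n : ℕ => hc (n+1)) - (1 - 2 * (1/2)^r) * riemannZeta r - LL (fun n : ℕ => hb (n+1)) * t = LL (fun n : ℕ => hc (n+1)) := by ring
  rw [e]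
  refine bc.2.trans (le_of_eq (by ring))

end EtaAux

namespace EtaAux

lemma gamma_int (s b : ℝ) (hs : 0 < s) (hb : 0 < b) :
    IntegrableOn (fun u : ℝ => u^(s-1) * Real.exp (-(b*u))) (Set.Ioi 0) := by
  have := integrableOn_rpow_mul_exp_neg_mul_rpow (p := 1) (s := s-1) (b := b) (by linarith) one_pos hb
  simpa using this

lemma gamma_cint (s : ℝ) (z : ℂ) (hs : 0 < s) (hz : 0 < z.re) :
    IntegrableOn (fun u : ℝ => ((u^(s-1) : ℝ) : ℂ) * Complex.exp (-(z*u))) (Set.Ioi 0) := by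
  refine Integrable.mono' (gamma_int s z.re hs hz) ?_ ?_
  · refine ContinuousOn.aestronglyMeasurable ?_ measurableSet_Ioi
    refine ContinuousOn.mul ?_ (by fun_prop)
    refine Complex.continuous_ofReal.comp_continuousOn ?_
    intro u hu
    exact (Real.continuousAt_rpow_const u (s-1) (Or.inl (ne_of_gt hu))).continuousWithinAt
  · refine (ae_restrict_mem measurableSet_Ioi).mono (fun u hu => ?_)
    have hu : 0 < u := hu
    rw [norm_mul, Complex.norm_exp, Complex.norm_real, Real.norm_of_nonneg (by positivity)]
    simp

lemma gamma_laplace (s : ℝ) (hs : 0 < s) (z : ℂ) (hz : 0 < z.re) :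
    ∫ u in Set.Ioi (0:ℝ), ((u^(s-1) : ℝ) : ℂ) * Complex.exp (-(z*u)) = z ^ (-(s:ℂ)) * Real.Gamma s := by
  set L : ℂ → ℂ := fun z => ∫ u in Set.Ioi (0:ℝ), ((u^(s-1) : ℝ) : ℂ) * Complex.exp (-(z*u)) with hL
  set U : Set ℂ := {z | 0 < z.re} with hU
  have hUo : IsOpen U := isOpen_lt continuous_const Complex.continuous_re
  have d1 : DifferentiableOn ℂ L U := by
    intro z0 hz0
    have hz0 : 0 < z0.re := hz0
    refine DifferentiableAt.differentiableWithinAt ?_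
    have := hasDerivAt_integral_of_dominated_loc_of_deriv_le (𝕜 := ℂ) (μ := volume.restrict (Set.Ioi (0:ℝ)))
      (F := fun z u => ((u^(s-1) : ℝ) : ℂ) * Complex.exp (-(z*u)))
      (F' := fun z u => ((u^(s-1) : ℝ) : ℂ) * (Complex.exp (-(z*u)) * (-u))) (x₀ := z0)
      (s := Metric.ball z0 (z0.re/2)) (bound := fun u => u^(s+1-1) * Real.exp (-(z0.re/2*u)))
      (Metric.ball_mem_nhds _ (by linarith)) ?_ (gamma_cint s z0 hs hz0) ?_ ?_ (gamma_int (s+1) _ (by linarith) (by linarith)) ?_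
    · exact this.2.differentiableAt
    · filter_upwards [hUo.mem_nhds (show z0 ∈ U from hz0)] with z hz
      exact (gamma_cint s z hs hz).aestronglyMeasurable
    · have := (gamma_cint s z0 hs hz0).aestronglyMeasurable
      have h2 : AEStronglyMeasurable (fun u : ℝ => -(u:ℂ)) (volume.restrict (Set.Ioi (0:ℝ))) :=
        Continuous.aestronglyMeasurable (by fun_prop)
      refine (this.mul h2).congr (Eventually.of_forall fun u => ?_)
      simp [mul_assoc]
    · refine (ae_restrict_mem measurableSet_Ioi).mono (fun u hu z hz => ?_)
      have hu : 0 < u := hu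
      rw [norm_mul, norm_mul, Complex.norm_exp, Complex.norm_real, Real.norm_of_nonneg (by positivity), norm_neg,
        Complex.norm_real, Real.norm_of_nonneg hu.le]
      have hre : z0.re/2 ≤ z.re := by
        have h1 : |(z - z0).re| ≤ ‖z - z0‖ := Complex.abs_re_le_norm _
        rw [Metric.mem_ball, dist_eq_norm] at hz
        rw [Complex.sub_re] at h1
        have := (abs_le.1 h1).1
        linarith
      have e : u^(s+1-1) = u^(s-1) * u := by
        rw [← Real.rpow_add_one hu.ne']; congr 1; ring
      rw [e, mul_assoc, mul_comm (Real.exp _) u]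
      gcongr
      simp
      gcongr
    · refine (ae_restrict_mem measurableSet_Ioi).mono (fun u hu z hz => ?_)
      refine HasDerivAt.const_mul _ ?_
      have : HasDerivAt (fun z : ℂ => -(z*u)) (-(u:ℂ)) z := by
        have h := ((hasDerivAt_id z).mul_const (u:ℂ)).fun_neg
        rw [one_mul] at h
        exact h
      exact this.cexp
  have d2 : DifferentiableOn ℂ (fun z : ℂ => z ^ (-(s:ℂ)) * Real.Gamma s) U := by
    intro z hz
    refine DifferentiableAt.differentiableWithinAt ?_
    exact (DifferentiableAt.cpow_const differentiableAt_id (Or.inl hz)).mul_const _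
  have hpre : IsPreconnected U := (convex_halfSpace_re_gt 0).isPreconnected
  have h1 : (1:ℂ) ∈ U := by simp [hU]
  have key := (d1.analyticOnNhd hUo).eqOn_of_preconnected_of_frequently_eq (d2.analyticOnNhd hUo) hpre h1 ?_
  · exact key hz
  · have hre : ∀ b : ℝ, 0 < b → L b = (b:ℂ) ^ (-(s:ℂ)) * Real.Gamma s := by
      intro b hb
      have := Real.integral_rpow_mul_exp_neg_mul_Ioi hs hb
      have e : L b = ((∫ u in Set.Ioi (0:ℝ), u^(s-1) * Real.exp (-(b*u)) : ℝ) : ℂ) := by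
        rw [← integral_complex_ofReal]
        simp only [hL]
        congr 1; ext u; push_cast; rfl
      rw [e, this]
      push_cast
      congr 1
      rw [Real.rpow_def_of_pos (by positivity), Complex.cpow_def_of_ne_zero (by exact_mod_cast hb.ne'), ← Complex.ofReal_log hb.le, one_div, Real.log_inv]
      push_cast
      congr 1; ring
    have hseq : Tendsto (fun n : ℕ => (((1:ℝ) + 1/((n:ℝ)+1) : ℝ) : ℂ)) atTop (nhdsWithin 1 {1}ᶜ) := by
      refine tendsto_nhdsWithin_iff.2 ⟨?_, Eventually.of_forall fun n => ?_⟩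
      · have := (tendsto_one_div_add_atTop_nhds_zero_nat (𝕜 := ℝ)).const_add 1
        rw [add_zero] at this
        exact (Complex.continuous_ofReal.tendsto 1).comp this
      · have : (0:ℝ) < 1/((n:ℝ)+1) := by positivity
        simp only [Set.mem_compl_iff, Set.mem_singleton_iff]
        intro h
        have : (1:ℝ) + 1/((n:ℝ)+1) = 1 := by exact_mod_cast h
        linarith
    refine hseq.frequently (Frequently.of_forall fun n => ?_)
    exact hre _ (by positivity)

lemma t_norm_le (s y x : ℝ) (hs : 3/2 ≤ s) (hy : 0 < y) (h1 : y ≤ 1) :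
    ‖((y:ℂ) + x * Complex.I) ^ (-(s:ℂ))‖ ≤ y ^ (-s) * (1 + ‖x‖^2) ^ (-(3/2:ℝ)/2) := by
  have hx : 0 ≤ x^2 := sq_nonneg x
  have e : ‖(y:ℂ) + x * Complex.I‖ = (y^2 + x^2)^(1/2:ℝ) := by
    rw [Complex.norm_add_mul_I, Real.sqrt_eq_rpow]
  have hneg : (-(s:ℂ)) = ((-s : ℝ) : ℂ) := by push_cast; rfl
  rw [hneg, Complex.norm_cpow_real, e, ← Real.rpow_mul (by positivity), Real.norm_eq_abs, sq_abs]
  calc (y^2 + x^2) ^ (1/2 * (-s)) ≤ (y^2 * (1 + x^2)) ^ (1/2 * (-s)) := by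
        refine Real.rpow_le_rpow_of_nonpos (by positivity) ?_ (by linarith)
        nlinarith [mul_nonneg hx (by nlinarith : 0 ≤ 1 - y^2)]
    _ = y^(-s) * (1+x^2)^(1/2 * (-s)) := by
        rw [Real.mul_rpow (by positivity) (by positivity)]
        congr 1
        rw [← Real.rpow_natCast, ← Real.rpow_mul hy.le]
        congr 1; push_cast; ring
    _ ≤ _ := by
        gcongr ?_ * ?_
        refine Real.rpow_le_rpow_of_exponent_le (by linarith) (by linarith)

lemma jap_int : Integrable (fun x : ℝ => (1 + ‖x‖^2) ^ (-(3/2:ℝ)/2)) :=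
  integrable_rpow_neg_one_add_norm_sq (by simp; norm_num)

lemma t_cpow_cont (y : ℝ) (hy : 0 < y) (c : ℂ) : Continuous (fun x : ℝ => ((y:ℂ) + x * Complex.I) ^ c) := by
  refine Continuous.cpow (by fun_prop) continuous_const (fun x => Or.inl ?_)
  simpa using hy

lemma t_int (s y : ℝ) (hs : 3/2 ≤ s) (hy : 0 < y) (h1 : y ≤ 1) :
    Integrable (fun x : ℝ => ((y:ℂ) + x * Complex.I) ^ (-(s:ℂ))) := by
  refine (jap_int.const_mul (y^(-s))).mono' (t_cpow_cont y hy _).aestronglyMeasurable ?_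
  exact Eventually.of_forall (fun x => t_norm_le s y x hs hy h1)

open FourierTransform in
lemma inv1 (s y n : ℝ) (hs : 3/2 ≤ s) (hy : 0 < y) (h1 : y ≤ 1) (hn : 0 < n) :
    ∫ x : ℝ, ((y:ℂ) + x * Complex.I) ^ (-(s:ℂ)) * Complex.exp (n * ((y:ℂ) + x * Complex.I)) =
      2 * Real.pi * (n^(s-1) / Real.Gamma s : ℝ) := by
  set f : ℝ → ℂ := fun u => (((max u 0)^(s-1) * Real.exp (-(y*u)) : ℝ) : ℂ) with hf
  have fc : Continuous f := by
    refine Complex.continuous_ofReal.comp ?_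
    refine Continuous.mul ?_ (by fun_prop)
    exact (by fun_prop : Continuous (fun u : ℝ => max u 0)).rpow_const (fun u => Or.inr (by linarith))
  have f0 : ∀ u, u ∉ Set.Ioi (0:ℝ) → f u = 0 := by
    intro u hu
    have hu : u ≤ 0 := by simpa using hu
    simp only [hf]
    rw [max_eq_right hu, Real.zero_rpow (by linarith)]; simp
  have f1 : ∀ u, u ∈ Set.Ioi (0:ℝ) → f u = ((u^(s-1) : ℝ) : ℂ) * Complex.exp (-((y:ℂ)*u)) := by
    intro u hu
    have hu : 0 < u := hu
    simp only [hf]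
    rw [max_eq_left hu.le]; push_cast; rfl
  have fi : Integrable f := by
    have : IntegrableOn f (Set.Ioi 0) := (gamma_cint s y (by linarith) (by simpa using hy)).congr_fun (fun u hu => (f1 u hu).symm) measurableSet_Ioi
    rwa [integrableOn_iff_integrable_of_support_subset] at this
    intro u hu
    by_contra h
    exact hu (f0 u h)
  have ft : 𝓕 f = fun w : ℝ => ((y:ℂ) + (2 * Real.pi * w : ℝ) * Complex.I) ^ (-(s:ℂ)) * Real.Gamma s := by
    ext w
    rw [Real.fourier_real_eq_integral_exp_smul, ← gamma_laplace s (by linarith) _ (by simpa using hy)]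
    rw [← setIntegral_eq_integral_of_forall_compl_eq_zero (s := Set.Ioi (0:ℝ))]
    · refine setIntegral_congr_fun measurableSet_Ioi (fun u hu => ?_)
      rw [f1 u hu, smul_eq_mul, mul_left_comm, ← Complex.exp_add]
      congr 2; push_cast; ring
    · intro u hu; rw [f0 u hu, smul_zero]
  have ti := t_int s y hs hy h1
  have fti : Integrable (𝓕 f) := by
    rw [ft]
    exact (ti.comp_mul_left' (R := 2 * Real.pi) (by positivity)).mul_const _
  have inv := congrFun (fc.fourierInv_fourier_eq fi fti) n
  rw [Real.fourierInv_eq', ft] at inv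
  have cv := Measure.integral_comp_mul_left (fun x : ℝ => ((y:ℂ) + x * Complex.I) ^ (-(s:ℂ)) * Complex.exp (n * ((y:ℂ) + x * Complex.I))) (2 * Real.pi)
  have hG : (Real.Gamma s : ℂ) ≠ 0 := by exact_mod_cast (Real.Gamma_pos_of_pos (by linarith)).ne'
  have e1 : (∫ w : ℝ, ((y:ℂ) + (2 * Real.pi * w : ℝ) * Complex.I) ^ (-(s:ℂ)) * Complex.exp (n * ((y:ℂ) + (2 * Real.pi * w : ℝ) * Complex.I))) = Complex.exp (n*y) / Real.Gamma s * f n := by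
    rw [← inv, ← integral_const_mul]
    congr 1; ext w
    rw [smul_eq_mul, mul_add, Complex.exp_add]
    have : ((2 * Real.pi * inner ℝ w n : ℝ) : ℂ) * Complex.I = n * ((2 * Real.pi * w : ℝ) * Complex.I) := by
      simp; ring
    rw [this]
    field_simp
  rw [e1, f1 n hn] at cv
  have hpi : (0:ℝ) < 2 * Real.pi := by positivity
  rw [abs_of_pos (by positivity), Complex.real_smul] at cv
  have : ((2*Real.pi : ℝ):ℂ) ≠ 0 := by exact_mod_cast hpi.ne'
  have h3 : Complex.exp (n*y) * Complex.exp (-((y:ℂ)*n)) = 1 := by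
    rw [← Complex.exp_add]; rw [show (n:ℂ)*y + -((y:ℂ)*n) = 0 by ring, Complex.exp_zero]
  calc _ = ((2*Real.pi : ℝ):ℂ) * ((((2*Real.pi)⁻¹ : ℝ) : ℂ) * ∫ x : ℝ, ((y:ℂ) + x * Complex.I) ^ (-(s:ℂ)) * Complex.exp (n * ((y:ℂ) + x * Complex.I))) := by
        rw [Complex.ofReal_inv, ← mul_assoc, mul_inv_cancel₀ this, one_mul]
    _ = ((2*Real.pi : ℝ):ℂ) * (Complex.exp (n*y) * Complex.exp (-((y:ℂ)*n)) * ((n^(s-1) : ℝ) : ℂ) / Real.Gamma s) := by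
        rw [← cv]; ring
    _ = _ := by rw [h3]; push_cast; ring

end EtaAux

namespace EtaAux

lemma te_int (s y n : ℝ) (hs : 3/2 ≤ s) (hy : 0 < y) (h1 : y ≤ 1) :
    Integrable (fun x : ℝ => ((y:ℂ) + x * Complex.I) ^ (-(s:ℂ)) * Complex.exp (n * ((y:ℂ) + x * Complex.I))) := by
  refine (t_int s y hs hy h1).mul_bdd (c := Real.exp (n*y)) (Continuous.aestronglyMeasurable (by fun_prop)) ?_
  refine Eventually.of_forall (fun x => ?_)
  rw [Complex.norm_exp]
  simp

lemma norm_exp_nt (n y x : ℝ) : ‖Complex.exp (n * ((y:ℂ) + x * Complex.I))‖ = Real.exp (n*y) := by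
  rw [Complex.norm_exp]; simp

lemma inv2 (s y n a : ℝ) (hs : 3/2 ≤ s) (hy : 0 < y) (h1 : y ≤ 1) (hn : 0 < n) (ha : 0 < a) :
    HasSum (fun k : ℕ => ((a^k / k.factorial : ℝ) : ℂ) * (2 * Real.pi * (n^(k+s-1) / Real.Gamma (k+s) : ℝ)))
    (∫ x : ℝ, ((y:ℂ) + x * Complex.I) ^ (-(s:ℂ)) * Complex.exp (a / ((y:ℂ) + x * Complex.I)) * Complex.exp (n * ((y:ℂ) + x * Complex.I))) := by
  set F : ℕ → ℝ → ℂ := fun k x => ((a^k / k.factorial : ℝ) : ℂ) * (((y:ℂ) + x * Complex.I) ^ (-((k + s : ℝ) :ℂ)) * Complex.exp (n * ((y:ℂ) + x * Complex.I))) with hF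
  have hks : ∀ k : ℕ, 3/2 ≤ (k + s : ℝ) := fun k => by have : (0:ℝ) ≤ k := Nat.cast_nonneg k; linarith
  have Fi : ∀ k, Integrable (F k) := fun k => (te_int (k+s) y n (hks k) hy h1).const_mul _
  set K := ∫ x : ℝ, (1 + ‖x‖^2) ^ (-(3/2:ℝ)/2) with hK
  have Fb : ∀ k, ∫ x, ‖F k x‖ ≤ (y^(-s) * Real.exp (n*y) * K) * ((a/y)^k / k.factorial) := by
    intro k
    calc ∫ x, ‖F k x‖ ≤ ∫ x : ℝ, (y^(-s) * Real.exp (n*y) * ((a/y)^k / k.factorial)) * (1 + ‖x‖^2) ^ (-(3/2:ℝ)/2) := by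
          refine integral_mono (Fi k).norm (jap_int.const_mul _) (fun x => ?_)
          simp only [hF]
          rw [norm_mul, norm_mul, norm_exp_nt, Complex.norm_real, Real.norm_of_nonneg (by positivity)]
          have := t_norm_le (k+s) y x (hks k) hy h1
          have e : y^(-(k+s)) = (y^k)⁻¹ * y^(-s) := by
            rw [neg_add, Real.rpow_add hy, Real.rpow_neg hy.le, Real.rpow_natCast]
          rw [e] at this
          calc _ ≤ (a^k / k.factorial) * (((y^k)⁻¹ * y^(-s) * (1 + ‖x‖^2) ^ (-(3/2:ℝ)/2)) * Real.exp (n*y)) := by gcongr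
            _ = _ := by rw [div_pow]; ring
      _ = _ := by rw [integral_const_mul]; ring
  have Fs : Summable (fun k => ∫ x, ‖F k x‖) := by
    refine Summable.of_nonneg_of_le (fun k => integral_nonneg (fun x => norm_nonneg _)) Fb ?_
    exact (Real.summable_pow_div_factorial (a/y)).mul_left _
  have key := hasSum_integral_of_summable_integral_norm Fi Fs
  have e1 : ∀ k, ∫ x, F k x = ((a^k / k.factorial : ℝ) : ℂ) * (2 * Real.pi * (n^(k+s-1) / Real.Gamma (k+s) : ℝ)) := by
    intro k
    simp only [hF]
    rw [integral_const_mul, inv1 (k+s) y n (hks k) hy h1 hn]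
  have e2 : ∀ x : ℝ, ∑' k, F k x = ((y:ℂ) + x * Complex.I) ^ (-(s:ℂ)) * Complex.exp (a / ((y:ℂ) + x * Complex.I)) * Complex.exp (n * ((y:ℂ) + x * Complex.I)) := by
    intro x
    set t := (y:ℂ) + x * Complex.I with ht
    have t0 : t ≠ 0 := by
      intro h
      have : t.re = 0 := by rw [h]; simp
      simp [ht] at this; linarith
    have h := (NormedSpace.expSeries_div_hasSum_exp ((a:ℂ)/t))
    rw [← Complex.exp_eq_exp_ℂ] at h
    have h2 := (h.mul_left (t ^ (-(s:ℂ)))).mul_right (Complex.exp (n*t))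
    refine HasSum.tsum_eq (h2.congr_fun (fun k => ?_))
    simp only [hF]
    have : t ^ (-((k+s:ℝ):ℂ)) = (t^k)⁻¹ * t ^ (-(s:ℂ)) := by
      push_cast
      rw [neg_add, Complex.cpow_add _ _ t0, Complex.cpow_neg, Complex.cpow_natCast]
    rw [this, div_pow]; push_cast; ring
  simp only [e1, e2] at key
  exact key

lemma inv3 (s y n : ℝ) (hs : 3/2 ≤ s) (hy : 0 < y) (h1 : y ≤ 1) (hn : 0 < n) :
    (∫ x : ℝ, ((y:ℂ) + x * Complex.I) ^ (-(s:ℂ)) * Complex.exp ((Real.pi^2/4 : ℝ) / ((y:ℂ) + x * Complex.I)) * Complex.exp (n * ((y:ℂ) + x * Complex.I)))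
     = ((2 * Real.pi * (2 * Real.sqrt n / Real.pi)^(s-1) * besselI (s-1) (Real.pi * Real.sqrt n) : ℝ) : ℂ) := by
  have h := (inv2 s y n (Real.pi^2/4) hs hy h1 hn (by positivity)).tsum_eq
  rw [← h, besselI, ← tsum_mul_left, Complex.ofReal_tsum]
  congr 1; ext k
  rw [← Complex.ofReal_ofNat, ← Complex.ofReal_mul, ← Complex.ofReal_mul, ← Complex.ofReal_mul]
  congr 1
  have hp := Real.pi_pos
  have hq : 0 < Real.sqrt n := Real.sqrt_pos.2 hn
  have hsq : Real.sqrt n ^ 2 = n := Real.sq_sqrt hn.le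
  have e1 : n^(k+s-1) = n^k * ((2 * Real.sqrt n / Real.pi)^(s-1) * (Real.pi * Real.sqrt n / 2)^(s-1)) := by
    rw [← Real.mul_rpow (by positivity) (by positivity)]
    have : 2 * Real.sqrt n / Real.pi * (Real.pi * Real.sqrt n / 2) = n := by
      field_simp; exact hsq
    rw [this, add_sub_assoc, Real.rpow_add hn, Real.rpow_natCast]
  have e2 : (Real.pi * Real.sqrt n / 2)^(2*(k:ℝ)+(s-1)) = (Real.pi^2/4)^k * n^k * (Real.pi * Real.sqrt n / 2)^(s-1) := by
    rw [Real.rpow_add (by positivity), Real.rpow_mul (by positivity), Real.rpow_natCast, ← mul_pow]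
    congr 2
    rw [← hsq]
    norm_num
    rw [hsq]
    ring_nf; rw [hsq]
  rw [e1, e2, show (k:ℝ) + (s-1) + 1 = k + s by ring]
  field_simp
end EtaAux

namespace EtaAux

lemma orth (k : ℤ) : ∫ x in Set.Ioc (-Real.pi) Real.pi, Complex.exp (((k:ℂ) * Complex.I) * x) = if k = 0 then 2 * (Real.pi : ℂ) else 0 := by
  rw [← intervalIntegral.integral_of_le (by linarith [Real.pi_pos])]
  split_ifs with h
  · subst h
    simp; ring
  · have hk : (k:ℂ) * Complex.I ≠ 0 := mul_ne_zero (by exact_mod_cast h) Complex.I_ne_zero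
    rw [integral_exp_mul_complex hk]
    have : Complex.exp ((k:ℂ) * Complex.I * (Real.pi:ℂ)) = Complex.exp ((k:ℂ) * Complex.I * ((-Real.pi : ℝ):ℂ)) := by
      rw [Complex.exp_eq_exp_iff_exists_int]
      refine ⟨k, ?_⟩
      push_cast; ring
    rw [this, sub_self, zero_div]

/-- The integrand. -/
noncomputable def GG (r N : ℕ) (y x : ℝ) : ℂ :=
  2 * PP (Complex.exp (-((y:ℂ) + x * Complex.I))) * SS r (Complex.exp (-((y:ℂ) + x * Complex.I))) * Complex.exp (N * ((y:ℂ) + x * Complex.I))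

lemma coef (r N : ℕ) (hr : 1 ≤ r) (y : ℝ) (hy : 0 < y) :
    Continuous (GG r N y) ∧ ∫ x in Set.Ioc (-Real.pi) Real.pi, GG r N y x = 2 * Real.pi * (etabar r N : ℂ) := by
  set f : ℕ → ℝ → ℂ := fun n x => (etabar r n : ℂ) * Complex.exp (-((y:ℂ) + x * Complex.I)) ^ n * Complex.exp (N * ((y:ℂ) + x * Complex.I)) with hf
  have hq : ∀ x : ℝ, ‖Complex.exp (-((y:ℂ) + x * Complex.I))‖ = Real.exp (-y) := by
    intro x; rw [Complex.norm_exp]; simp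
  have hlt : Real.exp (-y) < 1 := by rw [Real.exp_lt_one_iff]; linarith
  have hs : ∀ x, HasSum (fun n => f n x) (GG r N y x) := fun x =>
    (etabar_hasSum r hr _ (by rw [hq]; exact hlt)).mul_right _
  set b : ℕ → ℝ := fun n => ‖(etabar r n : ℂ)‖ * Real.exp (-y)^n * Real.exp (N*y) with hb
  have hbs : Summable b := by
    have := (hs 0).summable.norm
    refine this.congr (fun n => ?_)
    simp only [hf, hb]
    rw [norm_mul, norm_mul, norm_pow, hq]
    congr 1
    have := norm_exp_nt N y 0
    rw [← this]; push_cast; rfl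
  have hfb : ∀ n x, ‖f n x‖ = b n := by
    intro n x
    simp only [hf, hb]
    rw [norm_mul, norm_mul, norm_pow, hq]
    congr 1
    have := norm_exp_nt N y x
    rw [← this]; push_cast; rfl
  have hfc : ∀ n, Continuous (f n) := fun n => by simp only [hf]; fun_prop
  have eG : GG r N y = fun x => ∑' n, f n x := by ext x; exact (hs x).tsum_eq.symm
  have hc : Continuous (GG r N y) := by
    rw [eG]
    exact continuous_tsum hfc hbs (fun n x => (hfb n x).le)
  refine ⟨hc, ?_⟩
  have key := hasSum_integral_of_summable_integral_norm (μ := volume.restrict (Set.Ioc (-Real.pi) Real.pi)) (F := f)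
    (fun n => ((hfc n).integrableOn_Icc (a := -Real.pi) (b := Real.pi)).mono_set Set.Ioc_subset_Icc_self) (by
      simp only [hfb, integral_const, smul_eq_mul]
      exact hbs.mul_left _)
  have e1 : ∀ n, ∫ x in Set.Ioc (-Real.pi) Real.pi, f n x = if n = N then 2 * Real.pi * (etabar r N : ℂ) else 0 := by
    intro n
    have : ∀ x, f n x = ((etabar r n : ℂ) * Complex.exp (((N:ℂ) - n) * y)) * Complex.exp (((((N:ℤ) - n : ℤ):ℂ) * Complex.I) * x) := by
      intro x
      simp only [hf]
      rw [← Complex.exp_nat_mul, mul_assoc, mul_assoc, ← Complex.exp_add, ← Complex.exp_add]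
      congr 2; push_cast; ring
    simp only [this]
    rw [integral_const_mul, orth]
    by_cases h : n = N
    · subst h; simp; ring
    · have : ¬ ((N:ℤ) - n = 0) := by omega
      simp [h, this]
  simp only [e1] at key
  rw [← eG] at key
  rw [← key.tsum_eq, tsum_ite_eq]
end EtaAux

namespace EtaAux

lemma sqrt_div_pi_eq (t : ℂ) (ht : t ≠ 0) :
    (t / Real.pi) ^ (1/2:ℂ) = ((Real.pi ^ (-(1/2):ℝ) : ℝ) : ℂ) * t ^ (1/2:ℂ) := by
  have hp := Real.pi_pos
  have hp0 : (Real.pi : ℂ) ≠ 0 := by exact_mod_cast hp.ne'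
  have e : t / Real.pi = ((Real.pi⁻¹ : ℝ) : ℂ) * t := by push_cast; field_simp
  have hne : ((Real.pi⁻¹ : ℝ) : ℂ) * t ≠ 0 := mul_ne_zero (by exact_mod_cast (inv_pos.2 hp).ne') ht
  rw [e, Complex.cpow_def_of_ne_zero hne, Complex.log_ofReal_mul (inv_pos.2 hp) ht, add_mul, Complex.exp_add,
    Complex.cpow_def_of_ne_zero ht, Real.rpow_def_of_pos hp, Real.log_inv]
  congr 1
  push_cast
  congr 1; ring

/-- The main term. -/
noncomputable def MM (c0 c1 : ℂ) (r : ℕ) (t : ℂ) : ℂ :=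
  ((1/2 * Real.pi ^ (-(1/2):ℝ) : ℝ) : ℂ) * (c0 * (t ^ (-(((r:ℝ) - 1/2 : ℝ) : ℂ)) * Complex.exp ((Real.pi^2/4 : ℝ) / t)) + c1 * (t ^ (-(((r:ℝ) - 3/2 : ℝ) : ℂ)) * Complex.exp ((Real.pi^2/4 : ℝ) / t)))

lemma MM_eq (c0 c1 : ℂ) (r : ℕ) (t : ℂ) (ht : t ≠ 0) :
    t^r * MM c0 c1 r t = (1/2) * (t / Real.pi) ^ (1/2:ℂ) * Complex.exp ((Real.pi^2/4 : ℝ) / t) * (c0 + c1 * t) := by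
  have e0 : t^r * t ^ (-(((r:ℝ) - 1/2 : ℝ) : ℂ)) = t ^ (1/2:ℂ) := by
    rw [← Complex.cpow_natCast, ← Complex.cpow_add _ _ ht]
    congr 1; push_cast; ring
  have e1 : t^r * t ^ (-(((r:ℝ) - 3/2 : ℝ) : ℂ)) = t ^ (1/2:ℂ) * t := by
    have : t ^ (1/2:ℂ) * t = t ^ (1/2:ℂ) * t^(1:ℂ) := by rw [Complex.cpow_one]
    rw [this, ← Complex.cpow_natCast, ← Complex.cpow_add _ _ ht, ← Complex.cpow_add _ _ ht]
    congr 1; push_cast; ring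
  rw [sqrt_div_pi_eq t ht, MM]
  calc _ = ((1/2 * Real.pi ^ (-(1/2):ℝ) : ℝ) : ℂ) * (c0 * ((t^r * t ^ (-(((r:ℝ) - 1/2 : ℝ) : ℂ))) * Complex.exp ((Real.pi^2/4 : ℝ) / t)) + c1 * ((t^r * t ^ (-(((r:ℝ) - 3/2 : ℝ) : ℂ))) * Complex.exp ((Real.pi^2/4 : ℝ) / t))) := by ring
    _ = _ := by rw [e0, e1]; push_cast; ring

lemma exp_at_bound (a y x : ℝ) (ha : 0 ≤ a) (hy : 0 < y) : ‖Complex.exp (a / ((y:ℂ) + x * Complex.I))‖ ≤ Real.exp (a/y) := by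
  have := norm_exp_div_le a ha ((y:ℂ) + x * Complex.I) (by simpa using hy)
  simpa using this

lemma exp_at_bound2 (a y x : ℝ) (ha : 0 ≤ a) (hy : 0 < y) (hx : y ≤ |x|) : ‖Complex.exp (a / ((y:ℂ) + x * Complex.I))‖ ≤ Real.exp (a/(2*y)) := by
  rw [Complex.norm_exp, Real.exp_le_exp, Complex.div_re]
  have hn : Complex.normSq ((y:ℂ) + x * Complex.I) = y^2 + x^2 := Complex.normSq_add_mul_I y x
  rw [hn]
  simp
  have hx2 : y^2 ≤ x^2 := by rw [← sq_abs x]; gcongr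
  rw [div_le_div_iff₀ (by positivity) (by positivity)]
  have : 0 ≤ a * (x^2 - y^2) := mul_nonneg ha (by linarith)
  nlinarith

lemma exp_small (y : ℝ) (hy : 0 < y) : Real.exp (-(1/(4*y))) ≤ 720 * 4^6 * y^6 := by
  have h := Real.pow_div_factorial_le_exp (1/(4*y)) (by positivity) 6
  rw [Real.exp_neg]
  have hf : ((Nat.factorial 6 : ℕ) : ℝ) = 720 := by norm_num [Nat.factorial]
  rw [hf] at h
  calc (Real.exp (1/(4*y)))⁻¹ ≤ ((1/(4*y))^6/720)⁻¹ := inv_anti₀ (by positivity) h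
    _ = _ := by field_simp

/-- major arc -/
lemma major (r : ℕ) (c0 c1 : ℂ) (C : ℝ) (hC : 0 ≤ C)
    (hS : ∀ t : ℂ, 0 < t.re → |t.im| ≤ t.re → ‖2 * t^r * SS r (Complex.exp (-t)) - c0 - c1 * t‖ ≤ C * ‖t‖^2)
    (N : ℕ) (x y : ℝ) (hy : 0 < y) (h1 : y ≤ 1) (hx : |x| ≤ y) :
    ‖GG r N y x - MM c0 c1 r ((y:ℂ) + x * Complex.I) * Complex.exp (N * ((y:ℂ) + x * Complex.I))‖ ≤
      (8 * (2 * (‖c0‖ + 2 * ‖c1‖ + 4 * C) + C)) * y ^ (5/2 - (r:ℝ)) * (Real.exp (Real.pi^2/4/y) * Real.exp (N*y)) := by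
  set t := (y:ℂ) + x * Complex.I with ht
  have tre : t.re = y := by simp [ht]
  have tim : t.im = x := by simp [ht]
  have t0 : t ≠ 0 := fun h => by rw [h] at tre; simp at tre; linarith
  have tn1 : y ≤ ‖t‖ := by
    have := Complex.abs_re_le_norm t
    rw [tre, abs_of_pos hy] at this; exact this
  have tn2 : ‖t‖ ≤ 2*y := by
    have := Complex.norm_le_abs_re_add_abs_im t
    rw [tre, tim, abs_of_pos hy] at this; linarith
  have hP := PP_major t (by rw [tre]; exact hy) (by rw [tre, tim]; exact hx) (by rw [tre]; exact h1)
  have hQ := hS t (by rw [tre]; exact hy) (by rw [tre, tim]; exact hx)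
  set P0 := (t / Real.pi) ^ (1/2:ℂ) * Complex.exp ((Real.pi^2/4 : ℝ) / t) with hP0
  have hP0n : ‖P0‖ ≤ (2*y)^(1/2:ℝ) * Real.exp (Real.pi^2/4/y) := by
    rw [hP0, norm_mul, norm_sqrt_div_pi]
    gcongr
    · calc ‖t‖/Real.pi ≤ ‖t‖ / 1 := by gcongr; linarith [Real.pi_gt_three]
        _ ≤ 2*y := by linarith
    · exact exp_at_bound _ y x (by positivity) hy
  set S := 2 * t^r * SS r (Complex.exp (-t)) with hSd
  have hid : t^r * (2 * PP (Complex.exp (-t)) * SS r (Complex.exp (-t)) - MM c0 c1 r t) =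
      (PP (Complex.exp (-t)) - (1/2) * (t / Real.pi) ^ (1/2:ℂ) * Complex.exp ((Real.pi^2/4 : ℝ) / t)) * S + (1/2) * P0 * (S - c0 - c1 * t) := by
    rw [mul_sub, MM_eq _ _ _ _ t0, hSd, hP0]; ring
  have hSn : ‖S‖ ≤ ‖c0‖ + 2 * ‖c1‖ + 4 * C := by
    have e : S = (S - c0 - c1*t) + (c0 + c1 * t) := by ring
    have a1 := norm_add_le (S - c0 - c1*t) (c0 + c1*t)
    have a2 := norm_add_le c0 (c1*t)
    rw [← e] at a1
    rw [norm_mul] at a2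
    have a3 : ‖c1‖ * ‖t‖ ≤ ‖c1‖ * 2 := by gcongr; linarith
    have a4 : C * ‖t‖^2 ≤ C * 2^2 := by gcongr; linarith
    linarith
  set Cb := 2 * (‖c0‖ + 2 * ‖c1‖ + 4 * C) + C with hCb
  have hCb0 : 0 ≤ Cb := by positivity
  have hmain : ‖t^r * (2 * PP (Complex.exp (-t)) * SS r (Complex.exp (-t)) - MM c0 c1 r t)‖ ≤ Cb * (‖t‖^2 * ‖P0‖) := by
    rw [hid]
    refine (norm_add_le _ _).trans ?_
    rw [norm_mul, norm_mul (1/2 * P0), norm_mul (1/2:ℂ)]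
    have b1 : ‖PP (Complex.exp (-t)) - (1/2) * (t / Real.pi) ^ (1/2:ℂ) * Complex.exp ((Real.pi^2/4 : ℝ) / t)‖ * ‖S‖ ≤ (2 * ‖t‖^2 * ‖P0‖) * (‖c0‖ + 2 * ‖c1‖ + 4 * C) := by
      gcongr
    have b2 : ‖(1/2:ℂ)‖ * ‖P0‖ * ‖S - c0 - c1 * t‖ ≤ 1 * ‖P0‖ * (C * ‖t‖^2) := by
      gcongr
      norm_num
    rw [hCb]; nlinarith
  have hdiff : ‖2 * PP (Complex.exp (-t)) * SS r (Complex.exp (-t)) - MM c0 c1 r t‖ ≤ (8*Cb) * y ^ (5/2 - (r:ℝ)) * Real.exp (Real.pi^2/4/y) := by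
    rw [norm_mul, norm_pow] at hmain
    have c1' : y^r * ‖2 * PP (Complex.exp (-t)) * SS r (Complex.exp (-t)) - MM c0 c1 r t‖ ≤ Cb * ((2*y)^2 * ((2*y)^(1/2:ℝ) * Real.exp (Real.pi^2/4/y))) := by
      calc _ ≤ ‖t‖^r * ‖2 * PP (Complex.exp (-t)) * SS r (Complex.exp (-t)) - MM c0 c1 r t‖ := by gcongr
        _ ≤ _ := hmain
        _ ≤ _ := by gcongr
    have h2 : (2*y)^(1/2:ℝ) ≤ 2 * y^(1/2:ℝ) := by
      rw [Real.mul_rpow (by norm_num) hy.le]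
      gcongr
      calc (2:ℝ)^(1/2:ℝ) ≤ 2^(1:ℝ) := Real.rpow_le_rpow_of_exponent_le (by norm_num) (by norm_num)
        _ = 2 := by norm_num
    have h3 : y ^ (5/2 - (r:ℝ)) = y^2 * y^(1/2:ℝ) / y^r := by
      rw [Real.rpow_sub hy, Real.rpow_natCast]
      congr 1
      rw [← Real.rpow_natCast, ← Real.rpow_add hy]; norm_num
    rw [h3]
    have hyr : 0 < y^r := by positivity
    rw [← mul_le_mul_iff_right₀ hyr]
    refine c1'.trans ?_
    calc Cb * ((2*y)^2 * ((2*y)^(1/2:ℝ) * Real.exp (Real.pi^2/4/y))) ≤ Cb * ((2*y)^2 * ((2 * y^(1/2:ℝ)) * Real.exp (Real.pi^2/4/y))) := by gcongr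
      _ = _ := by field_simp; ring
  rw [GG, ← ht, ← sub_mul, norm_mul]
  have hN := norm_exp_nt N y x
  rw [← ht] at hN
  push_cast at hN
  rw [hN, ← mul_assoc]
  gcongr
end EtaAux

namespace EtaAux

lemma rpow_conv (r : ℕ) (y A : ℝ) (hy : 0 < y) (h1 : y ≤ 1) (hA : 7/2 - (r:ℝ) ≤ A) : y ^ A ≤ y ^ (7/2 - (r:ℝ)) :=
  Real.rpow_le_rpow_of_exponent_ge hy h1 hA

lemma minor (r : ℕ) (N : ℕ) (x y : ℝ) (hy : 0 < y) (h1 : y ≤ 1) (hx : y ≤ |x|) (hx2 : |x| ≤ Real.pi) :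
    ‖GG r N y x‖ ≤ (6 * Real.exp 2 * 2^(r+2) * (720 * 4^6)) * y ^ (7/2 - (r:ℝ)) * (Real.exp (Real.pi^2/4/y) * Real.exp (N*y)) := by
  have hP := PP_minor x y hy h1 hx hx2
  have hS := SS_crude' r x y hy h1
  have hN := norm_exp_nt N y x
  push_cast at hN
  rw [GG, norm_mul, norm_mul, norm_mul, hN]
  have e : Real.exp ((Real.pi^2/4 - 1/4)/y) ≤ Real.exp (Real.pi^2/4/y) * (720 * 4^6 * y^6) := by
    rw [show (Real.pi^2/4 - 1/4)/y = Real.pi^2/4/y + -(1/(4*y)) by field_simp; ring, Real.exp_add]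
    gcongr
    exact exp_small y hy
  have e2 : (2/y)^(r+2) * y^6 ≤ 2^(r+2) * y ^ (7/2 - (r:ℝ)) := by
    have : (2/y)^(r+2) * y^6 = 2^(r+2) * y^(4 - (r:ℝ)) := by
      rw [Real.rpow_sub hy, Real.rpow_natCast, show (4:ℝ) = ((4:ℕ):ℝ) by norm_num, Real.rpow_natCast, div_pow]
      field_simp
      ring
    rw [this]
    exact mul_le_mul_of_nonneg_left (rpow_conv r y _ hy h1 (by linarith)) (by positivity)
  calc ‖(2:ℂ)‖ * ‖PP (Complex.exp (-((y:ℂ) + x * Complex.I)))‖ * ‖SS r (Complex.exp (-((y:ℂ) + x * Complex.I)))‖ * Real.exp (N*y)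
      ≤ 2 * (3 * Real.exp 2 * (Real.exp (Real.pi^2/4/y) * (720 * 4^6 * y^6))) * (2/y)^(r+2) * Real.exp (N*y) := by
        have := hP.trans (mul_le_mul_of_nonneg_left e (by positivity))
        have h2 : ‖(2:ℂ)‖ = 2 := by norm_num
        rw [h2]
        gcongr
    _ = (6 * Real.exp 2 * (720 * 4^6)) * (Real.exp (Real.pi^2/4/y) * Real.exp (N*y)) * ((2/y)^(r+2) * y^6) := by ring
    _ ≤ (6 * Real.exp 2 * (720 * 4^6)) * (Real.exp (Real.pi^2/4/y) * Real.exp (N*y)) * (2^(r+2) * y ^ (7/2 - (r:ℝ))) := by gcongr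
    _ = _ := by ring

lemma tail1 (r : ℕ) (N : ℕ) (s x y : ℝ) (hs : 3/2 ≤ s) (hsr : s ≤ r) (hy : 0 < y) (h1 : y ≤ 1) (hx : y ≤ |x|) :
    ‖((y:ℂ) + x * Complex.I) ^ (-(s:ℂ)) * Complex.exp ((Real.pi^2/4 : ℝ) / ((y:ℂ) + x * Complex.I))‖ ≤
      (720 * 4^6) * y ^ (7/2 - (r:ℝ)) * Real.exp (Real.pi^2/4/y) * (1 + ‖x‖^2) ^ (-(3/2:ℝ)/2) := by
  rw [norm_mul]
  have h2 := t_norm_le s y x hs hy h1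
  have h3 := exp_at_bound2 (Real.pi^2/4) y x (by positivity) hy hx
  have h4 : Real.exp (Real.pi^2/4/(2*y)) ≤ Real.exp (Real.pi^2/4/y) * (720 * 4^6 * y^6) := by
    calc _ ≤ Real.exp (Real.pi^2/4/y + -(1/(4*y))) := by
          gcongr
          have : 0 ≤ (Real.pi^2 - 2)/(8*y) := by
            have := Real.pi_gt_three
            apply div_nonneg _ (by positivity); nlinarith
          have e : Real.pi^2/4/y + -(1/(4*y)) = Real.pi^2/4/(2*y) + (Real.pi^2 - 2)/(8*y) := by field_simp; ring
          linarith
      _ ≤ _ := by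
          rw [Real.exp_add]; gcongr; exact exp_small y hy
  have h5 : y^(-s) * y^6 ≤ y ^ (7/2 - (r:ℝ)) := by
    have : y^(-s) * y^6 = y^(-s + 6) := by
      rw [Real.rpow_add hy, show (6:ℝ) = ((6:ℕ):ℝ) by norm_num, Real.rpow_natCast]
    rw [this]
    exact rpow_conv r y _ hy h1 (by linarith)
  calc _ ≤ (y^(-s) * (1 + ‖x‖^2) ^ (-(3/2:ℝ)/2)) * (Real.exp (Real.pi^2/4/y) * (720 * 4^6 * y^6)) := by
        gcongr
        exact h3.trans h4
    _ = (y^(-s) * y^6) * ((720 * 4^6) * Real.exp (Real.pi^2/4/y) * (1 + ‖x‖^2) ^ (-(3/2:ℝ)/2)) := by ring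
    _ ≤ y ^ (7/2 - (r:ℝ)) * ((720 * 4^6) * Real.exp (Real.pi^2/4/y) * (1 + ‖x‖^2) ^ (-(3/2:ℝ)/2)) := by gcongr
    _ = _ := by ring

lemma tail (r : ℕ) (hr : 3 ≤ r) (c0 c1 : ℂ) (N : ℕ) (x y : ℝ) (hy : 0 < y) (h1 : y ≤ 1) (hx : y ≤ |x|) :
    ‖MM c0 c1 r ((y:ℂ) + x * Complex.I) * Complex.exp (N * ((y:ℂ) + x * Complex.I))‖ ≤
      ((‖c0‖ + ‖c1‖) * (720 * 4^6) * y ^ (7/2 - (r:ℝ)) * (Real.exp (Real.pi^2/4/y) * Real.exp (N*y))) * (1 + ‖x‖^2) ^ (-(3/2:ℝ)/2) := by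
  have hr' : (3:ℝ) ≤ r := by exact_mod_cast hr
  have a0 := tail1 r N ((r:ℝ) - 1/2) x y (by linarith) (by linarith) hy h1 hx
  have a1 := tail1 r N ((r:ℝ) - 3/2) x y (by linarith) (by linarith) hy h1 hx
  have hN := norm_exp_nt N y x
  push_cast at hN
  rw [norm_mul, hN, MM, norm_mul]
  have hk : ‖((1/2 * Real.pi ^ (-(1/2):ℝ) : ℝ) : ℂ)‖ ≤ 1 := by
    rw [Complex.norm_real, Real.norm_of_nonneg (by positivity)]
    have : Real.pi ^ (-(1/2):ℝ) ≤ 1 := Real.rpow_le_one_of_one_le_of_nonpos (by linarith [Real.pi_gt_three]) (by norm_num)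
    linarith
  set T := (720 * 4^6) * y ^ (7/2 - (r:ℝ)) * Real.exp (Real.pi^2/4/y) * (1 + ‖x‖^2) ^ (-(3/2:ℝ)/2) with hT
  have hT0 : 0 ≤ T := by positivity
  calc _ ≤ 1 * (‖c0‖ * T + ‖c1‖ * T) * Real.exp (N*y) := by
        gcongr
        refine (norm_add_le _ _).trans ?_
        rw [norm_mul, norm_mul c1]
        gcongr
    _ = _ := by rw [hT]; ring

lemma MM_int (r : ℕ) (hr : 3 ≤ r) (c0 c1 : ℂ) (N : ℕ) (hN : 0 < N) (y : ℝ) (hy : 0 < y) (h1 : y ≤ 1) :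
    Integrable (fun x : ℝ => MM c0 c1 r ((y:ℂ) + x * Complex.I) * Complex.exp (N * ((y:ℂ) + x * Complex.I))) ∧
    ∫ x : ℝ, MM c0 c1 r ((y:ℂ) + x * Complex.I) * Complex.exp (N * ((y:ℂ) + x * Complex.I)) =
      ((1/2 * Real.pi ^ (-(1/2):ℝ) : ℝ) : ℂ) * (c0 * ((2 * Real.pi * (2 * Real.sqrt N / Real.pi)^((r:ℝ) - 3/2) * besselI ((r:ℝ) - 3/2) (Real.pi * Real.sqrt N) : ℝ) : ℂ)
        + c1 * ((2 * Real.pi * (2 * Real.sqrt N / Real.pi)^((r:ℝ) - 5/2) * besselI ((r:ℝ) - 5/2) (Real.pi * Real.sqrt N) : ℝ) : ℂ)) := by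
  have hr' : (3:ℝ) ≤ r := by exact_mod_cast hr
  have hN' : (0:ℝ) < N := by exact_mod_cast hN
  have ii : ∀ s : ℝ, 3/2 ≤ s → Integrable (fun x : ℝ => ((y:ℂ) + x * Complex.I) ^ (-(s:ℂ)) * Complex.exp ((Real.pi^2/4 : ℝ) / ((y:ℂ) + x * Complex.I)) * Complex.exp ((N:ℝ) * ((y:ℂ) + x * Complex.I))) := by
    intro s hs
    have h0 := te_int s y N hs hy h1
    have : Integrable (fun x : ℝ => (((y:ℂ) + x * Complex.I) ^ (-(s:ℂ)) * Complex.exp ((N:ℝ) * ((y:ℂ) + x * Complex.I))) * Complex.exp ((Real.pi^2/4 : ℝ) / ((y:ℂ) + x * Complex.I))) := by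
      refine h0.mul_bdd (c := Real.exp (Real.pi^2/4/y)) (Continuous.aestronglyMeasurable ?_) ?_
      · refine Complex.continuous_exp.comp (Continuous.div (by fun_prop) (by fun_prop) (fun x h => ?_))
        have := congrArg Complex.re h
        simp at this; linarith
      · exact Eventually.of_forall (fun x => exp_at_bound _ y x (by positivity) hy)
    refine this.congr (Eventually.of_forall (fun x => ?_))
    simp only; ring
  have i0 := ii ((r:ℝ) - 1/2) (by linarith)
  have i1 := ii ((r:ℝ) - 3/2) (by linarith)
  have v0 := inv3 ((r:ℝ) - 1/2) y N (by linarith) hy h1 hN'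
  have v1 := inv3 ((r:ℝ) - 3/2) y N (by linarith) hy h1 hN'
  rw [show (r:ℝ) - 1/2 - 1 = r - 3/2 by ring] at v0
  rw [show (r:ℝ) - 3/2 - 1 = r - 5/2 by ring] at v1
  have e : (fun x : ℝ => MM c0 c1 r ((y:ℂ) + x * Complex.I) * Complex.exp (N * ((y:ℂ) + x * Complex.I))) = fun x : ℝ =>
     ((1/2 * Real.pi ^ (-(1/2):ℝ) : ℝ) : ℂ) * (c0 * (((y:ℂ) + x * Complex.I) ^ (-(((r:ℝ) - 1/2 : ℝ):ℂ)) * Complex.exp ((Real.pi^2/4 : ℝ) / ((y:ℂ) + x * Complex.I)) * Complex.exp ((N:ℝ) * ((y:ℂ) + x * Complex.I))) + c1 * (((y:ℂ) + x * Complex.I) ^ (-(((r:ℝ) - 3/2 : ℝ):ℂ)) * Complex.exp ((Real.pi^2/4 : ℝ) / ((y:ℂ) + x * Complex.I)) * Complex.exp ((N:ℝ) * ((y:ℂ) + x * Complex.I)))) := by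
    ext x
    rw [MM, Complex.ofReal_natCast]; ring
  rw [e]
  constructor
  · exact ((i0.const_mul c0).add (i1.const_mul c1)).const_mul _
  · rw [integral_const_mul, integral_add (i0.const_mul c0) (i1.const_mul c1), integral_const_mul, integral_const_mul, v0, v1]

theorem combine (r : ℕ) (hr : 3 ≤ r) : ∃ c1 : ℂ, ∃ K : ℝ, 0 ≤ K ∧ ∀ (N : ℕ) (y : ℝ), 0 < N → 0 < y → y ≤ 1 →
    ‖2 * Real.pi * (etabar r N : ℂ) - ∫ x : ℝ, MM ((1 - 2 * (1/2)^r) * riemannZeta r) c1 r ((y:ℂ) + x * Complex.I) * Complex.exp (N * ((y:ℂ) + x * Complex.I))‖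
      ≤ K * y ^ (7/2 - (r:ℝ)) * (Real.exp (Real.pi^2/4/y) * Real.exp (N*y)) := by
  obtain ⟨c1, C, hC, hS⟩ := SS_major r hr
  set c0 := (1 - 2 * (1/2)^r) * riemannZeta r with hc0
  set J := ∫ x : ℝ, (1 + ‖x‖^2) ^ (-(3/2:ℝ)/2) with hJ
  have hJ0 : 0 ≤ J := integral_nonneg (fun x => by positivity)
  set K1 := 8 * (2 * (‖c0‖ + 2 * ‖c1‖ + 4 * C) + C) with hK1
  set K2 := 6 * Real.exp 2 * 2^(r+2) * (720 * 4^6) with hK2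
  set K3 := (‖c0‖ + ‖c1‖) * (720 * 4^6) with hK3
  have hK10 : 0 ≤ K1 := by positivity
  have hK20 : 0 ≤ K2 := by positivity
  have hK30 : 0 ≤ K3 := by positivity
  refine ⟨c1, 2 * K1 + 2 * Real.pi * K2 + K3 * J, by positivity, fun N y hN hy h1 => ?_⟩
  have hp := Real.pi_gt_three
  obtain ⟨gc, gv⟩ := coef r N (by omega) y hy
  obtain ⟨mi, -⟩ := MM_int r hr c0 c1 N hN y hy h1
  set m : ℝ → ℂ := fun x => MM c0 c1 r ((y:ℂ) + x * Complex.I) * Complex.exp (N * ((y:ℂ) + x * Complex.I)) with hm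
  set E := Real.exp (Real.pi^2/4/y) * Real.exp (N*y) with hE
  have hE0 : 0 < E := by positivity
  set Y := y ^ (7/2 - (r:ℝ)) with hY
  have hY0 : 0 < Y := by positivity
  set A := Set.Icc (-y) y with hA
  set P := Set.Ioc (-Real.pi) Real.pi with hPd
  have hAP : A ⊆ P := by
    intro x hx
    exact ⟨by linarith [hx.1], by linarith [hx.2]⟩
  have hAm : MeasurableSet A := measurableSet_Icc
  have hPm : MeasurableSet P := measurableSet_Ioc
  have gP : IntegrableOn (GG r N y) P := (gc.integrableOn_Icc (a := -Real.pi) (b := Real.pi)).mono_set Set.Ioc_subset_Icc_self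
  have gA := gP.mono_set hAP
  have mA : IntegrableOn m A := mi.integrableOn
  have s1 : ∫ x in P, GG r N y x = (∫ x in A, GG r N y x) + ∫ x in P \ A, GG r N y x := by
    rw [← setIntegral_union Set.disjoint_sdiff_right (hPm.diff hAm) gA (gP.mono_set Set.sdiff_subset), Set.union_sdiff_cancel hAP]
  have s2 : ∫ x, m x = (∫ x in A, m x) + ∫ x in Aᶜ, m x := (integral_add_compl hAm mi).symm
  have b1 : ‖∫ x in A, (GG r N y x - m x)‖ ≤ 2 * K1 * Y * E := by
    have := norm_setIntegral_le_of_norm_le_const (μ := volume) (s := A) (f := fun x => GG r N y x - m x) (C := K1 * y ^ (5/2 - (r:ℝ)) * E) (by simp [hA]) (fun x hx => 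
      major r c0 c1 C hC hS N x y hy h1 (abs_le.2 hx))
    refine this.trans (le_of_eq ?_)
    have hv : volume.real A = 2 * y := by
      rw [hA, Real.volume_real_Icc_of_le (by linarith)]; ring
    have hYe : Y = y ^ (5/2 - (r:ℝ)) * y := by
      rw [hY, ← Real.rpow_add_one hy.ne']; congr 1; ring
    rw [hv, hYe]; ring
  have hnA : ∀ x, x ∉ A → y ≤ |x| := by
    intro x hx
    by_contra h
    push Not at h
    exact hx (abs_le.1 h.le)
  have b2 : ‖∫ x in P \ A, GG r N y x‖ ≤ 2 * Real.pi * K2 * Y * E := by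
    have hfin : volume (P \ A) < ⊤ := (measure_mono Set.sdiff_subset).trans_lt (by simp [hPd])
    have := norm_setIntegral_le_of_norm_le_const (μ := volume) (s := P \ A) (f := fun x => GG r N y x) (C := K2 * Y * E) hfin (fun x hx => 
      minor r N x y hy h1 (hnA x hx.2) (abs_le.2 ⟨hx.1.1.le, hx.1.2⟩))
    refine this.trans ?_
    have hv : volume.real (P \ A) ≤ 2 * Real.pi := by
      calc volume.real (P \ A) ≤ volume.real P := measureReal_mono Set.sdiff_subset (by simp [hPd])
        _ = 2 * Real.pi := by rw [hPd, Real.volume_real_Ioc_of_le (by linarith)]; ring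
    calc K2 * Y * E * volume.real (P \ A) ≤ K2 * Y * E * (2 * Real.pi) := by gcongr
      _ = _ := by ring
  have b3 : ‖∫ x in Aᶜ, m x‖ ≤ K3 * J * Y * E := by
    have := norm_integral_le_of_norm_le (μ := volume.restrict Aᶜ) (f := m) (g := fun x => (K3 * Y * E) * (1 + ‖x‖^2) ^ (-(3/2:ℝ)/2))
      ((jap_int.const_mul _).integrableOn) ((ae_restrict_mem hAm.compl).mono (fun x hx => 
      tail r hr c0 c1 N x y hy h1 (hnA x hx)))
    refine this.trans ?_
    calc _ ≤ ∫ x : ℝ, (K3 * Y * E) * (1 + ‖x‖^2) ^ (-(3/2:ℝ)/2) :=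
          setIntegral_le_integral (jap_int.const_mul _) (Eventually.of_forall fun x => by positivity)
      _ = _ := by rw [integral_const_mul]; ring
  rw [integral_sub gA mA] at b1
  rw [← gv, s1, s2]
  have e : (∫ x in A, GG r N y x) + (∫ x in P \ A, GG r N y x) - ((∫ x in A, m x) + ∫ x in Aᶜ, m x) =
    ((∫ x in A, GG r N y x) - ∫ x in A, m x) + (∫ x in P \ A, GG r N y x) - ∫ x in Aᶜ, m x := by ring
  rw [e]
  have n1 := norm_sub_le (((∫ x in A, GG r N y x) - ∫ x in A, m x) + (∫ x in P \ A, GG r N y x)) (∫ x in Aᶜ, m x)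
  have n2 := norm_add_le ((∫ x in A, GG r N y x) - ∫ x in A, m x) (∫ x in P \ A, GG r N y x)
  have : (2 * K1 + 2 * Real.pi * K2 + K3 * J) * Y * E = 2 * K1 * Y * E + 2 * Real.pi * K2 * Y * E + K3 * J * Y * E := by ring
  linarith
end EtaAux

/-- Asymptotic formula for the positive symmetrized rank moments via Bessel functions. -/
theorem etabar_asymptotic (r : ℕ) (hr : 3 ≤ r) :
    ∃ d : ℝ, ∃ C : ℝ, 0 < C ∧ ∃ N₀ : ℕ, ∀ N : ℕ, N₀ ≤ N →
      |etabar r N -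
          (2 ^ ((r : ℝ) - 5 / 2) * Real.pi ^ (1 - (r : ℝ)) * (riemannZeta r).re *
              (1 - 2 ^ (1 - (r : ℝ)))) *
            (N : ℝ) ^ ((r : ℝ) / 2 - 3 / 4) * besselI ((r : ℝ) - 3 / 2) (Real.pi * Real.sqrt N) -
          d * (N : ℝ) ^ ((r : ℝ) / 2 - 5 / 4) *
            besselI ((r : ℝ) - 5 / 2) (Real.pi * Real.sqrt N)| ≤
        C * (N : ℝ) ^ ((r : ℝ) / 2 - 7 / 4) * Real.exp (Real.pi * Real.sqrt N) := by
  obtain ⟨c1, K, hK, hmain⟩ := EtaAux.combine r hr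
  have hp := Real.pi_gt_three
  have hp0 := Real.pi_pos
  set κ : ℝ := 1/2 * Real.pi ^ (-(1/2):ℝ) with hκ
  refine ⟨κ * c1.re * (2/Real.pi)^((r:ℝ) - 5/2), K * (Real.pi/2)^(7/2 - (r:ℝ)) + 1, by positivity, 4, fun N hN => ?_⟩
  have hN0 : 0 < N := by omega
  have hNr : (4:ℝ) ≤ N := by exact_mod_cast hN
  have hNp : (0:ℝ) < N := by linarith
  set q := Real.sqrt N with hq
  have hq2 : 2 ≤ q := Real.le_sqrt_of_sq_le (by linarith)
  have hqq : q^2 = N := Real.sq_sqrt hNp.le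
  have hqp : 0 < q := by linarith
  set y := Real.pi / (2*q) with hy
  have hyp : 0 < y := by positivity
  have hy1 : y ≤ 1 := by
    rw [hy, div_le_one (by positivity)]
    linarith [Real.pi_lt_four]
  have hb := hmain N y hN0 hyp hy1
  rw [(EtaAux.MM_int r hr _ c1 N hN0 y hyp hy1).2] at hb
  rw [← hq] at hb
  have hexp : Real.exp (Real.pi^2/4/y) * Real.exp (N*y) = Real.exp (Real.pi * q) := by
    rw [← Real.exp_add, ← hqq, hy]
    congr 1; field_simp; ring
  rw [hexp] at hb
  set B0 := besselI ((r:ℝ) - 3/2) (Real.pi * q) with hB0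
  set B1 := besselI ((r:ℝ) - 5/2) (Real.pi * q) with hB1
  -- powers of N
  have hqpow : ∀ e : ℝ, q^e = (N:ℝ)^(e/2) := by
    intro e
    rw [hq, Real.sqrt_eq_rpow, ← Real.rpow_mul hNp.le]; congr 1; ring
  have w0 : (2 * q / Real.pi)^((r:ℝ) - 3/2) = (2/Real.pi)^((r:ℝ) - 3/2) * (N:ℝ)^((r:ℝ)/2 - 3/4) := by
    rw [show 2*q/Real.pi = 2/Real.pi * q by ring, Real.mul_rpow (by positivity) hqp.le, hqpow]
    congr 2; ring
  have w1 : (2 * q / Real.pi)^((r:ℝ) - 5/2) = (2/Real.pi)^((r:ℝ) - 5/2) * (N:ℝ)^((r:ℝ)/2 - 5/4) := by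
    rw [show 2*q/Real.pi = 2/Real.pi * q by ring, Real.mul_rpow (by positivity) hqp.le, hqpow]
    congr 2; ring
  have wy : y ^ (7/2 - (r:ℝ)) = (Real.pi/2)^(7/2 - (r:ℝ)) * (N:ℝ)^((r:ℝ)/2 - 7/4) := by
    rw [show y = Real.pi/2 * q⁻¹ by rw [hy]; field_simp, Real.mul_rpow (by positivity) (by positivity),
      Real.inv_rpow hqp.le, ← Real.rpow_neg hqp.le, hqpow]
    congr 2; ring
  have wc : κ * (2/Real.pi)^((r:ℝ) - 3/2) = 2 ^ ((r:ℝ) - 5/2) * Real.pi ^ (1 - (r:ℝ)) := by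
    rw [hκ, Real.div_rpow (by norm_num) hp0.le, div_eq_mul_inv (2 ^ ((r:ℝ) - 3/2)), ← Real.rpow_neg hp0.le,
      show (r:ℝ) - 3/2 = ((r:ℝ) - 5/2) + 1 by ring, Real.rpow_add_one (by norm_num),
      show (1 - (r:ℝ)) = -(1/2) + -((r:ℝ) - 5/2 + 1) by ring, Real.rpow_add hp0]
    ring
  have wz : (1 - 2 * (1/2:ℝ)^r) = 1 - 2 ^ (1 - (r:ℝ)) := by
    rw [Real.rpow_sub (by norm_num), Real.rpow_natCast, Real.rpow_one, one_div, inv_pow]; rfl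
  have hc0 : (1 - 2 * (1/2:ℂ)^r) * riemannZeta r = ((1 - 2 * (1/2:ℝ)^r : ℝ) : ℂ) * riemannZeta r := by push_cast; rfl
  rw [hc0] at hb
  have hre := (Complex.abs_re_le_norm _).trans hb
  have ere : (2 * (Real.pi:ℂ) * (etabar r N : ℂ) - (κ:ℂ) * (((1 - 2 * (1/2:ℝ)^r : ℝ) : ℂ) * riemannZeta r * ((2 * Real.pi * (2 * q / Real.pi)^((r:ℝ) - 3/2) * B0 : ℝ) : ℂ) + c1 * ((2 * Real.pi * (2 * q / Real.pi)^((r:ℝ) - 5/2) * B1 : ℝ) : ℂ))).re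
     = 2 * Real.pi * etabar r N - κ * ((1 - 2 * (1/2:ℝ)^r) * (riemannZeta r).re * (2 * Real.pi * (2 * q / Real.pi)^((r:ℝ) - 3/2) * B0) + c1.re * (2 * Real.pi * (2 * q / Real.pi)^((r:ℝ) - 5/2) * B1)) := by
    have e2 : (2 * (Real.pi:ℂ) * (etabar r N : ℂ)) = ((2 * Real.pi * etabar r N : ℝ) : ℂ) := by push_cast; rfl
    rw [Complex.sub_re, e2, Complex.ofReal_re, Complex.re_ofReal_mul, Complex.add_re, Complex.re_mul_ofReal, Complex.re_ofReal_mul, Complex.re_mul_ofReal]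
  rw [ere, w0, w1, wy, wz] at hre
  have efin : 2 * Real.pi * etabar r N - κ * ((1 - 2 ^ (1 - (r:ℝ))) * (riemannZeta r).re * (2 * Real.pi * ((2/Real.pi)^((r:ℝ) - 3/2) * (N:ℝ)^((r:ℝ)/2 - 3/4)) * B0) + c1.re * (2 * Real.pi * ((2/Real.pi)^((r:ℝ) - 5/2) * (N:ℝ)^((r:ℝ)/2 - 5/4)) * B1))
    = (2 * Real.pi) * (etabar r N - (2 ^ ((r : ℝ) - 5 / 2) * Real.pi ^ (1 - (r : ℝ)) * (riemannZeta r).re * (1 - 2 ^ (1 - (r : ℝ)))) * (N : ℝ) ^ ((r : ℝ) / 2 - 3 / 4) * B0 - κ * c1.re * (2/Real.pi)^((r:ℝ) - 5/2) * (N : ℝ) ^ ((r : ℝ) / 2 - 5 / 4) * B1) := by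
    rw [← wc]; ring
  rw [efin, abs_mul, abs_of_pos (by positivity)] at hre
  set D := |etabar r N - (2 ^ ((r : ℝ) - 5 / 2) * Real.pi ^ (1 - (r : ℝ)) * (riemannZeta r).re * (1 - 2 ^ (1 - (r : ℝ)))) * (N : ℝ) ^ ((r : ℝ) / 2 - 3 / 4) * B0 - κ * c1.re * (2/Real.pi)^((r:ℝ) - 5/2) * (N : ℝ) ^ ((r : ℝ) / 2 - 5 / 4) * B1| with hD
  have hD0 : 0 ≤ D := abs_nonneg _
  have h1 : D ≤ 2 * Real.pi * D := by nlinarith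
  have h2 : 0 ≤ (N:ℝ)^((r:ℝ)/2 - 7/4) * Real.exp (Real.pi * q) := by positivity
  calc D ≤ _ := h1.trans hre
    _ ≤ (K * (Real.pi/2)^(7/2 - (r:ℝ)) + 1) * (N:ℝ)^((r:ℝ)/2 - 7/4) * Real.exp (Real.pi * q) := by nlinarith
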